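/- Let ψ be a smooth global degree-one 1-equivariant wave map (ψ(t,0⁺) = 0, ψ(t,∞) = π) with E(ψ⃗) < 3E(Q) = 12, and let α_n → ∞ be any sequence. Then there exist sequences τ_n → ∞ and λ_n > 0 with α_nλ_n/τ_n → 0, and A_n → ∞ with λ_n ≤ A_n and A_n/τ_n → 0, such that as n → ∞: (a) ∫₀^{τ_n−A_n} (∂_tψ)²(τ_n,r) r dr → 0; and (b) ∫₀^{α_nλ_n} [ (∂_rψ(τ_n,r) − λ_n^{−1}Q'(r/λ_n))² + (ψ(τ_n,r) − Q(r/λ_n))²/r² ] r dr → 0. -/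

import Mathlib

open MeasureTheory Real Filter Set

noncomputable section

/-- The ground state harmonic map `Q(r) = 2 arctan r`. -/
def Q (r : ℝ) : ℝ := 2 * Real.arctan r

/-- Time derivative `∂ₜψ(t,r)`. -/
def pT (ψ : ℝ → ℝ → ℝ) (t r : ℝ) : ℝ := deriv (fun s => ψ s r) t

/-- Radial derivative `∂ᵣψ(t,r)`. -/
def pR (ψ : ℝ → ℝ → ℝ) (t r : ℝ) : ℝ := deriv (fun ρ => ψ t ρ) r

/-- Energy density `((∂ₜψ)² + (∂ᵣψ)² + sin²ψ/r²) · r`. -/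
def eDen (ψ : ℝ → ℝ → ℝ) (t r : ℝ) : ℝ :=
  ((pT ψ t r) ^ 2 + (pR ψ t r) ^ 2 + (Real.sin (ψ t r)) ^ 2 / r ^ 2) * r

/-- Localized energy `E_{r₁}^{r₂}(ψ⃗(t))`. -/
def locE (ψ : ℝ → ℝ → ℝ) (t r₁ r₂ : ℝ) : ℝ := ∫ r in Set.Ioc r₁ r₂, eDen ψ t r

/-- Total energy `E(ψ⃗(t))`. -/
def totE (ψ : ℝ → ℝ → ℝ) (t : ℝ) : ℝ := ∫ r in Set.Ioi (0:ℝ), eDen ψ t r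

/-- `ψ` is a smooth global 1-equivariant wave map on `[0,∞) × (0,∞)`. -/
def IsWaveMap (ψ : ℝ → ℝ → ℝ) : Prop :=
  ContDiffOn ℝ (⊤ : ℕ∞) (fun p : ℝ × ℝ => ψ p.1 p.2) (Set.Ici (0:ℝ) ×ˢ Set.Ioi (0:ℝ)) ∧
  ∀ t r : ℝ, 0 ≤ t → 0 < r →
    deriv (fun s => pT ψ s r) t - deriv (fun ρ => pR ψ t ρ) r
      - (1 / r) * pR ψ t r + Real.sin (2 * ψ t r) / (2 * r ^ 2) = 0

/-- Finite energy: the energy density is integrable at each time `t ≥ 0`. -/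
def FiniteEnergy (ψ : ℝ → ℝ → ℝ) : Prop :=
  ∀ t : ℝ, 0 ≤ t → MeasureTheory.IntegrableOn (eDen ψ t) (Set.Ioi 0) volume

/-- The energy is conserved. -/
def EnergyConserved (ψ : ℝ → ℝ → ℝ) : Prop :=
  ∀ t : ℝ, 0 ≤ t → totE ψ t = totE ψ 0

/-- Squared `H × L²` norm density `(ψ₁² + (∂ᵣψ₀)² + ψ₀²/r²) · r`. -/
def hl2Den (f g : ℝ → ℝ) (r : ℝ) : ℝ :=
  ((g r) ^ 2 + (deriv f r) ^ 2 + (f r) ^ 2 / r ^ 2) * r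

/-- Squared `H × L²` norm of the pair `(f, g)` over the set of radii `S`. -/
def hl2Sq (f g : ℝ → ℝ) (S : Set ℝ) : ℝ := ∫ r in S, hl2Den f g r

/-- Squared `H` norm of `f` over the set of radii `S`. -/
def hSq (f : ℝ → ℝ) (S : Set ℝ) : ℝ :=
  ∫ r in S, ((deriv f r) ^ 2 + (f r) ^ 2 / r ^ 2) * r

/-- Squared (radial) `L²` norm. -/
def l2Sq (g : ℝ → ℝ) : ℝ := ∫ r in Set.Ioi (0:ℝ), (g r) ^ 2 * r

/-- Wave map energy of a pair of data `(f, g)`. -/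
def pairE (f g : ℝ → ℝ) : ℝ :=
  ∫ r in Set.Ioi (0:ℝ), ((g r) ^ 2 + (deriv f r) ^ 2 + (Real.sin (f r)) ^ 2 / r ^ 2) * r

/-- `φ` is a smooth solution of the linearized equation
`φ_tt − φ_rr − (1/r) φ_r + φ/r² = 0` on `ℝ × (0,∞)`. -/
def IsLinearWave (φ : ℝ → ℝ → ℝ) : Prop :=
  ContDiffOn ℝ (⊤ : ℕ∞) (fun p : ℝ × ℝ => φ p.1 p.2) (Set.univ ×ˢ Set.Ioi (0:ℝ)) ∧
  ∀ t r : ℝ, 0 < r →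
    deriv (fun s => pT φ s r) t - deriv (fun ρ => pR φ t ρ) r
      - (1 / r) * pR φ t r + φ t r / r ^ 2 = 0

/-- A linear wave has finite energy: its `H × L²` density is integrable at each time. -/
def LinFiniteEnergy (φ : ℝ → ℝ → ℝ) : Prop :=
  ∀ t : ℝ, MeasureTheory.IntegrableOn (hl2Den (φ t) (pT φ t)) (Set.Ioi 0) volume

/-- Degree one boundary conditions: `ψ(t,0⁺) = 0`, `ψ(t,∞) = π`. -/
def DegreeOneBC (ψ : ℝ → ℝ → ℝ) : Prop :=
  ∀ t : ℝ, 0 ≤ t →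
    Filter.Tendsto (ψ t) (nhdsWithin 0 (Set.Ioi 0)) (nhds 0) ∧
    Filter.Tendsto (ψ t) Filter.atTop (nhds Real.pi)

/-- Degree zero boundary conditions: `φ(t,0⁺) = 0`, `φ(t,∞) = 0`. -/
def DegreeZeroBC (φ : ℝ → ℝ → ℝ) : Prop :=
  ∀ t : ℝ, 0 ≤ t →
    Filter.Tendsto (φ t) (nhdsWithin 0 (Set.Ioi 0)) (nhds 0) ∧
    Filter.Tendsto (φ t) Filter.atTop (nhds 0)

/-- Divergence theorem on the region `{(t, p₀ + p₁ t + y (q₀ + q₁ t))}` swept by `t ∈ [T, T']` and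
`y ∈ [y₀, y₁]`, for a pair of functions with `∂ₜF + ∂ᵣG = H`. -/
theorem divergence_sweep (p0 p1 q0 q1 : ℝ) {T T' y0 y1 : ℝ} (hT : T ≤ T') (hy : y0 ≤ y1)
    {F G H : ℝ → ℝ → ℝ}
    (hF : ∀ t ∈ Icc T T', ∀ y ∈ Icc y0 y1,
      DifferentiableAt ℝ (fun p : ℝ × ℝ => F p.1 p.2) (t, p0 + p1 * t + y * (q0 + q1 * t)))
    (hG : ∀ t ∈ Icc T T', ∀ y ∈ Icc y0 y1,
      DifferentiableAt ℝ (fun p : ℝ × ℝ => G p.1 p.2) (t, p0 + p1 * t + y * (q0 + q1 * t)))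
    (hH : ∀ t ∈ Icc T T', ∀ y ∈ Icc y0 y1, ∃ a b,
      HasDerivAt (fun s => F s (p0 + p1 * t + y * (q0 + q1 * t))) a t ∧
      HasDerivAt (fun ρ => G t ρ) b (p0 + p1 * t + y * (q0 + q1 * t)) ∧
      a + b = H t (p0 + p1 * t + y * (q0 + q1 * t)))
    (hHc : ContinuousOn (fun p : ℝ × ℝ => H p.1 (p0 + p1 * p.1 + p.2 * (q0 + q1 * p.1)))
      (Icc T T' ×ˢ Icc y0 y1)) :
    ∫ t in T..T', ∫ y in y0..y1, (q0 + q1 * t) * H t (p0 + p1 * t + y * (q0 + q1 * t)) =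
      (∫ y in y0..y1, (q0 + q1 * T') * F T' (p0 + p1 * T' + y * (q0 + q1 * T')))
      - (∫ y in y0..y1, (q0 + q1 * T) * F T (p0 + p1 * T + y * (q0 + q1 * T)))
      + (∫ t in T..T', (G t (p0 + p1 * t + y1 * (q0 + q1 * t))
          - (p1 + y1 * q1) * F t (p0 + p1 * t + y1 * (q0 + q1 * t))))
      - (∫ t in T..T', (G t (p0 + p1 * t + y0 * (q0 + q1 * t))
          - (p1 + y0 * q1) * F t (p0 + p1 * t + y0 * (q0 + q1 * t)))) := by
  set Φ : ℝ × ℝ → ℝ × ℝ := fun x => (x.1, p0 + p1 * x.1 + x.2 * (q0 + q1 * x.1)) with hΦ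
  set Φ' : ℝ × ℝ → ℝ × ℝ →L[ℝ] ℝ × ℝ := fun x =>
    (ContinuousLinearMap.fst ℝ ℝ ℝ).prod
      ((p1 + x.2 * q1) • ContinuousLinearMap.fst ℝ ℝ ℝ
        + (q0 + q1 * x.1) • ContinuousLinearMap.snd ℝ ℝ ℝ) with hΦ'
  have hfst : ∀ x : ℝ × ℝ, HasFDerivAt (fun x : ℝ × ℝ => x.1) (ContinuousLinearMap.fst ℝ ℝ ℝ) x :=
    fun x => hasFDerivAt_fst
  have hsnd : ∀ x : ℝ × ℝ, HasFDerivAt (fun x : ℝ × ℝ => x.2) (ContinuousLinearMap.snd ℝ ℝ ℝ) x :=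
    fun x => hasFDerivAt_snd
  have hq : ∀ x : ℝ × ℝ, HasFDerivAt (fun x : ℝ × ℝ => q0 + q1 * x.1)
      (q1 • ContinuousLinearMap.fst ℝ ℝ ℝ) x := fun x => ((hfst x).const_mul q1).const_add q0
  have hp : ∀ x : ℝ × ℝ, HasFDerivAt (fun x : ℝ × ℝ => p1 + x.2 * q1)
      (q1 • ContinuousLinearMap.snd ℝ ℝ ℝ) x := fun x => ((hsnd x).mul_const q1).const_add p1
  have hΦd : ∀ x, HasFDerivAt Φ (Φ' x) x := by
    intro x
    refine (hfst x).prodMk ?_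
    have := (((hfst x).const_mul p1).const_add p0).add ((hsnd x).mul (hq x))
    refine this.congr_fderiv ?_
    ext <;> simp
  set F2 : ℝ × ℝ → ℝ := fun p => F p.1 p.2 with hF2
  set G2 : ℝ × ℝ → ℝ := fun p => G p.1 p.2 with hG2
  have hF' : ∀ x ∈ Icc T T' ×ˢ Icc y0 y1,
      HasFDerivAt (fun x => F2 (Φ x)) ((fderiv ℝ F2 (Φ x)).comp (Φ' x)) x := fun x hx =>
    HasFDerivAt.comp (g := F2) x (hF x.1 hx.1 x.2 hx.2).hasFDerivAt (hΦd x)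
  have hG' : ∀ x ∈ Icc T T' ×ˢ Icc y0 y1,
      HasFDerivAt (fun x => G2 (Φ x)) ((fderiv ℝ G2 (Φ x)).comp (Φ' x)) x := fun x hx =>
    HasFDerivAt.comp (g := G2) x (hG x.1 hx.1 x.2 hx.2).hasFDerivAt (hΦd x)
  have hf := fun x hx => (hq x).mul (hF' x hx)
  have hg := fun x hx => (hG' x hx).sub ((hp x).mul (hF' x hx))
  set f' : ℝ × ℝ → ℝ × ℝ →L[ℝ] ℝ := fun x => (q0 + q1 * x.1) • (fderiv ℝ F2 (Φ x)).comp (Φ' x)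
    + F2 (Φ x) • q1 • ContinuousLinearMap.fst ℝ ℝ ℝ with hf'
  set g' : ℝ × ℝ → ℝ × ℝ →L[ℝ] ℝ := fun x => (fderiv ℝ G2 (Φ x)).comp (Φ' x)
    - ((p1 + x.2 * q1) • (fderiv ℝ F2 (Φ x)).comp (Φ' x)
    + F2 (Φ x) • q1 • ContinuousLinearMap.snd ℝ ℝ ℝ) with hg'
  have key : ∀ x ∈ Icc T T' ×ˢ Icc y0 y1,
      f' x (1, 0) + g' x (0, 1) = (q0 + q1 * x.1) * H (Φ x).1 (Φ x).2 := by
    intro x hx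
    obtain ⟨a, b, ha, hb, hab⟩ := hH x.1 hx.1 x.2 hx.2
    have ha' : a = fderiv ℝ F2 (Φ x) (1, 0) := by
      have h1 : HasDerivAt (fun s : ℝ => ((s, (Φ x).2) : ℝ × ℝ)) (1, 0) x.1 :=
        (hasDerivAt_id _).prodMk (hasDerivAt_const _ _)
      exact ha.unique (HasFDerivAt.comp_hasDerivAt (l := F2) x.1 (hF x.1 hx.1 x.2 hx.2).hasFDerivAt h1)
    have hb' : b = fderiv ℝ G2 (Φ x) (0, 1) := by
      have h1 : HasDerivAt (fun s : ℝ => ((x.1, s) : ℝ × ℝ)) (0, 1) (Φ x).2 :=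
        (hasDerivAt_const _ _).prodMk (hasDerivAt_id _)
      exact hb.unique (HasFDerivAt.comp_hasDerivAt (l := G2) (Φ x).2 (hG x.1 hx.1 x.2 hx.2).hasFDerivAt h1)
    have e1 : Φ' x (1, 0) = (1, 0) + (p1 + x.2 * q1) • ((0, 1) : ℝ × ℝ) := by
      ext <;> simp [hΦ']
    have e2 : Φ' x (0, 1) = (q0 + q1 * x.1) • ((0, 1) : ℝ × ℝ) := by
      ext <;> simp [hΦ']
    change _ = _ * H x.1 (p0 + p1 * x.1 + x.2 * (q0 + q1 * x.1))
    rw [← hab, ha', hb']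
    simp only [hf', hg', _root_.add_apply, _root_.sub_apply,
      _root_.smul_apply, ContinuousLinearMap.comp_apply, e1, e2, map_add, map_smul,
      ContinuousLinearMap.coe_fst', ContinuousLinearMap.coe_snd', smul_eq_mul]
    ring
  have hrect : uIcc T T' ×ˢ uIcc y0 y1 = Icc T T' ×ˢ Icc y0 y1 := by
    rw [uIcc_of_le hT, uIcc_of_le hy]
  have hint : ContinuousOn (fun x : ℝ × ℝ => (q0 + q1 * x.1) * H (Φ x).1 (Φ x).2)
      (Icc T T' ×ˢ Icc y0 y1) :=
    ContinuousOn.mul (by fun_prop) hHc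
  have main := integral2_divergence_prod_of_hasFDerivAt (E := ℝ)
    (fun x => (q0 + q1 * x.1) * F2 (Φ x))
    (fun x => G2 (Φ x) - (p1 + x.2 * q1) * F2 (Φ x)) f' g' T y0 T' y1
    (by rw [hrect]; exact fun x hx => (hf x hx).continuousAt.continuousWithinAt)
    (by rw [hrect]; exact fun x hx => (hg x hx).continuousAt.continuousWithinAt)
    (by
      rw [min_eq_left hT, max_eq_right hT, min_eq_left hy, max_eq_right hy]
      exact fun x hx => hf x ⟨Ioo_subset_Icc_self hx.1, Ioo_subset_Icc_self hx.2⟩)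
    (by
      rw [min_eq_left hT, max_eq_right hT, min_eq_left hy, max_eq_right hy]
      exact fun x hx => hg x ⟨Ioo_subset_Icc_self hx.1, Ioo_subset_Icc_self hx.2⟩)
    (by
      rw [hrect]
      refine IntegrableOn.congr_fun (hint.integrableOn_compact (isCompact_Icc.prod isCompact_Icc))
        (fun x hx => (key x hx).symm) (measurableSet_Icc.prod measurableSet_Icc))
  have lhs : (∫ t in T..T', ∫ y in y0..y1, f' (t, y) (1, 0) + g' (t, y) (0, 1)) =
      ∫ t in T..T', ∫ y in y0..y1, (q0 + q1 * t) * H t (p0 + p1 * t + y * (q0 + q1 * t)) := by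
    refine intervalIntegral.integral_congr fun t ht => ?_
    refine intervalIntegral.integral_congr fun y hy' => ?_
    rw [uIcc_of_le hT] at ht
    rw [uIcc_of_le hy] at hy'
    exact key (t, y) ⟨ht, hy'⟩
  rw [← lhs, main]
  simp only [hF2, hG2, hΦ]
  ring

/-- A smooth global degree-one wave map of finite conserved energy below three times the energy
of the ground state. -/
structure DegOneWave (ψ : ℝ → ℝ → ℝ) : Prop where
  wave : IsWaveMap ψ
  finite : FiniteEnergy ψ
  conserved : EnergyConserved ψ
  bc : DegreeOneBC ψ
  small : totE ψ 0 < 12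

theorem DifferentiableAt.hasDerivAt_slice_left {f : ℝ × ℝ → ℝ} {t r : ℝ}
    (hf : DifferentiableAt ℝ f (t, r)) :
    HasDerivAt (fun s => f (s, r)) (fderiv ℝ f (t, r) (1, 0)) t :=
  HasFDerivAt.comp_hasDerivAt (l := f) t hf.hasFDerivAt
    ((hasDerivAt_id _).prodMk (hasDerivAt_const _ _))

theorem DifferentiableAt.hasDerivAt_slice_right {f : ℝ × ℝ → ℝ} {t r : ℝ}
    (hf : DifferentiableAt ℝ f (t, r)) :
    HasDerivAt (fun s => f (t, s)) (fderiv ℝ f (t, r) (0, 1)) r :=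
  HasFDerivAt.comp_hasDerivAt (l := f) r hf.hasFDerivAt
    ((hasDerivAt_const _ _).prodMk (hasDerivAt_id _))

namespace DegOneWave

variable {ψ : ℝ → ℝ → ℝ}

theorem contDiffAt (h : DegOneWave ψ) {p : ℝ × ℝ} (ht : 0 < p.1) (hr : 0 < p.2) :
    ContDiffAt ℝ (⊤ : ℕ∞) (fun p : ℝ × ℝ => ψ p.1 p.2) p :=
  h.wave.1.contDiffAt (prod_mem_nhds (Ici_mem_nhds ht) (Ioi_mem_nhds hr))

theorem differentiableAt (h : DegOneWave ψ) {t r : ℝ} (ht : 0 < t) (hr : 0 < r) :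
    DifferentiableAt ℝ (fun p : ℝ × ℝ => ψ p.1 p.2) (t, r) :=
  (h.contDiffAt (p := (t, r)) ht hr).differentiableAt (by simp)

theorem pT_eq (h : DegOneWave ψ) {t r : ℝ} (ht : 0 < t) (hr : 0 < r) :
    pT ψ t r = fderiv ℝ (fun p : ℝ × ℝ => ψ p.1 p.2) (t, r) (1, 0) :=
  (h.differentiableAt ht hr).hasDerivAt_slice_left.deriv

theorem pR_eq (h : DegOneWave ψ) {t r : ℝ} (ht : 0 < t) (hr : 0 < r) :
    pR ψ t r = fderiv ℝ (fun p : ℝ × ℝ => ψ p.1 p.2) (t, r) (0, 1) :=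
  (h.differentiableAt ht hr).hasDerivAt_slice_right.deriv

theorem hasDerivAt_t (h : DegOneWave ψ) {t r : ℝ} (ht : 0 < t) (hr : 0 < r) :
    HasDerivAt (fun s => ψ s r) (pT ψ t r) t := by
  rw [h.pT_eq ht hr]
  exact (h.differentiableAt ht hr).hasDerivAt_slice_left

theorem hasDerivAt_r (h : DegOneWave ψ) {t r : ℝ} (ht : 0 < t) (hr : 0 < r) :
    HasDerivAt (fun ρ => ψ t ρ) (pR ψ t r) r := by
  rw [h.pR_eq ht hr]
  exact (h.differentiableAt ht hr).hasDerivAt_slice_right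

theorem eventually_pos {t r : ℝ} (ht : 0 < t) (hr : 0 < r) :
    ∀ᶠ p : ℝ × ℝ in nhds (t, r), 0 < p.1 ∧ 0 < p.2 :=
  (prod_mem_nhds (Ioi_mem_nhds ht) (Ioi_mem_nhds hr) : _)

theorem contDiffAt_fderiv (h : DegOneWave ψ) {t r : ℝ} (ht : 0 < t) (hr : 0 < r) :
    ContDiffAt ℝ 1 (fderiv ℝ (fun p : ℝ × ℝ => ψ p.1 p.2)) (t, r) :=
  ContDiffAt.fderiv_right (n := (⊤ : ℕ∞)) (h.contDiffAt (p := (t, r)) ht hr)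
    (by norm_num; exact WithTop.coe_le_coe.2 le_top)

theorem hasFDerivAt_pT (h : DegOneWave ψ) {t r : ℝ} (ht : 0 < t) (hr : 0 < r) :
    HasFDerivAt (fun p : ℝ × ℝ => pT ψ p.1 p.2)
      ((fderiv ℝ (fderiv ℝ (fun p : ℝ × ℝ => ψ p.1 p.2)) (t, r)).flip (1, 0)) (t, r) := by
  have h1 := ((h.contDiffAt_fderiv ht hr).differentiableAt (by simp)).hasFDerivAt.clm_apply
    (hasFDerivAt_const ((1, 0) : ℝ × ℝ) (t, r))
  refine (h1.congr_of_eventuallyEq ?_).congr_fderiv ?_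
  · filter_upwards [eventually_pos ht hr] with p hp
    exact h.pT_eq hp.1 hp.2
  · ext <;> simp

theorem hasFDerivAt_pR (h : DegOneWave ψ) {t r : ℝ} (ht : 0 < t) (hr : 0 < r) :
    HasFDerivAt (fun p : ℝ × ℝ => pR ψ p.1 p.2)
      ((fderiv ℝ (fderiv ℝ (fun p : ℝ × ℝ => ψ p.1 p.2)) (t, r)).flip (0, 1)) (t, r) := by
  have h1 := ((h.contDiffAt_fderiv ht hr).differentiableAt (by simp)).hasFDerivAt.clm_apply
    (hasFDerivAt_const ((0, 1) : ℝ × ℝ) (t, r))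
  refine (h1.congr_of_eventuallyEq ?_).congr_fderiv ?_
  · filter_upwards [eventually_pos ht hr] with p hp
    exact h.pR_eq hp.1 hp.2
  · ext <;> simp

theorem differentiableAt_pT (h : DegOneWave ψ) {t r : ℝ} (ht : 0 < t) (hr : 0 < r) :
    DifferentiableAt ℝ (fun p : ℝ × ℝ => pT ψ p.1 p.2) (t, r) :=
  (h.hasFDerivAt_pT ht hr).differentiableAt

theorem differentiableAt_pR (h : DegOneWave ψ) {t r : ℝ} (ht : 0 < t) (hr : 0 < r) :
    DifferentiableAt ℝ (fun p : ℝ × ℝ => pR ψ p.1 p.2) (t, r) :=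
  (h.hasFDerivAt_pR ht hr).differentiableAt

/-- The wave map equation in terms of second derivatives. -/
theorem second_derivatives (h : DegOneWave ψ) {t r : ℝ} (ht : 0 < t) (hr : 0 < r) :
    ∃ tt tr rr, HasDerivAt (fun s => pT ψ s r) tt t ∧ HasDerivAt (fun ρ => pT ψ t ρ) tr r ∧
      HasDerivAt (fun s => pR ψ s r) tr t ∧ HasDerivAt (fun ρ => pR ψ t ρ) rr r ∧
      tt = rr + pR ψ t r / r - sin (ψ t r) * cos (ψ t r) / r ^ 2 := by
  have hTl := (h.differentiableAt_pT ht hr).hasDerivAt_slice_left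
  have hTr := (h.differentiableAt_pT ht hr).hasDerivAt_slice_right
  have hRl := (h.differentiableAt_pR ht hr).hasDerivAt_slice_left
  have hRr := (h.differentiableAt_pR ht hr).hasDerivAt_slice_right
  rw [(h.hasFDerivAt_pT ht hr).fderiv] at hTl hTr
  rw [(h.hasFDerivAt_pR ht hr).fderiv] at hRl hRr
  have sym := (h.contDiffAt (p := (t, r)) ht hr).isSymmSndFDerivAt
    (by rw [minSmoothness_of_isRCLikeNormedField]; exact WithTop.coe_le_coe.2 le_top) (1, 0) (0, 1)
  simp only [ContinuousLinearMap.flip_apply] at hTl hTr hRl hRr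
  rw [sym] at hRl
  refine ⟨_, _, _, hTl, hTr, hRl, hRr, ?_⟩
  have := h.wave.2 t r ht.le hr
  rw [hTl.deriv, hRr.deriv, sin_two_mul] at this
  have e : 2 * sin (ψ t r) * cos (ψ t r) / (2 * r ^ 2) = sin (ψ t r) * cos (ψ t r) / r ^ 2 := by
    field_simp
  rw [e] at this
  linear_combination this

theorem continuousOn (h : DegOneWave ψ) :
    ContinuousOn (fun p : ℝ × ℝ => ψ p.1 p.2) (Ioi 0 ×ˢ Ioi 0) := fun _ hp =>
  (h.differentiableAt hp.1 hp.2).continuousAt.continuousWithinAt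

theorem continuousOn_pT (h : DegOneWave ψ) :
    ContinuousOn (fun p : ℝ × ℝ => pT ψ p.1 p.2) (Ioi 0 ×ˢ Ioi 0) := fun _ hp =>
  (h.differentiableAt_pT hp.1 hp.2).continuousAt.continuousWithinAt

theorem continuousOn_pR (h : DegOneWave ψ) :
    ContinuousOn (fun p : ℝ × ℝ => pR ψ p.1 p.2) (Ioi 0 ×ˢ Ioi 0) := fun _ hp =>
  (h.differentiableAt_pR hp.1 hp.2).continuousAt.continuousWithinAt

end DegOneWave

theorem continuousOn_parametric_integral {T T' c d : ℝ} (hT : T ≤ T') (hcd : c ≤ d)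
    {f : ℝ → ℝ → ℝ} (hf : ContinuousOn (fun p : ℝ × ℝ => f p.1 p.2) (Icc T T' ×ˢ Icc c d))
    {a b : ℝ → ℝ} (ha : ContinuousOn a (Icc T T')) (ha' : ∀ t ∈ Icc T T', a t ∈ Icc c d)
    (hb : ContinuousOn b (Icc T T')) (hb' : ∀ t ∈ Icc T T', b t ∈ Icc c d) :
    ContinuousOn (fun t => ∫ y in a t..b t, f t y) (Icc T T') := by
  set g : ℝ → ℝ → ℝ := fun t y => f (projIcc T T' hT t) (projIcc c d hcd y) with hg
  have hgc : Continuous (Function.uncurry g) :=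
    hf.comp_continuous (f := fun p : ℝ × ℝ =>
      ((projIcc T T' hT p.1 : ℝ), (projIcc c d hcd p.2 : ℝ)))
      (by fun_prop) fun p => ⟨(projIcc T T' hT p.1).2, (projIcc c d hcd p.2).2⟩
  have key : ∀ {s : ℝ → ℝ}, ContinuousOn s (Icc T T') →
      ContinuousOn (fun t => ∫ y in c..s t, g t y) (Icc T T') := fun {s} hs =>
    (intervalIntegral.continuous_parametric_primitive_of_continuous
      (μ := volume) (a₀ := c) hgc).comp_continuousOn (continuousOn_id.prodMk hs)
  refine ((key hb).sub (key ha)).congr fun t ht => ?_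
  have hi : ∀ u v, IntervalIntegrable (g t) volume u v := fun u v =>
    Continuous.intervalIntegrable (hgc.comp (Continuous.prodMk_right t)) u v
  change _ = (∫ y in c..b t, g t y) - ∫ y in c..a t, g t y
  rw [intervalIntegral.integral_interval_sub_left (hi _ _) (hi _ _)]
  refine intervalIntegral.integral_congr fun y hy => ?_
  have hy' : y ∈ Icc c d := (uIcc_subset_Icc (ha' t ht) (hb' t ht)) hy
  simp only [hg, projIcc_of_mem hT ht, projIcc_of_mem hcd hy']

theorem integral_integral_swap_of_continuousOn {T T' c d : ℝ} (hT : T ≤ T') (hcd : c ≤ d)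
    {f : ℝ → ℝ → ℝ} (hf : ContinuousOn (fun p : ℝ × ℝ => f p.1 p.2) (Icc T T' ×ˢ Icc c d)) :
    ∫ t in T..T', ∫ y in c..d, f t y = ∫ y in c..d, ∫ t in T..T', f t y := by
  refine intervalIntegral_intervalIntegral_swap ?_
  rw [uIoc_of_le hT, uIoc_of_le hcd]
  exact (hf.integrableOn_compact (isCompact_Icc.prod isCompact_Icc)).mono_set
    (prod_mono Ioc_subset_Icc_self Ioc_subset_Icc_self)

/-- Some slice is at most the average. -/
theorem exists_slice_le {T T' c d : ℝ} (hT : T ≤ T') (hcd : c ≤ d)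
    {f : ℝ → ℝ → ℝ} (hf : ContinuousOn (fun p : ℝ × ℝ => f p.1 p.2) (Icc T T' ×ˢ Icc c d)) :
    ∃ y ∈ Icc c d, (d - c) * ∫ t in T..T', f t y ≤ ∫ t in T..T', ∫ y in c..d, f t y := by
  have hf' : ContinuousOn (fun p : ℝ × ℝ => (fun y t => f t y) p.1 p.2) (Icc c d ×ˢ Icc T T') :=
    hf.comp (f := fun p : ℝ × ℝ => (p.2, p.1)) (by fun_prop) fun p hp => ⟨hp.2, hp.1⟩
  have hc := continuousOn_parametric_integral hcd hT (f := fun y t => f t y) hf' (a := fun _ => T) (b := fun _ => T')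
    continuousOn_const (fun _ _ => left_mem_Icc.2 hT) continuousOn_const
    (fun _ _ => right_mem_Icc.2 hT)
  obtain ⟨y, hy, hmin⟩ := isCompact_Icc.exists_isMinOn (nonempty_Icc.2 hcd) hc
  refine ⟨y, hy, ?_⟩
  rw [integral_integral_swap_of_continuousOn hT hcd hf]
  calc (d - c) * ∫ t in T..T', f t y = ∫ _ in c..d, ∫ t in T..T', f t y := by simp
    _ ≤ _ := intervalIntegral.integral_mono_on hcd (by simp)
      (ContinuousOn.intervalIntegrable_of_Icc hcd hc) fun x hx => hmin hx

/-- Energy outside the ball of radius `a`. -/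
def outE (ψ : ℝ → ℝ → ℝ) (t a : ℝ) : ℝ := ∫ r in Ioi a, eDen ψ t r

theorem eDen_nonneg (ψ : ℝ → ℝ → ℝ) (t : ℝ) {r : ℝ} (hr : 0 ≤ r) : 0 ≤ eDen ψ t r := by
  unfold eDen; positivity

theorem locE_nonneg (ψ : ℝ → ℝ → ℝ) (t : ℝ) {a b : ℝ} (ha : 0 ≤ a) : 0 ≤ locE ψ t a b :=
  setIntegral_nonneg measurableSet_Ioc fun _ hr => eDen_nonneg ψ t (ha.trans hr.1.le)

theorem outE_nonneg (ψ : ℝ → ℝ → ℝ) (t : ℝ) {a : ℝ} (ha : 0 ≤ a) : 0 ≤ outE ψ t a :=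
  setIntegral_nonneg measurableSet_Ioi fun _ hr => eDen_nonneg ψ t (ha.trans (le_of_lt hr))

theorem pT_sq_le (ψ : ℝ → ℝ → ℝ) (t : ℝ) {r : ℝ} (hr : 0 ≤ r) : pT ψ t r ^ 2 * r ≤ eDen ψ t r := by
  unfold eDen
  nlinarith [mul_nonneg (sq_nonneg (pR ψ t r)) hr,
    mul_nonneg (div_nonneg (sq_nonneg (sin (ψ t r))) (sq_nonneg r)) hr]

theorem pR_sq_le (ψ : ℝ → ℝ → ℝ) (t : ℝ) {r : ℝ} (hr : 0 ≤ r) : pR ψ t r ^ 2 * r ≤ eDen ψ t r := by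
  unfold eDen
  nlinarith [mul_nonneg (sq_nonneg (pT ψ t r)) hr,
    mul_nonneg (div_nonneg (sq_nonneg (sin (ψ t r))) (sq_nonneg r)) hr]

theorem eDen_eq (ψ : ℝ → ℝ → ℝ) (t : ℝ) {r : ℝ} (hr : 0 < r) :
    eDen ψ t r = r * pT ψ t r ^ 2 + r * pR ψ t r ^ 2 + sin (ψ t r) ^ 2 / r := by
  unfold eDen; field_simp

namespace DegOneWave

variable {ψ : ℝ → ℝ → ℝ}

theorem continuousOn_eDen (h : DegOneWave ψ) :
    ContinuousOn (fun p : ℝ × ℝ => eDen ψ p.1 p.2) (Ioi 0 ×ˢ Ioi 0) := by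
  unfold eDen
  have h1 := h.continuousOn
  have h2 := h.continuousOn_pT
  have h3 := h.continuousOn_pR
  have h4 : ∀ p ∈ (Ioi 0 ×ˢ Ioi 0 : Set (ℝ × ℝ)), p.2 ^ 2 ≠ 0 := fun p hp =>
    pow_ne_zero 2 (ne_of_gt hp.2)
  fun_prop (disch := assumption)

theorem continuousOn_slice {f : ℝ × ℝ → ℝ} (hf : ContinuousOn f (Ioi 0 ×ˢ Ioi 0)) {t : ℝ}
    (ht : 0 < t) : ContinuousOn (fun r => f (t, r)) (Ioi 0) :=
  hf.comp (f := fun r => (t, r)) (by fun_prop) fun _ hr => ⟨ht, hr⟩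

theorem intervalIntegrable_slice {f : ℝ × ℝ → ℝ} (hf : ContinuousOn f (Ioi 0 ×ˢ Ioi 0)) {t : ℝ}
    (ht : 0 < t) {a b : ℝ} (ha : 0 < a) (hb : 0 < b) :
    IntervalIntegrable (fun r => f (t, r)) volume a b :=
  ((continuousOn_slice hf ht).mono fun _ hx =>
    (lt_min ha hb).trans_le hx.1).intervalIntegrable

theorem integrableOn_eDen (h : DegOneWave ψ) {t : ℝ} (ht : 0 < t) {s : Set ℝ} (hs : s ⊆ Ioi 0) :
    IntegrableOn (eDen ψ t) s := (h.finite t ht.le).mono_set hs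

theorem locE_add_outE (h : DegOneWave ψ) {t : ℝ} (ht : 0 < t) {a : ℝ} (ha : 0 ≤ a) :
    locE ψ t 0 a + outE ψ t a = totE ψ 0 := by
  rw [← h.conserved t ht.le, totE, ← Ioc_union_Ioi_eq_Ioi ha]
  exact (setIntegral_union (Set.disjoint_left.2 fun x hx hx' => not_lt.2 hx.2 hx')
    measurableSet_Ioi (h.integrableOn_eDen ht Ioc_subset_Ioi_self)
    (h.integrableOn_eDen ht (Ioi_subset_Ioi ha))).symm

theorem locE_add_locE (h : DegOneWave ψ) {t : ℝ} (ht : 0 < t) {a b c : ℝ} (ha : 0 ≤ a)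
    (hab : a ≤ b) (hbc : b ≤ c) : locE ψ t a b + locE ψ t b c = locE ψ t a c := by
  unfold locE
  rw [← Ioc_union_Ioc_eq_Ioc hab hbc]
  exact (setIntegral_union (Set.disjoint_left.2 fun x hx hx' => not_lt.2 hx.2 hx'.1)
    measurableSet_Ioc (h.integrableOn_eDen ht fun x hx => ha.trans_lt hx.1)
    (h.integrableOn_eDen ht fun x hx => (ha.trans hab).trans_lt hx.1)).symm

theorem locE_add_outE_of_le (h : DegOneWave ψ) {t : ℝ} (ht : 0 < t) {a b : ℝ} (ha : 0 ≤ a)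
    (hab : a ≤ b) : locE ψ t a b + outE ψ t b = outE ψ t a := by
  have h1 := h.locE_add_outE ht ha
  have h2 := h.locE_add_outE ht (ha.trans hab)
  have h3 := h.locE_add_locE ht le_rfl ha hab
  linarith

theorem locE_eq_intervalIntegral {ψ : ℝ → ℝ → ℝ} {t a b : ℝ} (hab : a ≤ b) :
    locE ψ t a b = ∫ r in a..b, eDen ψ t r := (intervalIntegral.integral_of_le hab).symm

theorem locE_le (h : DegOneWave ψ) {t : ℝ} (ht : 0 < t) {a b : ℝ} (ha : 0 ≤ a) :
    locE ψ t a b ≤ totE ψ 0 := by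
  rcases le_total a b with hab | hab
  · have h1 := h.locE_add_outE ht (ha.trans hab)
    have h3 := h.locE_add_locE ht le_rfl ha hab
    have := locE_nonneg ψ t (b := a) le_rfl
    have := outE_nonneg ψ t (ha.trans hab)
    linarith
  · have h1 := h.locE_add_outE ht ha
    have := locE_nonneg ψ t (b := a) le_rfl
    have := outE_nonneg ψ t ha
    rw [locE, Ioc_eq_empty (not_lt.2 hab)]
    simp only [Measure.restrict_empty, integral_zero_measure]
    linarith

theorem locE_lt (h : DegOneWave ψ) {t : ℝ} (ht : 0 < t) {a b : ℝ} (ha : 0 ≤ a) :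
    locE ψ t a b < 12 := (h.locE_le ht ha).trans_lt h.small

theorem locE_mono_right (h : DegOneWave ψ) {t : ℝ} (ht : 0 < t) {a b c : ℝ} (ha : 0 ≤ a)
    (hab : a ≤ b) (hbc : b ≤ c) : locE ψ t a b ≤ locE ψ t a c := by
  have h3 := h.locE_add_locE ht ha hab hbc
  have := locE_nonneg ψ t (b := c) (ha.trans hab)
  linarith

theorem outE_anti (h : DegOneWave ψ) {t : ℝ} (ht : 0 < t) {a b : ℝ} (ha : 0 ≤ a)
    (hab : a ≤ b) : outE ψ t b ≤ outE ψ t a := by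
  have h3 := h.locE_add_outE_of_le ht ha hab
  have := locE_nonneg ψ t (b := b) ha
  linarith

theorem tendsto_outE_atTop (h : DegOneWave ψ) {t : ℝ} (ht : 0 < t) :
    Tendsto (outE ψ t) atTop (nhds 0) := by
  have h1 := intervalIntegral_tendsto_integral_Ioi (f := eDen ψ t) 0 (h.finite t ht.le)
    (tendsto_id (α := ℝ) (x := atTop))
  have h2 : Tendsto (fun a => totE ψ 0 - ∫ r in (0:ℝ)..a, eDen ψ t r) atTop (nhds 0) := by
    have := h1.const_sub (totE ψ 0)
    rwa [← h.conserved t ht.le, totE, sub_self, ← totE, h.conserved t ht.le] at this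
  refine h2.congr' ?_
  filter_upwards [eventually_ge_atTop 0] with a ha
  rw [← locE_eq_intervalIntegral ha]
  linarith [h.locE_add_outE ht ha]

theorem tendsto_locE_zero (h : DegOneWave ψ) {t : ℝ} (ht : 0 < t) :
    Tendsto (fun a => locE ψ t 0 a) (nhdsWithin 0 (Ioi 0)) (nhds 0) := by
  have h1 : ContinuousOn (fun a => ∫ r in (0:ℝ)..a, eDen ψ t r) (uIcc 0 1) :=
    intervalIntegral.continuousOn_primitive_interval (a := 0) (b := 1)
      (by
        rw [uIcc_of_le zero_le_one, integrableOn_Icc_iff_integrableOn_Ioc]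
        exact h.integrableOn_eDen ht Ioc_subset_Ioi_self)
  have h2 := h1 0 left_mem_uIcc
  rw [ContinuousWithinAt, intervalIntegral.integral_same, uIcc_of_le zero_le_one] at h2
  have h3 : nhdsWithin (0:ℝ) (Ioi 0) ≤ nhdsWithin 0 (Icc 0 1) := by
    rw [← nhdsWithin_Ioc_eq_nhdsGT (zero_lt_one' ℝ)]
    exact nhdsWithin_mono _ Ioc_subset_Icc_self
  refine (h2.mono_left h3).congr' ?_
  filter_upwards [self_mem_nhdsWithin] with a ha
  exact (locE_eq_intervalIntegral (le_of_lt ha)).symm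

theorem continuousOn_locE (h : DegOneWave ψ) {t : ℝ} (ht : 0 < t) {b : ℝ} (hb : 0 ≤ b) :
    ContinuousOn (fun a => locE ψ t 0 a) (Icc 0 b) := by
  have h1 : ContinuousOn (fun a => ∫ r in (0:ℝ)..a, eDen ψ t r) (uIcc 0 b) :=
    intervalIntegral.continuousOn_primitive_interval (a := 0) (b := b)
      (by
        rw [uIcc_of_le hb, integrableOn_Icc_iff_integrableOn_Ioc]
        exact h.integrableOn_eDen ht Ioc_subset_Ioi_self)
  rw [uIcc_of_le hb] at h1
  exact h1.congr fun a ha => locE_eq_intervalIntegral ha.1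

end DegOneWave

/-- Radial momentum density `r ∂ₜψ ∂ᵣψ`. -/
def mom (ψ : ℝ → ℝ → ℝ) (t r : ℝ) : ℝ := r * pT ψ t r * pR ψ t r

/-- The flux of the virial quantity `r² ∂ₜψ ∂ᵣψ`. -/
def pres (ψ : ℝ → ℝ → ℝ) (t r : ℝ) : ℝ :=
  (r ^ 2 * (pT ψ t r ^ 2 + pR ψ t r ^ 2) - sin (ψ t r) ^ 2) / 2

theorem abs_two_mom_le (ψ : ℝ → ℝ → ℝ) (t : ℝ) {r : ℝ} (hr : 0 < r) :
    |2 * mom ψ t r| ≤ eDen ψ t r := by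
  rw [eDen_eq ψ t hr, mom]
  have h1 := mul_nonneg hr.le (sq_nonneg (pT ψ t r - pR ψ t r))
  have h2 := mul_nonneg hr.le (sq_nonneg (pT ψ t r + pR ψ t r))
  have h3 := div_nonneg (sq_nonneg (sin (ψ t r))) hr.le
  rw [abs_le]; constructor <;> nlinarith

theorem abs_two_pres_le (ψ : ℝ → ℝ → ℝ) (t : ℝ) {r : ℝ} (hr : 0 < r) :
    |2 * pres ψ t r| ≤ r * eDen ψ t r := by
  have e : r * eDen ψ t r = r ^ 2 * (pT ψ t r ^ 2 + pR ψ t r ^ 2) + sin (ψ t r) ^ 2 := by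
    rw [eDen_eq ψ t hr]; field_simp
  rw [e, pres]
  have h1 := mul_nonneg (sq_nonneg r) (add_nonneg (sq_nonneg (pT ψ t r)) (sq_nonneg (pR ψ t r)))
  have h3 := sq_nonneg (sin (ψ t r))
  rw [abs_le]; constructor <;> nlinarith

namespace DegOneWave

variable {ψ : ℝ → ℝ → ℝ}

theorem differentiableAt_eDen (h : DegOneWave ψ) {t r : ℝ} (ht : 0 < t) (hr : 0 < r) :
    DifferentiableAt ℝ (fun p : ℝ × ℝ => eDen ψ p.1 p.2) (t, r) := by
  have h1 := h.differentiableAt ht hr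
  have h2 := h.differentiableAt_pT ht hr
  have h3 := h.differentiableAt_pR ht hr
  unfold eDen
  have h4 : ((t, r) : ℝ × ℝ).2 ^ 2 ≠ 0 := pow_ne_zero 2 hr.ne'
  fun_prop (disch := assumption)

theorem differentiableAt_mom (h : DegOneWave ψ) {t r : ℝ} (ht : 0 < t) (hr : 0 < r) :
    DifferentiableAt ℝ (fun p : ℝ × ℝ => mom ψ p.1 p.2) (t, r) := by
  have h2 := h.differentiableAt_pT ht hr
  have h3 := h.differentiableAt_pR ht hr
  unfold mom
  fun_prop

theorem differentiableAt_pres (h : DegOneWave ψ) {t r : ℝ} (ht : 0 < t) (hr : 0 < r) :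
    DifferentiableAt ℝ (fun p : ℝ × ℝ => pres ψ p.1 p.2) (t, r) := by
  have h1 := h.differentiableAt ht hr
  have h2 := h.differentiableAt_pT ht hr
  have h3 := h.differentiableAt_pR ht hr
  unfold pres
  fun_prop

theorem continuousOn_mom (h : DegOneWave ψ) :
    ContinuousOn (fun p : ℝ × ℝ => mom ψ p.1 p.2) (Ioi 0 ×ˢ Ioi 0) := fun _ hp =>
  (h.differentiableAt_mom hp.1 hp.2).continuousAt.continuousWithinAt

theorem continuousOn_pres (h : DegOneWave ψ) :
    ContinuousOn (fun p : ℝ × ℝ => pres ψ p.1 p.2) (Ioi 0 ×ˢ Ioi 0) := fun _ hp =>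
  (h.differentiableAt_pres hp.1 hp.2).continuousAt.continuousWithinAt

/-- Local conservation of energy: `∂ₜ e = 2 ∂ᵣ (r ∂ₜψ ∂ᵣψ)`. -/
theorem energy_identity (h : DegOneWave ψ) {t r : ℝ} (ht : 0 < t) (hr : 0 < r) :
    ∃ c, HasDerivAt (fun s => eDen ψ s r) (2 * c) t ∧ HasDerivAt (fun ρ => mom ψ t ρ) c r := by
  obtain ⟨tt, tr, rr, h1, h2, h3, h4, he⟩ := h.second_derivatives ht hr
  have h0 := h.hasDerivAt_t ht hr
  have hm := (((hasDerivAt_id r).mul h2).mul h4)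
  refine ⟨_, ?_, hm⟩
  have hE := (((h1.pow 2).add (h3.pow 2)).add ((h0.sin.pow 2).div_const (r ^ 2))).mul_const r
  refine hE.congr_deriv ?_
  simp only [Nat.cast_ofNat, Nat.add_one_sub_one, pow_one, id, he, Pi.mul_apply]
  field_simp
  ring

/-- Virial identity: `∂ₜ (r² ∂ₜψ ∂ᵣψ) = ∂ᵣ P - r (∂ₜψ)²`. -/
theorem virial_identity (h : DegOneWave ψ) {t r : ℝ} (ht : 0 < t) (hr : 0 < r) :
    ∃ c, HasDerivAt (fun s => r * mom ψ s r) (c - r * pT ψ t r ^ 2) t ∧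
      HasDerivAt (fun ρ => pres ψ t ρ) c r := by
  obtain ⟨tt, tr, rr, h1, h2, h3, h4, he⟩ := h.second_derivatives ht hr
  have h0 := h.hasDerivAt_r ht hr
  have hp := (((((hasDerivAt_id r).pow 2).mul ((h2.pow 2).add (h4.pow 2))).sub
    (h0.sin.pow 2)).div_const 2)
  refine ⟨_, ?_, hp⟩
  have hE := ((h1.const_mul r).mul h3).const_mul r
  refine hE.congr_deriv ?_
  simp only [Nat.cast_ofNat, Nat.add_one_sub_one, pow_one, id, he, Pi.add_apply, Pi.pow_apply]
  field_simp
  ring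

theorem exists_small_slice (h : DegOneWave ψ) {t1 t2 p0 p1 N : ℝ} (h1 : 0 < t1) (h12 : t1 ≤ t2)
    (hN : 0 < N) (hp : ∀ t ∈ Icc t1 t2, 0 ≤ p0 + p1 * t) :
    ∃ Y ∈ Icc N (2 * N), ∫ t in t1..t2, eDen ψ t (p0 + p1 * t + Y) ≤ 12 * (t2 - t1) / N := by
  have hf : ContinuousOn (fun p : ℝ × ℝ => eDen ψ p.1 (p0 + p1 * p.1 + p.2))
      (Icc t1 t2 ×ˢ Icc N (2 * N)) :=
    h.continuousOn_eDen.comp (f := fun p : ℝ × ℝ => (p.1, p0 + p1 * p.1 + p.2)) (by fun_prop)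
      fun p hp' => ⟨h1.trans_le hp'.1.1, by
        have := hp _ hp'.1; have := hp'.2.1; simp only [mem_Ioi]; linarith⟩
  obtain ⟨Y, hY, hle⟩ := exists_slice_le h12 (by linarith : N ≤ 2 * N)
    (f := fun t y => eDen ψ t (p0 + p1 * t + y)) hf
  refine ⟨Y, hY, ?_⟩
  rw [le_div_iff₀ hN]
  have hb : ∫ t in t1..t2, ∫ y in N..2 * N, eDen ψ t (p0 + p1 * t + y) ≤ ∫ t in t1..t2, 12 := by
    refine intervalIntegral.integral_mono_on h12 ?_ (by simp) fun t ht => ?_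
    · refine ContinuousOn.intervalIntegrable_of_Icc h12 ?_
      exact continuousOn_parametric_integral h12 (by linarith : N ≤ 2 * N)
        (f := fun t y => eDen ψ t (p0 + p1 * t + y)) hf continuousOn_const
        (fun _ _ => ⟨le_rfl, by linarith⟩) continuousOn_const (fun _ _ => ⟨by linarith, le_rfl⟩)
    · have := hp t ht
      rw [intervalIntegral.integral_comp_add_left (fun r => eDen ψ t r),
        ← locE_eq_intervalIntegral (by linarith)]
      exact (h.locE_lt (h1.trans_le ht.1) (by linarith)).le
  simp only [intervalIntegral.integral_const, smul_eq_mul] at hb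
  linarith

/-- Energy identity in a slanted strip. -/
theorem energy_strip (h : DegOneWave ψ) {t1 t2 p0 p1 Y : ℝ} (h1 : 0 < t1) (h12 : t1 ≤ t2)
    (hY : 0 ≤ Y) (hp : ∀ t ∈ Icc t1 t2, 0 < p0 + p1 * t) :
    locE ψ t2 (p0 + p1 * t2) (p0 + p1 * t2 + Y) - locE ψ t1 (p0 + p1 * t1) (p0 + p1 * t1 + Y) =
      (∫ t in t1..t2, (2 * mom ψ t (p0 + p1 * t + Y) + p1 * eDen ψ t (p0 + p1 * t + Y)))
      - ∫ t in t1..t2, (2 * mom ψ t (p0 + p1 * t) + p1 * eDen ψ t (p0 + p1 * t)) := by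
  have key := divergence_sweep p0 p1 1 0 h12 hY (F := fun t r => eDen ψ t r)
    (G := fun t r => -2 * mom ψ t r) (H := fun _ _ => 0)
    (fun t ht y hy => h.differentiableAt_eDen (h1.trans_le ht.1)
      (by have := hp t ht; have := hy.1; linarith))
    (fun t ht y hy => (h.differentiableAt_mom (h1.trans_le ht.1)
      (by have := hp t ht; have := hy.1; linarith)).const_mul _)
    (fun t ht y hy => by
      obtain ⟨c, hc, hc'⟩ := h.energy_identity (h1.trans_le ht.1)
        (by have := hp t ht; have := hy.1; linarith : 0 < p0 + p1 * t + y * (1 + 0 * t))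
      exact ⟨_, _, hc, hc'.const_mul _, by ring⟩)
    continuousOn_const
  simp only [mul_zero, intervalIntegral.integral_zero, zero_mul, add_zero, mul_one, one_mul] at key
  rw [intervalIntegral.integral_comp_add_left (fun r => eDen ψ t1 r),
    intervalIntegral.integral_comp_add_left (fun r => eDen ψ t2 r), add_zero, add_zero,
    ← locE_eq_intervalIntegral (by linarith), ← locE_eq_intervalIntegral (by linarith)] at key
  rw [← sub_eq_zero]
  rw [show ∀ f g : ℝ → ℝ, (∫ t in t1..t2, f t) - ∫ t in t1..t2, g t =
    (∫ t in t1..t2, - g t) - ∫ t in t1..t2, - f t from fun f g => by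
      rw [intervalIntegral.integral_neg, intervalIntegral.integral_neg]; ring]
  have e : ∀ x y : ℝ, -(2 * x + p1 * y) = -2 * x - p1 * y := fun x y => by ring
  simp only [e]
  linarith

end DegOneWave

namespace DegOneWave

variable {ψ : ℝ → ℝ → ℝ}

theorem outE_le_of_forall (h : DegOneWave ψ) {t b C K : ℝ} (ht : 0 < t) (hb : 0 ≤ b)
    (hN : ∀ N, 0 < N → locE ψ t b (b + N) ≤ C + K / N) : outE ψ t b ≤ C := by
  have h1 : Tendsto (fun N => outE ψ t b - outE ψ t (b + N)) atTop (nhds (outE ψ t b - 0)) :=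
    ((h.tendsto_outE_atTop ht).comp (tendsto_atTop_add_const_left _ b tendsto_id)).const_sub _
  have h2 : Tendsto (fun N : ℝ => C + K / N) atTop (nhds (C + 0)) :=
    (tendsto_const_nhds.div_atTop tendsto_id).const_add C
  rw [sub_zero] at h1
  rw [add_zero] at h2
  refine le_of_tendsto_of_tendsto h1 h2 ?_
  filter_upwards [eventually_gt_atTop 0] with N hN0
  have := h.locE_add_outE_of_le ht hb (by linarith : b ≤ b + N)
  linarith [hN N hN0]

theorem intervalIntegrable_line {f : ℝ → ℝ → ℝ}
    (hf : ContinuousOn (fun p : ℝ × ℝ => f p.1 p.2) (Ioi 0 ×ˢ Ioi 0)) {t1 t2 p0 p1 : ℝ}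
    (h1 : 0 < t1) (h12 : t1 ≤ t2) (hp : ∀ t ∈ Icc t1 t2, 0 < p0 + p1 * t) :
    IntervalIntegrable (fun t => f t (p0 + p1 * t)) volume t1 t2 :=
  ContinuousOn.intervalIntegrable_of_Icc h12
    (hf.comp (f := fun t => (t, p0 + p1 * t)) (by fun_prop)
      fun t ht => ⟨h1.trans_le ht.1, hp t ht⟩)

theorem abs_outer_flux_le (h : DegOneWave ψ) {t1 t2 p0 p1 Y : ℝ} (h1 : 0 < t1) (h12 : t1 ≤ t2)
    (hp : ∀ t ∈ Icc t1 t2, 0 < p0 + p1 * t) (hp1 : |p1| ≤ 1) (hY : 0 ≤ Y) :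
    |∫ t in t1..t2, (2 * mom ψ t (p0 + p1 * t + Y) + p1 * eDen ψ t (p0 + p1 * t + Y))| ≤
      2 * ∫ t in t1..t2, eDen ψ t (p0 + p1 * t + Y) := by
  have hi := intervalIntegrable_line h.continuousOn_eDen h1 h12 (p0 := p0 + Y) (p1 := p1)
    (fun t ht => by linarith [hp t ht])
  have e : ∀ t, p0 + Y + p1 * t = p0 + p1 * t + Y := fun t => by ring
  simp only [e] at hi
  rw [← Real.norm_eq_abs, ← intervalIntegral.integral_const_mul]
  refine intervalIntegral.norm_integral_le_of_norm_le h12 ?_ (hi.const_mul 2)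
  refine Eventually.of_forall fun t ht => ?_
  have hr : 0 < p0 + p1 * t + Y := by linarith [hp t (Ioc_subset_Icc_self ht)]
  have hm := abs_two_mom_le ψ t hr
  have he := eDen_nonneg ψ t hr.le
  rw [Real.norm_eq_abs]
  refine (abs_add_le _ _).trans ?_
  rw [abs_mul p1, abs_of_nonneg he]
  nlinarith

theorem outE_forward (h : DegOneWave ψ) {t1 t2 a : ℝ} (h1 : 0 < t1) (h12 : t1 ≤ t2) (ha : 0 ≤ a) :
    outE ψ t2 (a + (t2 - t1)) ≤ outE ψ t1 a := by
  rcases ha.eq_or_lt with rfl | ha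
  · have e1 := h.locE_add_outE h1 le_rfl
    have e2 := h.locE_add_outE (h1.trans_le h12) (by linarith : 0 ≤ 0 + (t2 - t1))
    have e3 : locE ψ t1 0 0 = 0 := by simp [locE]
    have := locE_nonneg ψ t2 (b := 0 + (t2 - t1)) le_rfl
    linarith
  refine h.outE_le_of_forall (K := 24 * (t2 - t1)) (h1.trans_le h12) (by linarith) fun N hN => ?_
  have hp : ∀ t ∈ Icc t1 t2, 0 < (a - t1) + 1 * t := fun t ht => by linarith [ht.1]
  obtain ⟨Y, hY, hle⟩ := h.exists_small_slice h1 h12 hN (fun t ht => (hp t ht).le)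
  have hY0 : 0 ≤ Y := hN.le.trans hY.1
  have key := h.energy_strip h1 h12 hY0 hp
  have hout := (abs_le.1 (h.abs_outer_flux_le h1 h12 hp (by simp) hY0)).2
  have hin : 0 ≤ ∫ t in t1..t2,
      (2 * mom ψ t ((a - t1) + 1 * t) + 1 * eDen ψ t ((a - t1) + 1 * t)) := by
    refine intervalIntegral.integral_nonneg h12 fun t ht => ?_
    linarith [(abs_le.1 (abs_two_mom_le ψ t (hp t ht))).1]
  have e1 : a - t1 + 1 * t1 = a := by ring
  have e2 : a - t1 + 1 * t2 = a + (t2 - t1) := by ring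
  rw [e1, e2] at key
  have m1 := h.locE_mono_right (h1.trans_le h12) (by linarith : 0 ≤ a + (t2 - t1))
    (by linarith : a + (t2 - t1) ≤ a + (t2 - t1) + N)
    (by linarith [hY.1] : a + (t2 - t1) + N ≤ a + (t2 - t1) + Y)
  have m2 := h.locE_add_outE_of_le h1 ha.le (by linarith : a ≤ a + Y)
  have m3 := outE_nonneg ψ t1 (by linarith : 0 ≤ a + Y)
  have e3 : 24 * (t2 - t1) / N = 2 * (12 * (t2 - t1) / N) := by ring
  linarith

theorem outE_backward (h : DegOneWave ψ) {t1 t2 a : ℝ} (h1 : 0 < t1) (h12 : t1 ≤ t2)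
    (ha : 0 < a - (t2 - t1)) : outE ψ t1 a ≤ outE ψ t2 (a - (t2 - t1)) := by
  refine h.outE_le_of_forall (K := 24 * (t2 - t1)) h1 (by linarith) fun N hN => ?_
  have hp : ∀ t ∈ Icc t1 t2, 0 < (a + t1) + (-1) * t := fun t ht => by linarith [ht.2]
  obtain ⟨Y, hY, hle⟩ := h.exists_small_slice h1 h12 hN (fun t ht => (hp t ht).le)
  have hY0 : 0 ≤ Y := hN.le.trans hY.1
  have key := h.energy_strip h1 h12 hY0 hp
  have hout := (abs_le.1 (h.abs_outer_flux_le h1 h12 hp (by simp) hY0)).1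
  have hin : 0 ≤ - ∫ t in t1..t2,
      (2 * mom ψ t ((a + t1) + (-1) * t) + (-1) * eDen ψ t ((a + t1) + (-1) * t)) := by
    rw [← intervalIntegral.integral_neg]
    refine intervalIntegral.integral_nonneg h12 fun t ht => ?_
    linarith [(abs_le.1 (abs_two_mom_le ψ t (hp t ht))).2]
  have e1 : a + t1 + (-1) * t1 = a := by ring
  have e2 : a + t1 + (-1) * t2 = a - (t2 - t1) := by ring
  rw [e1, e2] at key
  have m1 := h.locE_mono_right h1 (by linarith : 0 ≤ a)
    (by linarith : a ≤ a + N) (by linarith [hY.1] : a + N ≤ a + Y)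
  have m2 := h.locE_add_outE_of_le (h1.trans_le h12) ha.le
    (by linarith : a - (t2 - t1) ≤ a - (t2 - t1) + Y)
  have m3 := outE_nonneg ψ t2 (by linarith : 0 ≤ a - (t2 - t1) + Y)
  have e3 : 24 * (t2 - t1) / N = 2 * (12 * (t2 - t1) / N) := by ring
  linarith

theorem locE_forward (h : DegOneWave ψ) {t1 t2 a : ℝ} (h1 : 0 < t1) (h12 : t1 ≤ t2)
    (ha : 0 < a - (t2 - t1)) : locE ψ t2 0 (a - (t2 - t1)) ≤ locE ψ t1 0 a := by
  have := h.outE_backward h1 h12 ha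
  have := h.locE_add_outE h1 (by linarith : 0 ≤ a)
  have := h.locE_add_outE (h1.trans_le h12) ha.le
  linarith

theorem locE_backward (h : DegOneWave ψ) {t1 t2 a : ℝ} (h1 : 0 < t1) (h12 : t1 ≤ t2)
    (ha : 0 ≤ a) : locE ψ t1 0 a ≤ locE ψ t2 0 (a + (t2 - t1)) := by
  have := h.outE_forward h1 h12 ha
  have := h.locE_add_outE h1 ha
  have := h.locE_add_outE (h1.trans_le h12) (by linarith : 0 ≤ a + (t2 - t1))
  linarith

/-- The energy does not concentrate at the origin, uniformly on compact time intervals. -/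
theorem exists_radius_locE_le (h : DegOneWave ψ) {T T' ε : ℝ} (hT : 0 < T) (hε : 0 < ε) :
    ∃ ρ > 0, ∀ t ∈ Icc T T', locE ψ t 0 ρ ≤ ε := by
  have loc : ∀ s ∈ Icc T T', ∃ u ∈ nhdsWithin s (Icc T T'), ∃ ρ > 0, ∀ t ∈ u, locE ψ t 0 ρ ≤ ε := by
    intro s hs
    have hs0 : 0 < s := hT.trans_le hs.1
    obtain ⟨a, hae, ha⟩ := (((h.tendsto_locE_zero hs0).eventually (ge_mem_nhds hε)).and
      (self_mem_nhdsWithin)).exists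
    have ha0 : 0 < a := ha
    refine ⟨Ioo (s - min (a / 2) s) (s + a / 2),
      mem_nhdsWithin_of_mem_nhds (Ioo_mem_nhds (by
        have := lt_min (half_pos ha0) hs0; linarith) (by linarith)), a / 2, by positivity, ?_⟩
    intro t ht
    have hta : s - a / 2 < t := by linarith [ht.1, min_le_left (a / 2) s]
    have ht0 : 0 < t := by linarith [ht.1, min_le_right (a / 2) s]
    rcases le_total t s with hts | hts
    · refine (h.locE_backward ht0 hts (by positivity)).trans ((h.locE_mono_right hs0 le_rfl
        (by linarith) (by linarith)).trans hae)
    · have hlt := ht.2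
      refine le_trans ?_ ((h.locE_forward hs0 hts (a := a) (by linarith)).trans hae)
      exact h.locE_mono_right ht0 le_rfl (by positivity) (by linarith)
  refine isCompact_Icc.induction_on (p := fun u => ∃ ρ > 0, ∀ t ∈ u, 0 < t → locE ψ t 0 ρ ≤ ε)
    ⟨1, one_pos, by simp⟩ (fun s t hst ⟨ρ, hρ, H⟩ => ⟨ρ, hρ, fun x hx => H x (hst hx)⟩) ?_ ?_ |>.imp
    fun ρ hρ => ⟨hρ.1, fun t ht => hρ.2 t ht (hT.trans_le ht.1)⟩
  · rintro s t ⟨ρ, hρ, H⟩ ⟨ρ', hρ', H'⟩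
    refine ⟨min ρ ρ', lt_min hρ hρ', ?_⟩
    rintro x (hx | hx) hx0
    · exact (h.locE_mono_right hx0 le_rfl (lt_min hρ hρ').le (min_le_left _ _)).trans (H x hx hx0)
    · exact (h.locE_mono_right hx0 le_rfl (lt_min hρ hρ').le (min_le_right _ _)).trans
        (H' x hx hx0)
  · intro s hs
    obtain ⟨u, hu, ρ, hρ, H⟩ := loc s hs
    exact ⟨u, hu, ρ, hρ, fun t ht _ => H t ht⟩

/-- Smallness of the exterior energy outside a fixed light cone. -/
theorem exists_exterior (h : DegOneWave ψ) {δ : ℝ} (hδ : 0 < δ) :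
    ∃ a > 0, ∀ t ≥ 1, ∀ r ≥ a + t, outE ψ t r ≤ δ := by
  obtain ⟨a, hae, ha⟩ := (((h.tendsto_outE_atTop one_pos).eventually (ge_mem_nhds hδ)).and
    (eventually_gt_atTop 0)).exists
  refine ⟨a, ha, fun t ht r hr => ?_⟩
  exact (h.outE_anti (by linarith) (by linarith) (by linarith : a + (t - 1) ≤ r)).trans
    ((h.outE_forward one_pos ht ha.le).trans hae)

end DegOneWave

/-- Self-similar energy-virial density. -/
def coneF (w Θ : ℝ → ℝ) (ψ : ℝ → ℝ → ℝ) (t r : ℝ) : ℝ :=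
  w (r / t) * (eDen ψ t r / 2) + Θ (r / t) / t * (r * mom ψ t r)

/-- Self-similar energy-virial flux. -/
def coneG (w Θ : ℝ → ℝ) (ψ : ℝ → ℝ → ℝ) (t r : ℝ) : ℝ :=
  -(w (r / t) * mom ψ t r + Θ (r / t) / t * pres ψ t r)

/-- Self-similar energy-virial dissipation. -/
def coneD (w' Θ Θ' : ℝ → ℝ) (ψ : ℝ → ℝ → ℝ) (t r : ℝ) : ℝ :=
  w' (r / t) * (r / t * (eDen ψ t r / 2) + mom ψ t r)
    + (Θ (r / t) + r / t * Θ' (r / t)) * (r / t) * mom ψ t r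
    + Θ' (r / t) * (pres ψ t r / t) + Θ (r / t) * (r * pT ψ t r ^ 2)

namespace DegOneWave

variable {ψ : ℝ → ℝ → ℝ}

theorem continuousOn_cone {f : ℝ × ℝ → ℝ} (hf : ContinuousOn f (Ioi 0 ×ˢ Ioi 0))
    {T T' y0 y1 : ℝ} (hT : 0 < T) (hy0 : 0 < y0) :
    ContinuousOn (fun p : ℝ × ℝ => f (p.1, p.2 * p.1)) (Icc T T' ×ˢ Icc y0 y1) :=
  hf.comp (f := fun p : ℝ × ℝ => (p.1, p.2 * p.1)) (by fun_prop) fun p hp =>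
    have h1 : 0 < p.1 := hT.trans_le hp.1.1
    ⟨h1, mul_pos (hy0.trans_le hp.2.1) h1⟩

theorem cone_identity (h : DegOneWave ψ) {T T' y0 y1 : ℝ} (hT : 0 < T) (hTT : T ≤ T')
    (hy0 : 0 < y0) (hy : y0 ≤ y1) {w w' Θ Θ' : ℝ → ℝ}
    (hw : ∀ y ∈ Icc y0 y1, HasDerivAt w (w' y) y) (hΘ : ∀ y ∈ Icc y0 y1, HasDerivAt Θ (Θ' y) y)
    (hw' : ContinuousOn w' (Icc y0 y1)) (hΘ' : ContinuousOn Θ' (Icc y0 y1)) :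
    ∫ t in T..T', ∫ y in y0..y1, coneD w' Θ Θ' ψ t (y * t) =
      (∫ y in y0..y1, T * coneF w Θ ψ T (y * T)) - (∫ y in y0..y1, T' * coneF w Θ ψ T' (y * T'))
      - (∫ t in T..T', (coneG w Θ ψ t (y1 * t) - y1 * coneF w Θ ψ t (y1 * t)))
      + ∫ t in T..T', (coneG w Θ ψ t (y0 * t) - y0 * coneF w Θ ψ t (y0 * t)) := by
  have pos : ∀ t ∈ Icc T T', 0 < t := fun t ht => hT.trans_le ht.1
  have posr : ∀ t ∈ Icc T T', ∀ y ∈ Icc y0 y1, 0 < 0 + 0 * t + y * (0 + 1 * t) := fun t ht y hy => by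
    have := mul_pos (hy0.trans_le hy.1) (pos t ht); linarith
  have hyr : ∀ t ∈ Icc T T', ∀ y : ℝ, (0 + 0 * t + y * (0 + 1 * t)) / t = y := fun t ht y => by
    have := (pos t ht).ne'; field_simp; ring
  have hd : ∀ {f f' : ℝ → ℝ}, (∀ y ∈ Icc y0 y1, HasDerivAt f (f' y) y) →
      ∀ t ∈ Icc T T', ∀ y ∈ Icc y0 y1, DifferentiableAt ℝ (fun p : ℝ × ℝ => f (p.2 / p.1))
        (t, 0 + 0 * t + y * (0 + 1 * t)) := by
    intro f f' hf t ht y hy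
    have h1 : DifferentiableAt ℝ (fun p : ℝ × ℝ => p.2 / p.1)
        (t, 0 + 0 * t + y * (0 + 1 * t)) :=
      by
        have h5 : (t, 0 + 0 * t + y * (0 + 1 * t)).1 ≠ 0 := (pos t ht).ne'
        fun_prop (disch := assumption)
    have h2 : DifferentiableAt ℝ f ((0 + 0 * t + y * (0 + 1 * t)) / t) := by
      rw [hyr t ht]; exact (hf y hy).differentiableAt
    exact DifferentiableAt.comp (g := f) _ h2 h1
  have key := divergence_sweep 0 0 0 1 hTT hy (F := fun t r => coneF w Θ ψ t r)
    (G := fun t r => coneG w Θ ψ t r) (H := fun t r => -(1 / t * coneD w' Θ Θ' ψ t r))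
    (fun t ht y hy => by
      have h1 := hd hw t ht y hy
      have h2 := hd hΘ t ht y hy
      have h3 := h.differentiableAt_eDen (pos t ht) (posr t ht y hy)
      have h4 := h.differentiableAt_mom (pos t ht) (posr t ht y hy)
      have h5 : (t, 0 + 0 * t + y * (0 + 1 * t)).1 ≠ 0 := (pos t ht).ne'
      have gen : ∀ {a b e m : ℝ × ℝ → ℝ} {x : ℝ × ℝ}, DifferentiableAt ℝ a x →
          DifferentiableAt ℝ b x → DifferentiableAt ℝ e x → DifferentiableAt ℝ m x → x.1 ≠ 0 →
          DifferentiableAt ℝ (fun p => a p * (e p / 2) + b p / p.1 * (p.2 * m p)) x := by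
        intros; fun_prop (disch := assumption)
      exact gen h1 h2 h3 h4 h5)
    (fun t ht y hy => by
      have h1 := hd hw t ht y hy
      have h2 := hd hΘ t ht y hy
      have h3 := h.differentiableAt_pres (pos t ht) (posr t ht y hy)
      have h4 := h.differentiableAt_mom (pos t ht) (posr t ht y hy)
      have h5 : (t, 0 + 0 * t + y * (0 + 1 * t)).1 ≠ 0 := (pos t ht).ne'
      have gen : ∀ {a b e m : ℝ × ℝ → ℝ} {x : ℝ × ℝ}, DifferentiableAt ℝ a x →
          DifferentiableAt ℝ b x → DifferentiableAt ℝ e x → DifferentiableAt ℝ m x → x.1 ≠ 0 →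
          DifferentiableAt ℝ (fun p => -(a p * m p + b p / p.1 * e p)) x := by
        intros; fun_prop (disch := assumption)
      exact gen h1 h2 h3 h4 h5)
    (fun t ht y hy => by
      have ht0 := (pos t ht).ne'
      obtain ⟨c, hc, hc'⟩ := h.energy_identity (pos t ht) (posr t ht y hy)
      obtain ⟨d, hd, hd'⟩ := h.virial_identity (pos t ht) (posr t ht y hy)
      have hyr' := hyr t ht y
      set r := 0 + 0 * t + y * (0 + 1 * t) with hr
      have hr0 : 0 < r := posr t ht y hy
      have hyt : HasDerivAt (fun s => r / s) (-(r / t) / t) t := by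
        refine ((hasDerivAt_inv ht0).const_mul r).congr_deriv ?_
        field_simp
      have hyr1 : HasDerivAt (fun ρ => ρ / t) (1 / t) r := (hasDerivAt_id r).div_const t
      have hwy : HasDerivAt w (w' (r / t)) (r / t) := by rw [hyr']; exact hw y hy
      have hΘy : HasDerivAt Θ (Θ' (r / t)) (r / t) := by rw [hyr']; exact hΘ y hy
      have w1 : HasDerivAt (fun s => w (r / s)) _ t := HasDerivAt.comp t hwy hyt
      have w2 : HasDerivAt (fun ρ => w (ρ / t)) _ r := HasDerivAt.comp r hwy hyr1
      have Θ1 : HasDerivAt (fun s => Θ (r / s)) _ t := HasDerivAt.comp t hΘy hyt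
      have Θ2 : HasDerivAt (fun ρ => Θ (ρ / t)) _ r := HasDerivAt.comp r hΘy hyr1
      refine ⟨_, _, (w1.mul (hc.div_const 2)).add ((Θ1.div (hasDerivAt_id t) ht0).mul hd),
        ((w2.mul hc').add ((Θ2.div_const t).mul hd')).neg, ?_⟩
      simp only [coneD, id, Pi.div_apply]
      field_simp
      ring)
    (by
      have gen : ∀ {a1 a2 a3 e m P q : ℝ × ℝ → ℝ} {s : Set (ℝ × ℝ)}, ContinuousOn a1 s →
          ContinuousOn a2 s → ContinuousOn a3 s → ContinuousOn e s → ContinuousOn m s →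
          ContinuousOn P s → ContinuousOn q s → (∀ p ∈ s, p.1 ≠ 0) →
          ContinuousOn (fun p => -(1 / p.1 * (a1 p * (p.2 * (e p / 2) + m p)
            + (a2 p + p.2 * a3 p) * p.2 * m p + a3 p * (P p / p.1)
            + a2 p * (p.2 * p.1 * q p ^ 2)))) s := by
        intros; fun_prop (disch := assumption)
      have hyc : ∀ {f : ℝ → ℝ}, ContinuousOn f (Icc y0 y1) →
          ContinuousOn (fun p : ℝ × ℝ => f p.2) (Icc T T' ×ˢ Icc y0 y1) := fun {f} hf =>
        hf.comp continuousOn_snd fun p hp => hp.2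
      refine (gen (hyc hw') (hyc (f := Θ) fun y hy => (hΘ y hy).continuousAt.continuousWithinAt)
        (hyc hΘ') (continuousOn_cone h.continuousOn_eDen hT hy0)
        (continuousOn_cone h.continuousOn_mom hT hy0) (continuousOn_cone h.continuousOn_pres hT hy0)
        (continuousOn_cone h.continuousOn_pT hT hy0) fun p hp => (pos _ hp.1).ne').congr
        fun p hp => ?_
      have e1 : 0 + 0 * p.1 + p.2 * (0 + 1 * p.1) = p.2 * p.1 := by ring
      have e2 : p.2 * p.1 / p.1 = p.2 := mul_div_cancel_right₀ _ (pos _ hp.1).ne'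
      simp only [coneD, e1, e2])
  simp only [zero_mul, zero_add, one_mul, mul_one] at key
  have e : ∫ t in T..T', ∫ y in y0..y1, t * -(1 / t * coneD w' Θ Θ' ψ t (y * t)) =
      - ∫ t in T..T', ∫ y in y0..y1, coneD w' Θ Θ' ψ t (y * t) := by
    rw [← intervalIntegral.integral_neg]
    refine intervalIntegral.integral_congr fun t ht => ?_
    rw [uIcc_of_le hTT] at ht
    rw [← intervalIntegral.integral_neg]
    refine intervalIntegral.integral_congr fun y _ => ?_
    have := (pos t ht).ne'
    field_simp
  rw [e] at key
  linarith

end DegOneWave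

section DoubleIntegral

variable {T T' c d : ℝ} {f g : ℝ → ℝ → ℝ}

theorem continuousOn_inner_integral (hT : T ≤ T') (hcd : c ≤ d)
    (hf : ContinuousOn (fun p : ℝ × ℝ => f p.1 p.2) (Icc T T' ×ˢ Icc c d)) :
    ContinuousOn (fun t => ∫ y in c..d, f t y) (Icc T T') :=
  continuousOn_parametric_integral hT hcd hf (a := fun _ => c) (b := fun _ => d) continuousOn_const
    (fun _ _ => left_mem_Icc.2 hcd) continuousOn_const (fun _ _ => right_mem_Icc.2 hcd)

theorem intervalIntegrable_slice_of_continuousOn (hcd : c ≤ d)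
    (hf : ContinuousOn (fun p : ℝ × ℝ => f p.1 p.2) (Icc T T' ×ˢ Icc c d)) {t : ℝ}
    (ht : t ∈ Icc T T') : IntervalIntegrable (f t) volume c d :=
  ContinuousOn.intervalIntegrable_of_Icc hcd
    (hf.comp (f := fun y => (t, y)) (by fun_prop) fun _ hy => ⟨ht, hy⟩)

theorem double_integral_mono (hT : T ≤ T') (hcd : c ≤ d)
    (hf : ContinuousOn (fun p : ℝ × ℝ => f p.1 p.2) (Icc T T' ×ˢ Icc c d))
    (hg : ContinuousOn (fun p : ℝ × ℝ => g p.1 p.2) (Icc T T' ×ˢ Icc c d))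
    (hfg : ∀ t ∈ Icc T T', ∀ y ∈ Icc c d, f t y ≤ g t y) :
    ∫ t in T..T', ∫ y in c..d, f t y ≤ ∫ t in T..T', ∫ y in c..d, g t y :=
  intervalIntegral.integral_mono_on hT
    ((continuousOn_inner_integral hT hcd hf).intervalIntegrable_of_Icc hT)
    ((continuousOn_inner_integral hT hcd hg).intervalIntegrable_of_Icc hT)
    fun t ht => intervalIntegral.integral_mono_on hcd
      (intervalIntegrable_slice_of_continuousOn hcd hf ht)
      (intervalIntegrable_slice_of_continuousOn hcd hg ht) (hfg t ht)

theorem double_integral_linear (hT : T ≤ T') (hcd : c ≤ d) (a b : ℝ)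
    (hf : ContinuousOn (fun p : ℝ × ℝ => f p.1 p.2) (Icc T T' ×ˢ Icc c d))
    (hg : ContinuousOn (fun p : ℝ × ℝ => g p.1 p.2) (Icc T T' ×ˢ Icc c d)) :
    ∫ t in T..T', ∫ y in c..d, (a * f t y + b * g t y) =
      a * (∫ t in T..T', ∫ y in c..d, f t y) + b * ∫ t in T..T', ∫ y in c..d, g t y := by
  rw [← intervalIntegral.integral_const_mul, ← intervalIntegral.integral_const_mul,
    ← intervalIntegral.integral_add
      (((continuousOn_inner_integral hT hcd hf).intervalIntegrable_of_Icc hT).const_mul a)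
      (((continuousOn_inner_integral hT hcd hg).intervalIntegrable_of_Icc hT).const_mul b)]
  refine intervalIntegral.integral_congr fun t ht => ?_
  rw [uIcc_of_le hT] at ht
  rw [← intervalIntegral.integral_const_mul, ← intervalIntegral.integral_const_mul,
    ← intervalIntegral.integral_add
      ((intervalIntegrable_slice_of_continuousOn hcd hf ht).const_mul a)
      ((intervalIntegrable_slice_of_continuousOn hcd hg ht).const_mul b)]

theorem double_integral_mono_interval {c' d' : ℝ} (hT : T ≤ T') (hcd : c ≤ d) (hc : c' ≤ c)
    (hd : d ≤ d')
    (hf : ContinuousOn (fun p : ℝ × ℝ => f p.1 p.2) (Icc T T' ×ˢ Icc c' d'))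
    (hf0 : ∀ t ∈ Icc T T', ∀ y ∈ Icc c' d', 0 ≤ f t y) :
    ∫ t in T..T', ∫ y in c..d, f t y ≤ ∫ t in T..T', ∫ y in c'..d', f t y := by
  have hf' := hf.mono (prod_mono (Subset.refl (Icc T T')) (Icc_subset_Icc hc hd))
  have hcd' : c' ≤ d' := hc.trans (hcd.trans hd)
  refine intervalIntegral.integral_mono_on hT
    ((continuousOn_inner_integral hT hcd hf').intervalIntegrable_of_Icc hT)
    ((continuousOn_inner_integral hT hcd' hf).intervalIntegrable_of_Icc hT) fun t ht => ?_
  refine intervalIntegral.integral_mono_interval hc hcd hd ?_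
    (intervalIntegrable_slice_of_continuousOn hcd' hf ht)
  filter_upwards [ae_restrict_mem measurableSet_Ioc] with y hy
  exact hf0 t ht y (Ioc_subset_Icc_self hy)

end DoubleIntegral

theorem integral_const_div {T T' : ℝ} (hT : 0 < T) (hTT : T ≤ T') (a : ℝ) :
    ∫ t in T..T', a / t = a * log (T' / T) := by
  simp_rw [div_eq_mul_inv a]
  rw [intervalIntegral.integral_const_mul, integral_inv_of_pos hT (hT.trans_le hTT)]

theorem intervalIntegrable_const_div {T T' : ℝ} (hT : 0 < T) (hTT : T ≤ T') (a : ℝ) :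
    IntervalIntegrable (fun t => a / t) volume T T' :=
  ContinuousOn.intervalIntegrable_of_Icc hTT
    (continuousOn_const.div continuousOn_id fun _ ht => (hT.trans_le ht.1).ne')

namespace DegOneWave

variable {ψ : ℝ → ℝ → ℝ}

theorem integral_cone_eDen {t y0 y1 : ℝ} (ht : 0 < t)
    (hy : y0 ≤ y1) : ∫ y in y0..y1, t * eDen ψ t (y * t) = locE ψ t (y0 * t) (y1 * t) := by
  rw [locE_eq_intervalIntegral (by gcongr), intervalIntegral.integral_const_mul,
    intervalIntegral.integral_comp_mul_right _ ht.ne', smul_eq_mul, ← mul_assoc,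
    mul_inv_cancel₀ ht.ne', one_mul]

theorem double_integral_eDen_le (h : DegOneWave ψ) {T T' y0 y1 ε : ℝ} (hT : 0 < T) (hTT : T ≤ T')
    (hy0 : 0 < y0) (hy : y0 ≤ y1) (hε : ∀ t ∈ Icc T T', locE ψ t (y0 * t) (y1 * t) ≤ ε) :
    ∫ t in T..T', ∫ y in y0..y1, eDen ψ t (y * t) ≤ ε * log (T' / T) := by
  rw [← integral_const_div hT hTT]
  refine intervalIntegral.integral_mono_on hTT
    ((continuousOn_inner_integral hTT hy
      (continuousOn_cone h.continuousOn_eDen hT hy0)).intervalIntegrable_of_Icc hTT)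
    (intervalIntegrable_const_div hT hTT ε) fun t ht => ?_
  have ht0 : 0 < t := hT.trans_le ht.1
  rw [le_div_iff₀ ht0, mul_comm, ← intervalIntegral.integral_const_mul,
    integral_cone_eDen ht0 hy]
  exact hε t ht

theorem exists_slice_eDen_le (h : DegOneWave ψ) {T T' y0 y1 ε : ℝ} (hT : 0 < T) (hTT : T ≤ T')
    (hy0 : 0 < y0) (hy : y0 ≤ y1) (hε : ∀ t ∈ Icc T T', locE ψ t (y0 * t) (y1 * t) ≤ ε) :
    ∃ y ∈ Icc y0 y1, (y1 - y0) * ∫ t in T..T', eDen ψ t (y * t) ≤ ε * log (T' / T) := by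
  obtain ⟨y, hy', hle⟩ := exists_slice_le hTT hy (f := fun t y => eDen ψ t (y * t))
    (continuousOn_cone h.continuousOn_eDen hT hy0)
  exact ⟨y, hy', hle.trans (h.double_integral_eDen_le hT hTT hy0 hy hε)⟩

/-- Small flux through some ray slightly outside the light cone. -/
theorem exists_outer_ray (h : DegOneWave ψ) {b1 b2 ε : ℝ} (hb1 : 1 < b1) (hb : b1 < b2)
    (hε : 0 < ε) : ∃ T0 ≥ 1, ∀ T ≥ T0, ∀ T' ≥ T, ∃ y ∈ Icc b1 b2,
      ∫ t in T..T', eDen ψ t (y * t) ≤ ε * log (T' / T) := by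
  obtain ⟨a, ha, hae⟩ := h.exists_exterior (δ := (b2 - b1) * ε) (mul_pos (by linarith) hε)
  refine ⟨max 1 (a / (b1 - 1)), le_max_left _ _, fun T hT T' hTT => ?_⟩
  have hT1 : 1 ≤ T := (le_max_left _ _).trans hT
  have hTa : a / (b1 - 1) ≤ T := (le_max_right _ _).trans hT
  rw [div_le_iff₀ (by linarith)] at hTa
  obtain ⟨y, hy, hle⟩ := h.exists_slice_eDen_le (ε := (b2 - b1) * ε) (by linarith) hTT
    (by linarith : 0 < b1) hb.le fun t ht => by
      have ht1 : 1 ≤ t := hT1.trans ht.1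
      have h1 := h.locE_add_outE_of_le (t := t) (a := b1 * t) (b := b2 * t) (by linarith)
        (by positivity) (by gcongr)
      have h2 := outE_nonneg ψ t (a := b2 * t) (by nlinarith)
      have h3 := hae t ht1 (b1 * t) (by nlinarith [ht.1])
      linarith
  refine ⟨y, hy, ?_⟩
  rw [mul_assoc] at hle
  exact le_of_mul_le_mul_left hle (by linarith)

/-- Small flux through rays close to the axis. -/
theorem exists_inner_ray (h : DegOneWave ψ) {T T' ε y1 : ℝ} (hT : 0 < T) (hTT : T ≤ T')
    (hy1 : 0 < y1) (hε : 0 < ε) : ∃ y, 0 < y ∧ y ≤ y1 ∧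
      y * ∫ t in T..T', eDen ψ t (y * t) ≤ ε * log (T' / T) := by
  have hT' : 0 < T' := hT.trans_le hTT
  obtain ⟨ρ, hρ, hρε⟩ := h.exists_radius_locE_le (T := T) (T' := T') hT (half_pos hε)
  set z := min y1 (ρ / T') / 2 with hz
  have hz0 : 0 < z := by positivity
  have hz1 : 2 * z ≤ y1 := by rw [hz]; linarith [min_le_left y1 (ρ / T')]
  have hz2 : 2 * z ≤ ρ / T' := by rw [hz]; linarith [min_le_right y1 (ρ / T')]
  rw [le_div_iff₀ hT'] at hz2
  obtain ⟨y, hy, hle⟩ := h.exists_slice_eDen_le (ε := ε / 2) hT hTT hz0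
    (by linarith : z ≤ 2 * z) fun t ht => by
      have ht0 := hT.trans_le ht.1
      have h1 := h.locE_add_locE (t := t) (a := 0) (b := z * t) (c := 2 * z * t) ht0 le_rfl
        (by positivity) (by nlinarith)
      have h2 := locE_nonneg ψ t (a := 0) (b := z * t) le_rfl
      have h3 := h.locE_mono_right ht0 le_rfl (by positivity)
        (by nlinarith [ht.2] : 2 * z * t ≤ ρ)
      linarith [hρε t ht]
  refine ⟨y, hz0.trans_le hy.1, hy.2.trans hz1, ?_⟩
  have h0 : 0 ≤ ∫ t in T..T', eDen ψ t (y * t) := intervalIntegral.integral_nonneg hTT fun t ht =>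
    eDen_nonneg ψ t (mul_pos (hz0.trans_le hy.1) (hT.trans_le ht.1)).le
  have := mul_le_mul_of_nonneg_right hy.2 h0
  linarith

end DegOneWave

namespace DegOneWave

variable {ψ : ℝ → ℝ → ℝ}

theorem abs_coneF_le (w Θ : ℝ → ℝ) (ψ : ℝ → ℝ → ℝ) {t y : ℝ} (ht : 0 < t) (hy : 0 < y) :
    |coneF w Θ ψ t (y * t)| ≤ (|w y| + y * |Θ y|) * (eDen ψ t (y * t) / 2) := by
  have h1 := abs_two_mom_le ψ t (mul_pos hy ht)
  have h0 := eDen_nonneg ψ t (mul_pos hy ht).le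
  have h2 : |mom ψ t (y * t)| ≤ eDen ψ t (y * t) / 2 := by
    rw [abs_mul, abs_two] at h1; linarith
  have e : coneF w Θ ψ t (y * t) = w y * (eDen ψ t (y * t) / 2) + y * Θ y * mom ψ t (y * t) := by
    rw [coneF, mul_div_cancel_right₀ _ ht.ne']
    field_simp
  rw [e, add_mul]
  refine (abs_add_le _ _).trans (add_le_add ?_ ?_)
  · rw [abs_mul, abs_of_nonneg (by linarith : 0 ≤ eDen ψ t (y * t) / 2)]
  · rw [abs_mul, abs_mul, abs_of_pos hy]
    gcongr

theorem abs_coneG_le (w Θ : ℝ → ℝ) (ψ : ℝ → ℝ → ℝ) {t y : ℝ} (ht : 0 < t) (hy : 0 < y) :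
    |coneG w Θ ψ t (y * t)| ≤ (|w y| + y * |Θ y|) * (eDen ψ t (y * t) / 2) := by
  have h1 := abs_two_mom_le ψ t (mul_pos hy ht)
  have h3 := abs_two_pres_le ψ t (mul_pos hy ht)
  have h2 : |mom ψ t (y * t)| ≤ eDen ψ t (y * t) / 2 := by
    rw [abs_mul, abs_two] at h1; linarith
  have h4 : |pres ψ t (y * t) / t| ≤ y * (eDen ψ t (y * t) / 2) := by
    rw [abs_mul, abs_two] at h3
    rw [abs_div, abs_of_pos ht, div_le_iff₀ ht]
    linarith
  have e : coneG w Θ ψ t (y * t) = -(w y * mom ψ t (y * t) + Θ y * (pres ψ t (y * t) / t)) := by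
    rw [coneG, mul_div_cancel_right₀ _ ht.ne']
    field_simp
  rw [e, abs_neg, add_mul]
  refine (abs_add_le _ _).trans (add_le_add ?_ ?_)
  · rw [abs_mul]
    gcongr
  · rw [abs_mul]
    linarith [mul_le_mul_of_nonneg_left h4 (abs_nonneg (Θ y))]

theorem abs_cone_ray_le (h : DegOneWave ψ) {T T' : ℝ} (hT : 0 < T) (hTT : T ≤ T') (w Θ : ℝ → ℝ)
    {y : ℝ} (hy : 0 < y) :
    |∫ t in T..T', (coneG w Θ ψ t (y * t) - y * coneF w Θ ψ t (y * t))| ≤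
      (1 + y) / 2 * (|w y| + y * |Θ y|) * ∫ t in T..T', eDen ψ t (y * t) := by
  rw [← intervalIntegral.integral_const_mul]
  have hi := intervalIntegrable_line h.continuousOn_eDen hT hTT (p0 := 0) (p1 := y)
    (fun t ht => by have := mul_pos hy (hT.trans_le ht.1); linarith)
  simp only [zero_add] at hi
  rw [← Real.norm_eq_abs]
  refine intervalIntegral.norm_integral_le_of_norm_le hTT ?_ (hi.const_mul _)
  filter_upwards with t ht
  have ht0 := hT.trans ht.1
  have h1 := abs_coneF_le w Θ ψ ht0 hy
  have h2 := abs_coneG_le w Θ ψ ht0 hy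
  rw [Real.norm_eq_abs]
  refine (abs_sub _ _).trans ?_
  rw [abs_mul, abs_of_pos hy]
  nlinarith

theorem abs_cone_slab_le (h : DegOneWave ψ) {t y0 y1 M : ℝ} (ht : 0 < t) (hy0 : 0 < y0)
    (hy : y0 ≤ y1) {w Θ : ℝ → ℝ} (hM : ∀ y ∈ Icc y0 y1, |w y| + y * |Θ y| ≤ M) :
    |∫ y in y0..y1, t * coneF w Θ ψ t (y * t)| ≤ 6 * M := by
  have hM0 : 0 ≤ M := le_trans (by positivity) (hM y0 (left_mem_Icc.2 hy))
  have hi : IntervalIntegrable (fun y => t * eDen ψ t (y * t)) volume y0 y1 := by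
    refine (ContinuousOn.intervalIntegrable_of_Icc hy ?_).const_mul _
    exact h.continuousOn_eDen.comp (f := fun y => (t, y * t)) (by fun_prop)
      fun y hy => ⟨ht, mul_pos (hy0.trans_le hy.1) ht⟩
  have : |∫ y in y0..y1, t * coneF w Θ ψ t (y * t)| ≤
      ∫ y in y0..y1, M / 2 * (t * eDen ψ t (y * t)) := by
    rw [← Real.norm_eq_abs]
    refine intervalIntegral.norm_integral_le_of_norm_le hy ?_ (hi.const_mul _)
    filter_upwards with y hy'
    have hyp := hy0.trans hy'.1
    have h1 := abs_coneF_le w Θ ψ ht hyp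
    have h0 := eDen_nonneg ψ t (mul_pos hyp ht).le
    rw [Real.norm_eq_abs, abs_mul, abs_of_pos ht]
    have h2 := h1.trans (mul_le_mul_of_nonneg_right (hM y (Ioc_subset_Icc_self hy'))
      (by linarith : 0 ≤ eDen ψ t (y * t) / 2))
    calc _ ≤ t * (M * (eDen ψ t (y * t) / 2)) := by gcongr
      _ = _ := by ring
  rw [intervalIntegral.integral_const_mul (M / 2), integral_cone_eDen ht hy] at this
  have h3 := h.locE_lt ht (a := y0 * t) (b := y1 * t) (by positivity)
  nlinarith

theorem continuousOn_coneD (h : DegOneWave ψ) {T T' y0 y1 : ℝ} (hT : 0 < T) (hy0 : 0 < y0)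
    {w' Θ Θ' : ℝ → ℝ} (hw' : ContinuousOn w' (Icc y0 y1)) (hΘ : ContinuousOn Θ (Icc y0 y1))
    (hΘ' : ContinuousOn Θ' (Icc y0 y1)) :
    ContinuousOn (fun p : ℝ × ℝ => coneD w' Θ Θ' ψ p.1 (p.2 * p.1)) (Icc T T' ×ˢ Icc y0 y1) := by
  have pos : ∀ p ∈ Icc T T' ×ˢ Icc y0 y1, p.1 ≠ 0 := fun p hp => (hT.trans_le hp.1.1).ne'
  have hsnd : ContinuousOn (Prod.snd : ℝ × ℝ → ℝ) (Icc T T' ×ˢ Icc y0 y1) := continuousOn_snd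
  have k1 := hw'.comp hsnd fun p hp => hp.2
  have k2 := hΘ.comp hsnd fun p hp => hp.2
  have k3 := hΘ'.comp hsnd fun p hp => hp.2
  have k4 := continuousOn_cone h.continuousOn_eDen hT hy0 (T' := T') (y1 := y1)
  have k5 := continuousOn_cone h.continuousOn_mom hT hy0 (T' := T') (y1 := y1)
  have k6 := continuousOn_cone h.continuousOn_pres hT hy0 (T' := T') (y1 := y1)
  have k7 := continuousOn_cone h.continuousOn_pT hT hy0 (T' := T') (y1 := y1)
  have gen : ∀ {a b c e m q v : ℝ × ℝ → ℝ} {s : Set (ℝ × ℝ)}, ContinuousOn a s → ContinuousOn b s →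
      ContinuousOn c s → ContinuousOn e s → ContinuousOn m s → ContinuousOn q s →
      ContinuousOn v s → (∀ p ∈ s, p.1 ≠ 0) → ContinuousOn (fun p => a p * (p.2 * (e p / 2) + m p)
        + (b p + p.2 * c p) * p.2 * m p + c p * (q p / p.1) + b p * (p.2 * p.1 * v p ^ 2)) s := by
    intros; fun_prop (disch := assumption)
  refine (gen k1 k2 k3 k4 k5 k6 k7 pos).congr fun p hp => ?_
  simp only [coneD, mul_div_cancel_right₀ _ (pos p hp), Function.comp]

/-- Estimate of the total dissipation on a truncated cone by its boundary contributions. -/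
theorem abs_double_integral_coneD_le (h : DegOneWave ψ) {T T' y0 y1 M : ℝ} (hT : 0 < T)
    (hTT : T ≤ T') (hy0 : 0 < y0) (hy : y0 ≤ y1) {w w' Θ Θ' : ℝ → ℝ}
    (hw : ∀ y ∈ Icc y0 y1, HasDerivAt w (w' y) y) (hΘ : ∀ y ∈ Icc y0 y1, HasDerivAt Θ (Θ' y) y)
    (hw' : ContinuousOn w' (Icc y0 y1)) (hΘ' : ContinuousOn Θ' (Icc y0 y1))
    (hM : ∀ y ∈ Icc y0 y1, |w y| + y * |Θ y| ≤ M) :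
    |∫ t in T..T', ∫ y in y0..y1, coneD w' Θ Θ' ψ t (y * t)| ≤ 12 * M
      + (1 + y1) / 2 * (|w y1| + y1 * |Θ y1|) * (∫ t in T..T', eDen ψ t (y1 * t))
      + (1 + y0) / 2 * (|w y0| + y0 * |Θ y0|) * ∫ t in T..T', eDen ψ t (y0 * t) := by
  rw [h.cone_identity hT hTT hy0 hy hw hΘ hw' hΘ']
  have h1 := abs_le.1 (h.abs_cone_slab_le hT hy0 hy hM)
  have h2 := abs_le.1 (h.abs_cone_slab_le (hT.trans_le hTT) hy0 hy hM)
  have h3 := abs_le.1 (h.abs_cone_ray_le hT hTT w Θ hy0)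
  have h4 := abs_le.1 (h.abs_cone_ray_le hT hTT w Θ (hy0.trans_le hy))
  rw [abs_le]
  constructor <;> linarith [h1.1, h1.2, h2.1, h2.2, h3.1, h3.2, h4.1, h4.2]

/-- Integrand of the self-similar dissipation. -/
def selfSim (ψ : ℝ → ℝ → ℝ) (t y : ℝ) : ℝ :=
  y * t * (pT ψ t (y * t) + y * pR ψ t (y * t)) ^ 2

theorem continuousOn_selfSim (h : DegOneWave ψ) {T T' y0 y1 : ℝ} (hT : 0 < T) (hy0 : 0 < y0) :
    ContinuousOn (fun p : ℝ × ℝ => selfSim ψ p.1 p.2) (Icc T T' ×ˢ Icc y0 y1) := by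
  have h1 := continuousOn_cone h.continuousOn_pT hT hy0 (T' := T') (y1 := y1)
  have h2 := continuousOn_cone h.continuousOn_pR hT hy0 (T' := T') (y1 := y1)
  unfold selfSim
  fun_prop

theorem coneD_power_ge {k t y : ℝ} (hk : 0 < k) (hk' : k ≤ 1 / 2) (ht : 0 < t) (hy : 0 < y)
    (hy2 : y ^ 2 ≤ 1 + k ^ 2) :
    1 / 8 * selfSim ψ t y - 4 * k * eDen ψ t (y * t) ≤
      coneD (fun y => y / √(1 + 2 * k ^ 2 - y ^ 2) ^ 3) (fun y => 1 / √(1 + 2 * k ^ 2 - y ^ 2))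
        (fun y => y / √(1 + 2 * k ^ 2 - y ^ 2) ^ 3) ψ t (y * t) := by
  set p := 1 + 2 * k ^ 2 - y ^ 2 with hp
  have hpk : k ^ 2 ≤ p := by rw [hp]; linarith
  have hp0 : 0 < p := lt_of_lt_of_le (by positivity) hpk
  set s := √p with hs
  have hss : s ^ 2 = p := sq_sqrt hp0.le
  have hs0 : 0 < s := sqrt_pos.2 hp0
  have hks : k ≤ s := by
    rw [hs]; exact le_sqrt_of_sq_le hpk
  set a := pT ψ t (y * t)
  set b := pR ψ t (y * t)
  set r := y * t with hr
  have hr0 : 0 < r := mul_pos hy ht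
  have e : coneD (fun y => y / √(1 + 2 * k ^ 2 - y ^ 2) ^ 3) (fun y => 1 / √(1 + 2 * k ^ 2 - y ^ 2))
        (fun y => y / √(1 + 2 * k ^ 2 - y ^ 2) ^ 3) ψ t r =
      r * (1 / s ^ 3 * ((1 + 2 * k ^ 2) * (a + y * b) ^ 2 - 2 * k ^ 2 * y * (a + y * b) * b)) := by
    have hyr : r / t = y := mul_div_cancel_right₀ _ ht.ne'
    have hk2 : 2 * k ^ 2 = s ^ 2 + y ^ 2 - 1 := by rw [hss, hp]; ring
    simp only [coneD, hyr, eDen_eq ψ t hr0, mom, pres, ← hp, ← hs]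
    rw [hk2, hr]
    field_simp
    ring
  rw [e]
  have hs32 : s ^ 3 ≤ 2 := by
    have h1 : s ^ 2 ≤ 3 / 2 := by rw [hss, hp]; nlinarith
    have h2 : s ≤ 5 / 4 := by nlinarith
    nlinarith
  have hq1 : 1 / 2 ≤ 1 / s ^ 3 := one_div_le_one_div_of_le (by positivity) hs32
  have hq2 : 1 / s ^ 3 * k ^ 3 ≤ 1 := by
    rw [one_div, inv_mul_le_iff₀ (by positivity), mul_one]; gcongr
  have hb : b ^ 2 * r ≤ eDen ψ t r := pR_sq_le ψ t hr0.le
  set q := 1 / s ^ 3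
  have hv : 2 * k ^ 2 * y * (a + y * b) * b ≤ 1 / 2 * (a + y * b) ^ 2 + 2 * k ^ 4 * y ^ 2 * b ^ 2 := by
    nlinarith [sq_nonneg ((a + y * b) - 2 * k ^ 2 * y * b)]
  have hq0 : 0 < q := by positivity
  have h1 : q * (1 / 2 * (a + y * b) ^ 2 - 2 * k ^ 4 * y ^ 2 * b ^ 2) ≤
      q * ((1 + 2 * k ^ 2) * (a + y * b) ^ 2 - 2 * k ^ 2 * y * (a + y * b) * b) := by
    refine mul_le_mul_of_nonneg_left ?_ hq0.le
    nlinarith [mul_nonneg (sq_nonneg k) (sq_nonneg (a + y * b))]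
  have h2 : 1 / 8 * (a + y * b) ^ 2 - 4 * k * b ^ 2 ≤
      q * (1 / 2 * (a + y * b) ^ 2 - 2 * k ^ 4 * y ^ 2 * b ^ 2) := by
    have h3 : 1 / 8 * (a + y * b) ^ 2 ≤ q * (1 / 2 * (a + y * b) ^ 2) := by
      nlinarith [sq_nonneg (a + y * b)]
    have h4 : q * (2 * k ^ 4 * y ^ 2 * b ^ 2) ≤ 4 * k * b ^ 2 := by
      have : q * (2 * k ^ 4 * y ^ 2 * b ^ 2) = (q * k ^ 3) * (2 * k * y ^ 2 * b ^ 2) := by ring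
      rw [this]
      have h5 : y ^ 2 ≤ 2 := by nlinarith
      calc _ ≤ 1 * (2 * k * y ^ 2 * b ^ 2) := by gcongr
        _ ≤ 1 * (2 * k * 2 * b ^ 2) := by gcongr
        _ = _ := by ring
    linarith
  have h6 := mul_le_mul_of_nonneg_left (h2.trans h1) hr0.le
  have h7 : selfSim ψ t y = r * (a + y * b) ^ 2 := rfl
  rw [h7]
  nlinarith

theorem exists_integral_selfSim_le (h : DegOneWave ψ) {ε : ℝ} (hε : 0 < ε) :
    ∃ T0 ≥ 1, ∃ C, ∀ T ≥ T0, ∀ T' ≥ T, ∀ y0, 0 < y0 → y0 < 1 →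
      ∫ t in T..T', ∫ y in y0..1, selfSim ψ t y ≤ C + ε * log (T' / T) := by
  set k := min (1 / 2) (ε / 1200) with hk
  have hk0 : 0 < k := by positivity
  have hk1 : k ≤ 1 / 2 := min_le_left _ _
  have hk2 : k ≤ ε / 1200 := min_le_right _ _
  obtain ⟨T0, hT0, H⟩ := h.exists_outer_ray (b1 := 1 + k ^ 2 / 6) (b2 := 1 + k ^ 2 / 3)
    (ε := ε * k / 144) (by nlinarith) (by nlinarith) (by positivity)
  refine ⟨T0, hT0, 288 / k, fun T hT T' hTT y0 hy0 hy01 => ?_⟩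
  have hT1 : 0 < T := by linarith
  obtain ⟨y1, hy1, hout⟩ := H T hT T' hTT
  obtain ⟨z, hz, hzy, hin⟩ := h.exists_inner_ray (ε := ε * k / 24) hT1 hTT hy0 (by positivity)
  have hy11 : 1 < y1 := lt_of_lt_of_le (by nlinarith) hy1.1
  have hzy1 : z ≤ y1 := by linarith
  have hL : 0 ≤ log (T' / T) := log_nonneg ((one_le_div hT1).2 hTT)
  have hsq : ∀ y ∈ Icc z y1, y ^ 2 ≤ 1 + k ^ 2 := fun y hy => by
    have h1 : y ≤ 1 + k ^ 2 / 3 := hy.2.trans hy1.2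
    have h2 : y ^ 2 ≤ (1 + k ^ 2 / 3) ^ 2 := pow_le_pow_left₀ (hz.le.trans hy.1) h1 2
    have h3 : k ^ 2 ≤ 1 := by nlinarith
    nlinarith [mul_le_mul_of_nonneg_left h3 (sq_nonneg k)]
  have hp0 : ∀ y ∈ Icc z y1, k ^ 2 ≤ 1 + 2 * k ^ 2 - y ^ 2 := fun y hy => by linarith [hsq y hy]
  have hsp : ∀ y ∈ Icc z y1, k ≤ √(1 + 2 * k ^ 2 - y ^ 2) := fun y hy => le_sqrt_of_sq_le (hp0 y hy)
  have hder : ∀ y ∈ Icc z y1, HasDerivAt (fun y => 1 / √(1 + 2 * k ^ 2 - y ^ 2))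
      (y / √(1 + 2 * k ^ 2 - y ^ 2) ^ 3) y := fun y hy => by
    have h1 : HasDerivAt (fun y : ℝ => 1 + 2 * k ^ 2 - y ^ 2) (-(2 * y)) y := by
      simpa using (hasDerivAt_pow 2 y).const_sub (1 + 2 * k ^ 2)
    have hpos := hk0.trans_le (hsp y hy)
    have h2 := (h1.sqrt (sqrt_pos.1 hpos).ne').inv hpos.ne'
    simp only [one_div]
    refine h2.congr_deriv ?_
    field_simp
  have hcont : ContinuousOn (fun y => y / √(1 + 2 * k ^ 2 - y ^ 2) ^ 3) (Icc z y1) := by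
    refine continuousOn_id.div (by fun_prop) fun y hy => (pow_pos (hk0.trans_le (hsp y hy)) 3).ne'
  have hinv : ∀ y ∈ Icc z y1, 0 ≤ 1 / √(1 + 2 * k ^ 2 - y ^ 2) ∧
      1 / √(1 + 2 * k ^ 2 - y ^ 2) ≤ 1 / k := fun y hy =>
    ⟨by positivity, one_div_le_one_div_of_le hk0 (hsp y hy)⟩
  set c0 := 1 / √(1 + 2 * k ^ 2 - z ^ 2) with hc0
  have hc0' := hinv z ⟨le_rfl, hzy1⟩
  have hy1' : y1 ≤ 5 / 4 := hy1.2.trans (by nlinarith)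
  have hM : ∀ y ∈ Icc z y1, |1 / √(1 + 2 * k ^ 2 - y ^ 2) - c0| +
      y * |1 / √(1 + 2 * k ^ 2 - y ^ 2)| ≤ 3 / k := fun y hy => by
    have h1 := hinv y hy
    have h2 : |1 / √(1 + 2 * k ^ 2 - y ^ 2) - c0| ≤ 1 / k := by
      rw [abs_le]; constructor <;> linarith [h1.1, h1.2, hc0'.1, hc0'.2]
    rw [abs_of_nonneg h1.1]
    have h3 : y * (1 / √(1 + 2 * k ^ 2 - y ^ 2)) ≤ 2 * (1 / k) :=
      mul_le_mul (by linarith [hy.2]) h1.2 h1.1 (by norm_num)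
    have : 3 / k = 1 / k + 2 * (1 / k) := by ring
    linarith
  have key := (abs_le.1 (h.abs_double_integral_coneD_le hT1 hTT hz hzy1
    (w := fun y => 1 / √(1 + 2 * k ^ 2 - y ^ 2) - c0) (fun y hy => (hder y hy).sub_const c0)
    hder hcont hcont hM)).2
  have hcD : ContinuousOn (fun p : ℝ × ℝ => 1 / 8 * selfSim ψ p.1 p.2 +
      -(4 * k) * eDen ψ p.1 (p.2 * p.1)) (Icc T T' ×ˢ Icc z y1) := by
    have h1 := continuousOn_selfSim h hT1 hz (T' := T') (y1 := y1)
    have h2 := continuousOn_cone h.continuousOn_eDen hT1 hz (T' := T') (y1 := y1)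
    fun_prop
  have hcD' : ContinuousOn (fun p : ℝ × ℝ => coneD (fun y => y / √(1 + 2 * k ^ 2 - y ^ 2) ^ 3)
      (fun y => 1 / √(1 + 2 * k ^ 2 - y ^ 2)) (fun y => y / √(1 + 2 * k ^ 2 - y ^ 2) ^ 3) ψ
      p.1 (p.2 * p.1)) (Icc T T' ×ˢ Icc z y1) :=
    h.continuousOn_coneD hT1 hz hcont (fun y hy => (hder y hy).continuousAt.continuousWithinAt)
      hcont
  have h1 := double_integral_mono (f := fun t y => 1 / 8 * selfSim ψ t y +
      -(4 * k) * eDen ψ t (y * t)) (g := fun t y => coneD (fun y => y / √(1 + 2 * k ^ 2 - y ^ 2) ^ 3)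
      (fun y => 1 / √(1 + 2 * k ^ 2 - y ^ 2)) (fun y => y / √(1 + 2 * k ^ 2 - y ^ 2) ^ 3) ψ
      t (y * t)) hTT hzy1 hcD hcD' fun t ht y hy => by
    have := coneD_power_ge (ψ := ψ) hk0 hk1 (hT1.trans_le ht.1) (hz.trans_le hy.1) (hsq y hy)
    linarith
  rw [double_integral_linear hTT hzy1 _ _ (continuousOn_selfSim h hT1 hz)
    (continuousOn_cone h.continuousOn_eDen hT1 hz)] at h1
  have h2 := h.double_integral_eDen_le hT1 hTT hz hzy1 (ε := 12) fun t ht =>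
    (h.locE_lt (hT1.trans_le ht.1) (mul_pos hz (hT1.trans_le ht.1)).le).le
  have h3 := double_integral_mono_interval (f := selfSim ψ) hTT hy01.le hzy hy11.le
    (continuousOn_selfSim h hT1 hz) fun t ht y hy =>
      mul_nonneg (mul_pos (hz.trans_le hy.1) (hT1.trans_le ht.1)).le (sq_nonneg _)
  have e0 : 0 ≤ ∫ t in T..T', eDen ψ t (y1 * t) := intervalIntegral.integral_nonneg hTT
    fun t ht => eDen_nonneg ψ t (mul_pos (by linarith) (hT1.trans_le ht.1)).le
  have e1 : 0 ≤ ∫ t in T..T', eDen ψ t (z * t) := intervalIntegral.integral_nonneg hTT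
    fun t ht => eDen_nonneg ψ t (mul_pos hz (hT1.trans_le ht.1)).le
  have h4 : (1 + y1) / 2 * (|1 / √(1 + 2 * k ^ 2 - y1 ^ 2) - c0| +
      y1 * |1 / √(1 + 2 * k ^ 2 - y1 ^ 2)|) * (∫ t in T..T', eDen ψ t (y1 * t)) ≤
      ε / 24 * log (T' / T) := by
    calc _ ≤ 2 * (3 / k) * (ε * k / 144 * log (T' / T)) := by
          refine mul_le_mul (mul_le_mul (by linarith) (hM y1 ⟨hzy1, le_rfl⟩) (by positivity)
            (by norm_num)) hout e0 (by positivity)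
      _ = _ := by field_simp; ring
  have h5 : (1 + z) / 2 * (|1 / √(1 + 2 * k ^ 2 - z ^ 2) - c0| +
      z * |1 / √(1 + 2 * k ^ 2 - z ^ 2)|) * (∫ t in T..T', eDen ψ t (z * t)) ≤
      ε / 24 * log (T' / T) := by
    rw [← hc0, sub_self, abs_zero, zero_add, abs_of_nonneg hc0'.1]
    calc (1 + z) / 2 * (z * c0) * (∫ t in T..T', eDen ψ t (z * t))
        = (1 + z) / 2 * c0 * (z * ∫ t in T..T', eDen ψ t (z * t)) := by ring
      _ ≤ 1 * (1 / k) * (ε * k / 24 * log (T' / T)) := by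
          refine mul_le_mul (mul_le_mul (by linarith) hc0'.2 hc0'.1 (by norm_num)) hin
            (mul_nonneg hz.le e1) (by positivity)
      _ = _ := by field_simp
  have h6 : 4 * k * (∫ t in T..T', ∫ y in z..y1, eDen ψ t (y * t)) ≤
      ε / 25 * log (T' / T) := by
    calc _ ≤ 4 * k * (12 * log (T' / T)) := by gcongr
      _ ≤ 4 * (ε / 1200) * (12 * log (T' / T)) := by gcongr
      _ = _ := by ring
  have h7 : 12 * (3 / k) = 36 / k := by ring
  have h8 : 288 / k = 8 * (36 / k) := by ring
  have h9 := mul_nonneg hε.le hL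
  linarith

end DegOneWave

/-- A function of `a - b` type oscillation is controlled by the Dirichlet energy. -/
theorem sq_sub_le_integral_mul_log {v v' : ℝ → ℝ} {a b : ℝ} (ha : 0 < a) (hab : a ≤ b)
    (hv : ∀ r ∈ Icc a b, HasDerivAt v (v' r) r) (hv' : ContinuousOn v' (Icc a b)) :
    (v b - v a) ^ 2 ≤ (∫ r in a..b, v' r ^ 2 * r) * log (b / a) := by
  have hL : 0 ≤ log (b / a) := log_nonneg ((one_le_div ha).2 hab)
  have hi : IntervalIntegrable v' volume a b := hv'.intervalIntegrable_of_Icc hab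
  have hi2 : IntervalIntegrable (fun r => v' r ^ 2 * r) volume a b :=
    ContinuousOn.intervalIntegrable_of_Icc hab (by fun_prop)
  have hftc : ∫ r in a..b, v' r = v b - v a :=
    intervalIntegral.integral_eq_sub_of_hasDerivAt (fun r hr => hv r (by rwa [uIcc_of_le hab] at hr))
      hi
  rcases hL.eq_or_lt with h0 | h0
  · have : b / a = 1 := by
      rcases log_eq_zero.1 h0.symm with h | h | h
      · have := div_pos (ha.trans_le hab) ha; linarith
      · exact h
      · have := div_pos (ha.trans_le hab) ha; linarith
    have : b = a := by rwa [div_eq_one_iff_eq ha.ne'] at this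
    simp [this]
  set L := log (b / a)
  set m := (v b - v a) / L with hm
  have key : 0 ≤ ∫ r in a..b, (v' r ^ 2 * r - 2 * m * v' r + m ^ 2 / r) := by
    refine intervalIntegral.integral_nonneg hab fun r hr => ?_
    have hr0 : 0 < r := ha.trans_le hr.1
    have : v' r ^ 2 * r - 2 * m * v' r + m ^ 2 / r = (v' r * r - m) ^ 2 / r := by
      field_simp; ring
    rw [this]; positivity
  rw [intervalIntegral.integral_add (hi2.sub (hi.const_mul _)) (intervalIntegrable_const_div ha hab _),
    intervalIntegral.integral_sub hi2 (hi.const_mul _), intervalIntegral.integral_const_mul, hftc,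
    integral_const_div ha hab] at key
  have e : v b - v a = m * L := by rw [hm]; field_simp
  rw [e] at key ⊢
  nlinarith

theorem one_add_cos_le (a b : ℝ) : 2 * (1 + cos a) ≤ 2 * (2 * (1 + cos b)) + 2 * (a - b) ^ 2 := by
  have h1 : 2 * (1 + cos a) = (2 * cos (a / 2)) ^ 2 := by
    have := cos_sq (a / 2); rw [show 2 * (a / 2) = a by ring] at this; linarith
  have h2 : 2 * (1 + cos b) = (2 * cos (b / 2)) ^ 2 := by
    have := cos_sq (b / 2); rw [show 2 * (b / 2) = b by ring] at this; linarith
  have h3 : (2 * cos (a / 2) - 2 * cos (b / 2)) ^ 2 ≤ (a - b) ^ 2 := by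
    have h4 : |cos (a / 2) - cos (b / 2)| ≤ |a / 2 - b / 2| := abs_cos_sub_cos_le _ _
    refine sq_le_sq.2 ?_
    rw [← mul_sub, abs_mul, abs_two]
    rw [show a / 2 - b / 2 = (a - b) / 2 by ring, abs_div, abs_two] at h4
    linarith
  rw [h1, h2]
  nlinarith [sq_nonneg (2 * cos (a / 2) - 2 * (2 * cos (b / 2)))]

namespace DegOneWave

variable {ψ : ℝ → ℝ → ℝ}

theorem osc_sq_le (h : DegOneWave ψ) {t a b : ℝ} (ht : 0 < t) (ha : 0 < a) (hab : a ≤ b) :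
    (ψ t b - ψ t a) ^ 2 ≤ (∫ r in a..b, pR ψ t r ^ 2 * r) * log (b / a) :=
  sq_sub_le_integral_mul_log ha hab (fun _ hr => h.hasDerivAt_r ht (ha.trans_le hr.1))
    (h.continuousOn_pR.comp (f := fun r => (t, r)) (by fun_prop)
      fun _ hr => ⟨ht, ha.trans_le hr.1⟩)

theorem integral_pR_sq_le (h : DegOneWave ψ) {t a b : ℝ} (ht : 0 < t) (ha : 0 < a) (hab : a ≤ b) :
    ∫ r in a..b, pR ψ t r ^ 2 * r ≤ locE ψ t a b := by
  rw [locE_eq_intervalIntegral hab]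
  have h1 := continuousOn_slice h.continuousOn_pR ht
  refine intervalIntegral.integral_mono_on hab ?_
    (intervalIntegrable_slice h.continuousOn_eDen ht ha (ha.trans_le hab))
    fun r hr => pR_sq_le ψ t (ha.le.trans hr.1)
  refine ContinuousOn.intervalIntegrable_of_Icc hab ?_
  have := h1.mono (fun r hr => ha.trans_le hr.1 : Icc a b ⊆ Ioi 0)
  fun_prop

theorem abs_cos_sub_cos_le_locE (h : DegOneWave ψ) {t a b : ℝ} (ht : 0 < t) (ha : 0 < a)
    (hab : a ≤ b) : |cos (ψ t b) - cos (ψ t a)| ≤ locE ψ t a b / 2 := by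
  have h1 := continuousOn_slice h.continuousOn_pR ht
  have h2 := continuousOn_slice h.continuousOn ht
  have hsub : Icc a b ⊆ Ioi 0 := fun r hr => ha.trans_le hr.1
  have h1' := h1.mono hsub
  have h2' := h2.mono hsub
  have hftc := intervalIntegral.integral_eq_sub_of_hasDerivAt (a := a) (b := b)
    (f := fun r => cos (ψ t r)) (f' := fun r => -sin (ψ t r) * pR ψ t r)
    (fun r hr => by
      rw [uIcc_of_le hab] at hr
      exact (h.hasDerivAt_r ht (hsub hr)).cos)
    (ContinuousOn.intervalIntegrable_of_Icc hab (by fun_prop))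
  rw [← hftc, locE_eq_intervalIntegral hab, ← intervalIntegral.integral_div, ← Real.norm_eq_abs]
  refine intervalIntegral.norm_integral_le_of_norm_le hab ?_
    ((intervalIntegrable_slice h.continuousOn_eDen ht ha (ha.trans_le hab)).div_const 2)
  filter_upwards with r hr
  have hr0 : 0 < r := ha.trans hr.1
  rw [eDen_eq ψ t hr0, Real.norm_eq_abs, abs_mul, abs_neg]
  have h3 : 2 * (|sin (ψ t r)| * |pR ψ t r|) ≤ r * pR ψ t r ^ 2 + sin (ψ t r) ^ 2 / r := by
    rw [← sq_abs (pR ψ t r), ← sq_abs (sin (ψ t r))]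
    have : r * |pR ψ t r| ^ 2 + |sin (ψ t r)| ^ 2 / r - 2 * (|sin (ψ t r)| * |pR ψ t r|) =
      (r * |pR ψ t r| - |sin (ψ t r)|) ^ 2 / r := by field_simp; ring
    have h5 : 0 ≤ (r * |pR ψ t r| - |sin (ψ t r)|) ^ 2 / r := by positivity
    linarith
  have h4 : 0 ≤ r * pT ψ t r ^ 2 := by positivity
  linarith

theorem one_sub_cos_le (h : DegOneWave ψ) {t r : ℝ} (ht : 0 < t) (hr : 0 < r) :
    1 - cos (ψ t r) ≤ locE ψ t 0 r / 2 := by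
  have h1 : Tendsto (fun a => cos (ψ t a) - cos (ψ t r)) (nhdsWithin 0 (Ioi 0))
      (nhds (cos 0 - cos (ψ t r))) :=
    ((continuous_cos.tendsto _).comp (h.bc t ht.le).1).sub_const _
  rw [cos_zero] at h1
  refine le_of_tendsto h1 ?_
  filter_upwards [Ioc_mem_nhdsGT hr] with a ha
  have h2 := (abs_le.1 (h.abs_cos_sub_cos_le_locE ht ha.1 ha.2)).1
  have h3 := h.locE_add_locE ht le_rfl ha.1.le ha.2
  have h4 := locE_nonneg ψ t (b := a) le_rfl
  linarith

theorem one_add_cos_le_outE (h : DegOneWave ψ) {t r : ℝ} (ht : 0 < t) (hr : 0 < r) :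
    1 + cos (ψ t r) ≤ outE ψ t r / 2 := by
  have h1 : Tendsto (fun b => cos (ψ t r) - cos (ψ t b)) atTop
      (nhds (cos (ψ t r) - cos π)) :=
    ((continuous_cos.tendsto _).comp (h.bc t ht.le).2).const_sub _
  rw [cos_pi] at h1
  have : cos (ψ t r) - -1 ≤ outE ψ t r / 2 := by
    refine le_of_tendsto h1 ?_
    filter_upwards [eventually_ge_atTop r] with b hb
    have h2 := (abs_le.1 (h.abs_cos_sub_cos_le_locE ht hr hb)).1
    have h3 := h.locE_add_outE_of_le ht hr.le hb
    have h4 := outE_nonneg ψ t (hr.le.trans hb)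
    linarith
  linarith

/-- Close to the light cone the map stays close to `π`. -/
theorem exists_near_cone (h : DegOneWave ψ) {c : ℝ} (hc : 1 / 2 < c) (hc1 : c < 1) :
    ∃ T0 ≥ 1, ∀ t ≥ T0, 2 * (1 + cos (ψ t (c * t))) ≤ 100 * (1 - c) := by
  have hc0 : 0 < c := by linarith
  obtain ⟨a, ha, hae⟩ := h.exists_exterior (δ := 2 * (1 - c)) (by linarith)
  refine ⟨max 1 (a / (1 - c)), le_max_left _ _, fun t ht => ?_⟩
  have ht1 : 1 ≤ t := (le_max_left _ _).trans ht
  have hta : a / (1 - c) ≤ t := (le_max_right _ _).trans ht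
  rw [div_le_iff₀ (by linarith)] at hta
  have ht0 : 0 < t := by linarith
  have hr2 : a + t ≤ t / c := by
    rw [le_div_iff₀ hc0]; nlinarith
  have hle : c * t ≤ t / c := by nlinarith
  have h1 := h.one_add_cos_le_outE ht0 (div_pos ht0 hc0)
  have h2 := hae t ht1 _ hr2
  have h3 := h.osc_sq_le ht0 (mul_pos hc0 ht0) hle
  have h4 := h.integral_pR_sq_le ht0 (mul_pos hc0 ht0) hle
  have h5 := h.locE_lt ht0 (a := c * t) (b := t / c) (by positivity)
  have h6 : log (t / c / (c * t)) ≤ 4 * (1 - c) := by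
    have e : t / c / (c * t) = c⁻¹ ^ 2 := by field_simp
    rw [e, log_pow]
    have := log_le_sub_one_of_pos (inv_pos.2 hc0)
    have h7 : c⁻¹ - 1 ≤ 2 * (1 - c) := by
      have : c⁻¹ * c = 1 := inv_mul_cancel₀ hc0.ne'
      have : c⁻¹ ≤ 2 := by rw [inv_le_comm₀ hc0 (by norm_num)]; linarith
      nlinarith
    push_cast
    linarith
  have h8 : 0 ≤ log (t / c / (c * t)) := log_nonneg ((one_le_div (by positivity)).2 hle)
  have h9 : (ψ t (t / c) - ψ t (c * t)) ^ 2 ≤ 12 * (4 * (1 - c)) :=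
    h3.trans ((mul_le_mul_of_nonneg_right (h4.trans h5.le) h8).trans (by linarith))
  have h10 := one_add_cos_le (ψ t (c * t)) (ψ t (t / c))
  have : (ψ t (c * t) - ψ t (t / c)) ^ 2 = (ψ t (t / c) - ψ t (c * t)) ^ 2 := by ring
  linarith

end DegOneWave

/-- The multiplier `(y / (1 + √(1 - y²)))⁴`. -/
def omg (y : ℝ) : ℝ := (y / (1 + √(1 - y ^ 2))) ^ 4

theorem omg_nonneg (y : ℝ) : 0 ≤ omg y := by unfold omg; positivity

theorem omg_le_one {y : ℝ} (hy : 0 ≤ y) (hy1 : y ≤ 1) : omg y ≤ 1 := by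
  have := sqrt_nonneg (1 - y ^ 2)
  refine pow_le_one₀ (by positivity) ?_
  rw [div_le_one (by positivity)]; linarith

theorem pow_div_le_omg {y : ℝ} (hy : 0 ≤ y) : (y / 2) ^ 4 ≤ omg y := by
  have h1 : √(1 - y ^ 2) ≤ 1 := by rw [Real.sqrt_le_one]; nlinarith [sq_nonneg y]
  have h2 := sqrt_nonneg (1 - y ^ 2)
  unfold omg
  gcongr
  linarith

theorem hasDerivAt_omg {y : ℝ} (hy : 0 < y) (hy1 : y < 1) :
    HasDerivAt omg (4 * omg y / (y * √(1 - y ^ 2))) y := by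
  have hp : 0 < 1 - y ^ 2 := by nlinarith
  have hS : 0 < √(1 - y ^ 2) := sqrt_pos.2 hp
  have hSS : √(1 - y ^ 2) ^ 2 = 1 - y ^ 2 := sq_sqrt hp.le
  have h1 : HasDerivAt (fun y : ℝ => 1 - y ^ 2) (-(2 * y)) y := by
    simpa using (hasDerivAt_pow 2 y).const_sub 1
  have h2 := (h1.sqrt hp.ne').const_add 1
  have h3 := ((hasDerivAt_id y).div h2 (by positivity)).pow 4
  refine (h3.congr_deriv ?_ : HasDerivAt omg _ y)
  unfold omg
  simp only [id, Pi.div_apply]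
  set S := √(1 - y ^ 2)
  clear_value S
  have hy2 : y ^ 2 = 1 - S ^ 2 := by linarith
  have hS1 : 1 + S ≠ 0 := by positivity
  norm_num only [Nat.cast_ofNat, Nat.reduceSub]
  field_simp
  rw [hy2]; ring

/-- Radial derivative density in self-similar variables. -/
def radDen (ψ : ℝ → ℝ → ℝ) (t y : ℝ) : ℝ := y * t * pR ψ t (y * t) ^ 2

/-- Kinetic density in self-similar variables. -/
def kinDen (ψ : ℝ → ℝ → ℝ) (t y : ℝ) : ℝ := y * t * pT ψ t (y * t) ^ 2

/-- The self-similar radial derivative of `2 ω(y) (1 + cos ψ(t, y t))`, divided by `t`. -/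
def bdryDen (ψ : ℝ → ℝ → ℝ) (t y : ℝ) : ℝ :=
  1 / t * (2 * (4 * omg y / (y * √(1 - y ^ 2))) * (1 + cos (ψ t (y * t)))
    - 2 * omg y * (sin (ψ t (y * t)) * (pR ψ t (y * t) * t)))

open DegOneWave in
theorem omg_radDen_le {ψ : ℝ → ℝ → ℝ} {t y c ν : ℝ} (ht : 0 < t) (hy : 0 < y) (hyc : y ≤ c)
    (hc : c < 1) (hν : 0 < ν) :
    omg y * √(1 - y ^ 2) * radDen ψ t y ≤
      coneD (fun _ => 0) (fun y => omg y - omg c) (fun y => 4 * omg y / (y * √(1 - y ^ 2))) ψ t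
        (y * t) + bdryDen ψ t y + (ν * eDen ψ t (y * t) + 1 / (4 * ν) * selfSim ψ t y) := by
  have hp : 0 < 1 - y ^ 2 := by nlinarith
  have hS : 0 < √(1 - y ^ 2) := sqrt_pos.2 hp
  have hSS : √(1 - y ^ 2) ^ 2 = 1 - y ^ 2 := sq_sqrt hp.le
  have hw0 := omg_nonneg y
  have hw1 := omg_le_one hy.le (hyc.trans hc.le)
  have hc0 := omg_nonneg c
  have hc1 := omg_le_one (hy.le.trans hyc) hc.le
  have hyr : y * t / t = y := mul_div_cancel_right₀ _ ht.ne'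
  have hcs := sin_sq_add_cos_sq (ψ t (y * t))
  have hcm := neg_one_le_cos (ψ t (y * t))
  have hr : 0 < y * t := mul_pos hy ht
  have hpt := pT_sq_le ψ t hr.le
  have hpt2 := mul_le_mul_of_nonneg_left hpt hν.le
  simp only [radDen, coneD, bdryDen, selfSim, hyr, mom, pres]
  set w := omg y
  set w1 := omg c
  set S := √(1 - y ^ 2)
  set a := pT ψ t (y * t)
  set b := pR ψ t (y * t)
  set s := sin (ψ t (y * t))
  set C := cos (ψ t (y * t))
  set e := eDen ψ t (y * t)
  have hcross : -((w - w1) * (y * t) * a * (a + y * b)) ≤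
      ν * (a ^ 2 * (y * t)) + 1 / (4 * ν) * (y * t * (a + y * b) ^ 2) := by
    have h1 : |w - w1| ≤ 1 := by rw [abs_le]; constructor <;> linarith
    have h2 : -((w - w1) * (a * (a + y * b))) ≤ |a * (a + y * b)| := by
      refine (neg_le_abs _).trans ?_
      rw [abs_mul]
      exact mul_le_of_le_one_left (abs_nonneg _) h1
    have h3 : |a * (a + y * b)| ≤ ν * a ^ 2 + 1 / (4 * ν) * (a + y * b) ^ 2 := by
      have h4 : ∀ u v : ℝ, u * v ≤ ν * u ^ 2 + 1 / (4 * ν) * v ^ 2 := fun u v => by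
        have : ν * u ^ 2 + 1 / (4 * ν) * v ^ 2 - u * v = (2 * ν * u - v) ^ 2 / (4 * ν) := by
          field_simp; ring
        have h5 : 0 ≤ (2 * ν * u - v) ^ 2 / (4 * ν) := by positivity
        linarith
      rw [abs_le]
      constructor
      · have := h4 (-a) (a + y * b); nlinarith
      · exact h4 _ _
    have h5 := mul_le_mul_of_nonneg_left (h2.trans h3) hr.le
    nlinarith
  have hpos : 0 ≤ 2 * w / (y * S * t) * (1 / 2 * (y * S * t * b - s) ^ 2
      + (1 + C) * (4 - 3 / 2 * (1 - C))) := by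
    have h1 : 0 ≤ (1 + C) * (4 - 3 / 2 * (1 - C)) := mul_nonneg (by linarith) (by linarith)
    positivity
  have hpos2 : 0 ≤ 4 * w / (y * S) / (2 * t) * ((y * t) ^ 2 * (a + y * b) ^ 2) := by positivity
  have hs2 : s ^ 2 = 1 - C ^ 2 := by linarith
  have e1 : 0 * (y * (e / 2) + y * t * a * b) + (w - w1 + y * (4 * w / (y * S))) * y * (y * t * a * b) +
      4 * w / (y * S) * (((y * t) ^ 2 * (a ^ 2 + b ^ 2) - s ^ 2) / 2 / t) +
      (w - w1) * (y * t * a ^ 2) + 1 / t * (2 * (4 * w / (y * S)) * (1 + C) -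
      2 * w * (s * (b * t))) - w * S * (y * t * b ^ 2) =
      2 * w / (y * S * t) * (1 / 2 * (y * S * t * b - s) ^ 2 + (1 + C) * (4 - 3 / 2 * (1 - C)))
      + 4 * w / (y * S) / (2 * t) * ((y * t) ^ 2 * (a + y * b) ^ 2)
      + (w - w1) * (y * t) * a * (a + y * b) := by
    have hy2 : (y * t) ^ 2 * (a ^ 2 + b ^ 2) = (y * t) ^ 2 * (a ^ 2 + 2 * y * a * b + y ^ 2 * b ^ 2
      + S ^ 2 * b ^ 2) - 2 * (y * t) ^ 2 * y * a * b := by rw [hSS]; ring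
    rw [hy2, hs2]
    field_simp
    have : s ^ 2 = 1 - C ^ 2 := hs2
    linear_combination (-2 * w) * this
  linarith

namespace DegOneWave

variable {ψ : ℝ → ℝ → ℝ}

theorem continuousOn_radDen (h : DegOneWave ψ) {T T' y0 y1 : ℝ} (hT : 0 < T) (hy0 : 0 < y0) :
    ContinuousOn (fun p : ℝ × ℝ => radDen ψ p.1 p.2) (Icc T T' ×ˢ Icc y0 y1) := by
  have h1 := continuousOn_cone h.continuousOn_pR hT hy0 (T' := T') (y1 := y1)
  unfold radDen; fun_prop

theorem continuousOn_kinDen (h : DegOneWave ψ) {T T' y0 y1 : ℝ} (hT : 0 < T) (hy0 : 0 < y0) :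
    ContinuousOn (fun p : ℝ × ℝ => kinDen ψ p.1 p.2) (Icc T T' ×ˢ Icc y0 y1) := by
  have h1 := continuousOn_cone h.continuousOn_pT hT hy0 (T' := T') (y1 := y1)
  unfold kinDen; fun_prop

theorem continuousOn_omg {y0 y1 : ℝ} (hy0 : 0 < y0) (hy1 : y1 < 1) :
    ContinuousOn omg (Icc y0 y1) := fun _ hy =>
  (hasDerivAt_omg (hy0.trans_le hy.1) (hy.2.trans_lt hy1)).continuousAt.continuousWithinAt

theorem continuousOn_omg_deriv {y0 y1 : ℝ} (hy0 : 0 < y0) (hy1 : y1 < 1) :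
    ContinuousOn (fun y => 4 * omg y / (y * √(1 - y ^ 2))) (Icc y0 y1) := by
  have h1 := continuousOn_omg hy0 hy1
  refine ContinuousOn.div (by fun_prop) (by fun_prop) fun y hy => ?_
  have hy' := hy0.trans_le hy.1
  have hy1' := hy.2.trans_lt hy1
  have : 0 < √(1 - y ^ 2) := sqrt_pos.2 (by nlinarith)
  positivity

theorem continuousOn_bdryDen (h : DegOneWave ψ) {T T' y0 y1 : ℝ} (hT : 0 < T) (hy0 : 0 < y0)
    (hy1 : y1 < 1) :
    ContinuousOn (fun p : ℝ × ℝ => bdryDen ψ p.1 p.2) (Icc T T' ×ˢ Icc y0 y1) := by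
  have h1 := continuousOn_cone h.continuousOn_pR hT hy0 (T' := T') (y1 := y1)
  have h2 := continuousOn_cone h.continuousOn hT hy0 (T' := T') (y1 := y1)
  have hsnd : ContinuousOn (Prod.snd : ℝ × ℝ → ℝ) (Icc T T' ×ˢ Icc y0 y1) := continuousOn_snd
  have h3 := (continuousOn_omg hy0 hy1).comp hsnd fun p hp => hp.2
  have h4 := (continuousOn_omg_deriv hy0 hy1).comp hsnd fun p hp => hp.2
  have pos : ∀ p ∈ Icc T T' ×ˢ Icc y0 y1, p.1 ≠ 0 := fun p hp => (hT.trans_le hp.1.1).ne'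
  have gen : ∀ {a b x y : ℝ × ℝ → ℝ} {s : Set (ℝ × ℝ)}, ContinuousOn a s → ContinuousOn b s →
      ContinuousOn x s → ContinuousOn y s → (∀ p ∈ s, p.1 ≠ 0) →
      ContinuousOn (fun p => 1 / p.1 * (2 * a p * (1 + cos (x p))
        - 2 * b p * (sin (x p) * (y p * p.1)))) s := by
    intros; fun_prop (disch := assumption)
  exact gen h4 h3 h2 h1 pos

theorem integral_bdryDen_le (h : DegOneWave ψ) {t y0 c : ℝ} (ht : 0 < t) (hy0 : 0 < y0)
    (hy : y0 ≤ c) (hc : c < 1) :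
    ∫ y in y0..c, bdryDen ψ t y ≤ 2 * (1 + cos (ψ t (c * t))) / t := by
  have hcont := h.continuousOn_bdryDen ht hy0 hc (T' := t)
  have hi := intervalIntegrable_slice_of_continuousOn (f := bdryDen ψ) hy hcont
    (t := t) ⟨le_rfl, le_rfl⟩
  have hd : ∀ y ∈ uIcc y0 c, HasDerivAt
      (fun y => 1 / t * (2 * omg y * (1 + cos (ψ t (y * t))))) (bdryDen ψ t y) y := fun y hy' => by
    rw [uIcc_of_le hy] at hy'
    have hyp := hy0.trans_le hy'.1
    have h1 := hasDerivAt_omg hyp (hy'.2.trans_lt hc)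
    have h2 := (h.hasDerivAt_r ht (mul_pos hyp ht)).comp y (h₂ := ψ t)
      (by simpa using (hasDerivAt_id y).mul_const t)
    have h3 := ((h1.const_mul 2).mul (h2.cos.const_add 1)).const_mul (1 / t)
    refine h3.congr_deriv ?_
    simp only [bdryDen, Function.comp]
    ring
  rw [intervalIntegral.integral_eq_sub_of_hasDerivAt hd hi]
  have h1 : 0 ≤ 1 / t * (2 * omg y0 * (1 + cos (ψ t (y0 * t)))) := by
    have := omg_nonneg y0
    have : 0 ≤ 1 + cos (ψ t (y0 * t)) := by linarith [neg_one_le_cos (ψ t (y0 * t))]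
    positivity
  have h2 : 1 / t * (2 * omg c * (1 + cos (ψ t (c * t)))) ≤ 2 * (1 + cos (ψ t (c * t))) / t := by
    have h3 : 0 ≤ 1 + cos (ψ t (c * t)) := by linarith [neg_one_le_cos (ψ t (c * t))]
    have h4 := omg_le_one (hy0.le.trans hy) hc.le
    have h5 := mul_le_mul_of_nonneg_right h4 h3
    rw [div_mul_eq_mul_div, one_mul]
    gcongr
    linarith
  linarith

/-- Averaged control of the radial derivative inside the cone. -/
theorem exists_integral_radDen_le (h : DegOneWave ψ) {c ε : ℝ} (hc : 1 / 2 < c) (hc1 : c < 1)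
    (hε : 0 < ε) :
    ∃ T0 ≥ 1, ∃ C, ∀ T ≥ T0, ∀ T' ≥ T, ∀ y0, 0 < y0 → y0 < c →
      ∫ t in T..T', ∫ y in y0..c, omg y * √(1 - y ^ 2) * radDen ψ t y ≤
        C + (ε + 100 * (1 - c)) * log (T' / T) := by
  obtain ⟨T1, hT1, H1⟩ := h.exists_near_cone hc hc1
  obtain ⟨T2, hT2, C2, H2⟩ := h.exists_integral_selfSim_le (ε := ε ^ 2 / 27) (by positivity)
  refine ⟨max T1 T2, le_max_of_le_left hT1, 12 + 9 / ε * C2, fun T hT T' hTT y0 hy0 hyc => ?_⟩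
  have hTT1 : T1 ≤ T := (le_max_left _ _).trans hT
  have hTT2 : T2 ≤ T := (le_max_right _ _).trans hT
  have hT0 : 0 < T := by linarith
  obtain ⟨z, hz, hzy, hin⟩ := h.exists_inner_ray (ε := ε / 3) hT0 hTT hy0 (by positivity)
  have hzc : z ≤ c := by linarith
  have hΘ : ∀ y ∈ Icc z c, |omg y - omg c| ≤ 1 := fun y hy => by
    have h1 := omg_nonneg y
    have h2 := omg_nonneg c
    have h3 := omg_le_one (hz.le.trans hy.1) (hy.2.trans hc1.le)
    have h4 := omg_le_one (by linarith) hc1.le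
    rw [abs_le]; constructor <;> linarith
  have hω' := continuousOn_omg_deriv hz hc1
  have key := (abs_le.1 (h.abs_double_integral_coneD_le hT0 hTT hz hzc (w := fun _ => 0)
    (w' := fun _ => 0) (M := 1) (fun y _ => hasDerivAt_const y 0)
    (fun y hy => (hasDerivAt_omg (hz.trans_le hy.1) (hy.2.trans_lt hc1)).sub_const (omg c))
    continuousOn_const hω' fun y hy => by
      have h1 := hΘ y hy
      have h2 := hz.trans_le hy.1
      have h3 := hy.2
      have h4 := abs_nonneg (omg y - omg c)
      simp only [abs_zero, zero_add]
      nlinarith)).2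
  have cD := h.continuousOn_coneD hT0 hz (T' := T') (y1 := c) (w' := fun _ => 0)
    (Θ := fun y => omg y - omg c) continuousOn_const ((continuousOn_omg hz hc1).sub
      continuousOn_const) hω'
  have cB := h.continuousOn_bdryDen hT0 hz hc1 (T' := T')
  have cE := continuousOn_cone h.continuousOn_eDen hT0 hz (T' := T') (y1 := c)
  have cS := continuousOn_selfSim h hT0 hz (T' := T') (y1 := c)
  have cR : ∀ {z}, 0 < z → ContinuousOn (fun p : ℝ × ℝ => omg p.2 * √(1 - p.2 ^ 2) * radDen ψ p.1 p.2)
      (Icc T T' ×ˢ Icc z c) := fun hz => by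
    have hsnd : ∀ {z}, ContinuousOn (Prod.snd : ℝ × ℝ → ℝ) (Icc T T' ×ˢ Icc z c) := continuousOn_snd
    have h3 := (continuousOn_omg hz hc1).comp hsnd fun p hp => hp.2
    have h4 := h.continuousOn_radDen hT0 hz (T' := T') (y1 := c)
    have gen : ∀ {a b : ℝ × ℝ → ℝ} {s : Set (ℝ × ℝ)}, ContinuousOn a s → ContinuousOn b s →
      ContinuousOn (fun p => a p * √(1 - p.2 ^ 2) * b p) s := by intros; fun_prop
    exact gen h3 h4
  set ν := ε / 36 with hν
  have hν0 : 0 < ν := by positivity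
  have hmono := double_integral_mono hTT hzc (f := fun t y => omg y * √(1 - y ^ 2) * radDen ψ t y)
    (g := fun t y => 1 * (1 * coneD (fun _ => 0) (fun y => omg y - omg c)
      (fun y => 4 * omg y / (y * √(1 - y ^ 2))) ψ t (y * t) + 1 * bdryDen ψ t y)
      + 1 * (ν * eDen ψ t (y * t) + 1 / (4 * ν) * selfSim ψ t y)) (cR hz)
    (((cD.const_mul _).add (cB.const_mul _)).const_mul _ |>.add
      (((cE.const_mul _).add (cS.const_mul _)).const_mul _))
    fun t ht y hy => by
      have := omg_radDen_le (ψ := ψ) (hT0.trans_le ht.1) (hz.trans_le hy.1) hy.2 hc1 hν0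
      linarith
  rw [double_integral_linear (f := fun t y => 1 * coneD (fun _ => 0) (fun y => omg y - omg c)
      (fun y => 4 * omg y / (y * √(1 - y ^ 2))) ψ t (y * t) + 1 * bdryDen ψ t y)
      (g := fun t y => ν * eDen ψ t (y * t) + 1 / (4 * ν) * selfSim ψ t y) hTT hzc 1 1
      ((cD.const_mul _).add (cB.const_mul _)) ((cE.const_mul _).add (cS.const_mul _)),
    double_integral_linear (g := bdryDen ψ) hTT hzc 1 1 cD cB,
    double_integral_linear (g := selfSim ψ) hTT hzc ν (1 / (4 * ν)) cE cS] at hmono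
  have hE := h.double_integral_eDen_le hT0 hTT hz hzc (ε := 12) fun t ht =>
    (h.locE_lt (hT0.trans_le ht.1) (mul_pos hz (hT0.trans_le ht.1)).le).le
  have hS1 := double_integral_mono_interval (f := selfSim ψ) hTT hzc le_rfl hc1.le
    (continuousOn_selfSim h hT0 hz) fun t ht y hy =>
      mul_nonneg (mul_pos (hz.trans_le hy.1) (hT0.trans_le ht.1)).le (sq_nonneg _)
  have hS2 := H2 T hTT2 T' hTT z hz (by linarith)
  have hB : ∫ t in T..T', ∫ y in z..c, bdryDen ψ t y ≤ 100 * (1 - c) * log (T' / T) := by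
    rw [← integral_const_div hT0 hTT]
    refine intervalIntegral.integral_mono_on hTT
      ((continuousOn_inner_integral hTT hzc cB).intervalIntegrable_of_Icc hTT)
      (intervalIntegrable_const_div hT0 hTT _) fun t ht => ?_
    have ht0 := hT0.trans_le ht.1
    refine (h.integral_bdryDen_le ht0 hz hzc hc1).trans ?_
    exact div_le_div_of_nonneg_right (H1 t (hTT1.trans ht.1)) ht0.le
  have hL := double_integral_mono_interval (f := fun t y => omg y * √(1 - y ^ 2) * radDen ψ t y)
    hTT hyc.le hzy le_rfl (cR hz) fun t ht y hy => by
      have := omg_nonneg y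
      have h1 := hz.trans_le hy.1
      have h2 := hT0.trans_le ht.1
      unfold radDen; positivity
  have e1 : 0 ≤ ∫ t in T..T', eDen ψ t (z * t) := intervalIntegral.integral_nonneg hTT
    fun t ht => eDen_nonneg ψ t (mul_pos hz (hT0.trans_le ht.1)).le
  have hin2 : (1 + z) / 2 * (z * |omg z - omg c|) * (∫ t in T..T', eDen ψ t (z * t)) ≤
      ε / 3 * log (T' / T) := by
    refine le_trans ?_ hin
    refine mul_le_mul_of_nonneg_right ?_ e1
    have h1 := hΘ z ⟨le_rfl, hzc⟩
    have h4 := abs_nonneg (omg z - omg c)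
    have h5 : (1 + z) / 2 ≤ 1 := by linarith
    have h6 : z * |omg z - omg c| ≤ z := by nlinarith
    have h7 : 0 ≤ z * |omg z - omg c| := by positivity
    nlinarith
  simp only [sub_self, abs_zero, mul_zero, zero_mul, zero_add, add_zero, mul_one] at key
  have h9 : 1 / (4 * ν) = 9 / ε := by rw [hν]; field_simp; norm_num
  rw [h9] at hmono
  have hS3 := mul_le_mul_of_nonneg_left (hS1.trans hS2) (by positivity : 0 ≤ 9 / ε)
  have hE3 := mul_le_mul_of_nonneg_left hE hν0.le
  have e3 : 9 / ε * (C2 + ε ^ 2 / 27 * log (T' / T)) = 9 / ε * C2 + ε / 3 * log (T' / T) := by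
    field_simp; ring
  have e4 : ν * (12 * log (T' / T)) = ε / 3 * log (T' / T) := by rw [hν]; ring
  linarith

end DegOneWave

/-- The defect at time `t` whose logarithmic average vanishes. -/
def defect (ψ : ℝ → ℝ → ℝ) (η c y0 t : ℝ) : ℝ :=
  (∫ r in y0 * t..c * t, pT ψ t r ^ 2 * r) + ∫ r in η * t..c * t, pR ψ t r ^ 2 * r

theorem kinDen_le {ψ : ℝ → ℝ → ℝ} {t y η : ℝ} (ht : 0 < t) (hy : 0 < y) (hyη : y ≤ η) :
    kinDen ψ t y ≤ 2 * DegOneWave.selfSim ψ t y + 2 * η ^ 2 * eDen ψ t (y * t) := by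
  have hr := mul_pos hy ht
  have h1 := pR_sq_le ψ t hr.le
  have h2 : y ^ 2 * (pR ψ t (y * t) ^ 2 * (y * t)) ≤ η ^ 2 * eDen ψ t (y * t) :=
    mul_le_mul (pow_le_pow_left₀ hy.le hyη 2) h1 (by positivity) (by positivity)
  unfold kinDen DegOneWave.selfSim
  nlinarith [mul_nonneg hr.le (sq_nonneg (pT ψ t (y * t) + 2 * y * pR ψ t (y * t)))]

theorem kinDen_le' {ψ : ℝ → ℝ → ℝ} {t y : ℝ} (ht : 0 < t) (hy : 0 < y) (hy1 : y ≤ 1) :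
    kinDen ψ t y ≤ 2 * DegOneWave.selfSim ψ t y + 2 * radDen ψ t y := by
  have hr := mul_pos hy ht
  have h2 : y ^ 2 * (pR ψ t (y * t) ^ 2 * (y * t)) ≤ 1 * (pR ψ t (y * t) ^ 2 * (y * t)) :=
    mul_le_mul_of_nonneg_right (by nlinarith) (by positivity)
  unfold kinDen DegOneWave.selfSim radDen
  nlinarith [mul_nonneg hr.le (sq_nonneg (pT ψ t (y * t) + 2 * y * pR ψ t (y * t)))]

theorem radDen_le {ψ : ℝ → ℝ → ℝ} {t y η κ : ℝ} (ht : 0 < t) (hη : 0 < η) (hκ : 0 < κ)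
    (hyη : η ≤ y) (hyc : y ≤ 1 - κ ^ 2) :
    radDen ψ t y ≤ 16 / (η ^ 4 * κ) * (omg y * √(1 - y ^ 2) * radDen ψ t y) := by
  have hy : 0 < y := hη.trans_le hyη
  have h0 : 0 ≤ radDen ψ t y := by unfold radDen; positivity
  have h1 : (η / 2) ^ 4 ≤ omg y := le_trans (by gcongr) (pow_div_le_omg hy.le)
  have h2 : κ ≤ √(1 - y ^ 2) := le_sqrt_of_sq_le (by nlinarith)
  have h3 : (η / 2) ^ 4 * κ ≤ omg y * √(1 - y ^ 2) := by
    have := omg_nonneg y; gcongr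
  have h4 : 1 ≤ 16 / (η ^ 4 * κ) * (omg y * √(1 - y ^ 2)) := by
    have e : 1 = 16 / (η ^ 4 * κ) * ((η / 2) ^ 4 * κ) := by field_simp; norm_num
    calc 1 = 16 / (η ^ 4 * κ) * ((η / 2) ^ 4 * κ) := e
      _ ≤ _ := by gcongr
  calc radDen ψ t y = 1 * radDen ψ t y := (one_mul _).symm
    _ ≤ 16 / (η ^ 4 * κ) * (omg y * √(1 - y ^ 2)) * radDen ψ t y := by gcongr
    _ = _ := by ring

namespace DegOneWave

variable {ψ : ℝ → ℝ → ℝ}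

theorem defect_div_eq (ψ : ℝ → ℝ → ℝ) {η c y0 t : ℝ} (ht : 0 < t) :
    defect ψ η c y0 t / t = (∫ y in y0..c, kinDen ψ t y) + ∫ y in η..c, radDen ψ t y := by
  have gen : ∀ (f : ℝ → ℝ) (a b : ℝ), ∫ y in a..b, y * t * f (y * t) ^ 2 =
      (∫ r in a * t..b * t, f r ^ 2 * r) / t := fun f a b => by
    have := intervalIntegral.integral_comp_mul_right (fun r => f r ^ 2 * r) ht.ne' (a := a) (b := b)
    rw [smul_eq_mul] at this
    rw [div_eq_inv_mul, ← this]
    exact intervalIntegral.integral_congr fun y _ => by ring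
  unfold defect kinDen radDen
  rw [gen, gen]; ring

/-- Averaged decay of the kinetic energy in the cone and of the radial derivative away from
the centre. -/
theorem exists_integral_defect_le (h : DegOneWave ψ) {η ε : ℝ} (hη : 0 < η) (hη1 : η < 1 / 2)
    (hε : 0 < ε) :
    ∃ c, 1 / 2 < c ∧ 1 - ε < c ∧ c < 1 ∧ ∃ T0 ≥ 1, ∃ C,
      (∀ t ≥ T0, 2 * (1 + cos (ψ t (c * t))) ≤ 100 * (1 - c)) ∧
      ∀ T ≥ T0, ∀ T' ≥ T, ∀ y0, 0 < y0 → y0 < η →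
        ∫ t in T..T', defect ψ η c y0 t / t ≤ C + ε * log (T' / T) := by
  set η' := min η (min (ε / 100) (1 / 2)) with hη'
  have hη0 : 0 < η' := by positivity
  have hη'1 : η' ≤ η := min_le_left _ _
  have hη'2 : η' ≤ ε / 100 := (min_le_right _ _).trans (min_le_left _ _)
  have hη'3 : η' ≤ 1 / 2 := (min_le_right _ _).trans (min_le_right _ _)
  set κ := min (1 / 2) (min (ε / 2) (ε * η' ^ 4 / 19200)) with hκ
  have hκ0 : 0 < κ := by positivity
  have hκ1 : κ ≤ 1 / 2 := min_le_left _ _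
  have hκ2 : κ ≤ ε / 2 := (min_le_right _ _).trans (min_le_left _ _)
  have hκ3 : κ ≤ ε * η' ^ 4 / 19200 := (min_le_right _ _).trans (min_le_right _ _)
  set c := 1 - κ ^ 2 with hc
  have hκsq : κ ^ 2 ≤ κ * (1 / 2) := by nlinarith
  have hc1 : 1 / 2 < c := by rw [hc]; nlinarith
  have hc2 : c < 1 := by rw [hc]; nlinarith
  set K1 := 16 / (η' ^ 4 * κ) with hK1
  have hK0 : 0 < K1 := by positivity
  obtain ⟨T1, hT1, H1⟩ := h.exists_near_cone hc1 hc2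
  obtain ⟨T2, hT2, C2, H2⟩ := h.exists_integral_selfSim_le (ε := ε / 8) (by positivity)
  obtain ⟨T3, hT3, C3, H3⟩ := h.exists_integral_radDen_le (ε := ε / (12 * K1)) hc1 hc2
    (by positivity)
  refine ⟨c, hc1, by rw [hc]; linarith, hc2, max T1 (max T2 T3), le_max_of_le_left hT1,
    2 * C2 + 3 * K1 * C3, fun t ht => H1 t ((le_max_left _ _).trans ht),
    fun T hT T' hTT y0 hy0 hyη => ?_⟩
  have hT2' : T2 ≤ T := (le_max_left _ _).trans ((le_max_right _ _).trans hT)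
  have hT3' : T3 ≤ T := (le_max_right _ _).trans ((le_max_right _ _).trans hT)
  have hT0 : 0 < T := by linarith
  have hyc : y0 < c := by linarith
  have cS := continuousOn_selfSim h hT0 hy0 (T' := T') (y1 := c)
  have cE := continuousOn_cone h.continuousOn_eDen hT0 hy0 (T' := T') (y1 := c)
  have cK := h.continuousOn_kinDen hT0 hy0 (T' := T') (y1 := c)
  have cR := h.continuousOn_radDen hT0 hy0 (T' := T') (y1 := c)
  have cRη := h.continuousOn_radDen hT0 hη (T' := T') (y1 := c)
  have cW : ContinuousOn (fun p : ℝ × ℝ => omg p.2 * √(1 - p.2 ^ 2) * radDen ψ p.1 p.2)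
      (Icc T T' ×ˢ Icc y0 c) := by
    have hsnd : ContinuousOn (Prod.snd : ℝ × ℝ → ℝ) (Icc T T' ×ˢ Icc y0 c) := continuousOn_snd
    have h3 := (continuousOn_omg hy0 hc2).comp hsnd fun p hp => hp.2
    have gen : ∀ {a b : ℝ × ℝ → ℝ} {s : Set (ℝ × ℝ)}, ContinuousOn a s → ContinuousOn b s →
      ContinuousOn (fun p => a p * √(1 - p.2 ^ 2) * b p) s := by intros; fun_prop
    exact gen h3 cR
  have cW' := cW.mono (prod_mono (Subset.refl (Icc T T')) (Icc_subset_Icc_left hyη.le))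
  have hW0 : ∀ t ∈ Icc T T', ∀ y ∈ Icc y0 c, 0 ≤ omg y * √(1 - y ^ 2) * radDen ψ t y :=
    fun t ht y hy => by
      have := omg_nonneg y
      have h1 := hy0.trans_le hy.1
      have h2 := hT0.trans_le ht.1
      unfold radDen; positivity
  have hk := double_integral_mono (f := kinDen ψ) (g := fun t y =>
      1 * (2 * selfSim ψ t y + 2 * η' ^ 2 * eDen ψ t (y * t)) +
      2 * K1 * (omg y * √(1 - y ^ 2) * radDen ψ t y)) hTT hyc.le cK
    ((((cS.const_mul _).add (cE.const_mul _)).const_mul _).add (cW.const_mul _))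
    fun t ht y hy => by
      have h1 := hy0.trans_le hy.1
      have h2 := hT0.trans_le ht.1
      have h3 := hW0 t ht y hy
      have h5 := mul_nonneg hK0.le h3
      have h6 := eDen_nonneg ψ t (mul_pos h1 h2).le
      rcases le_total y η' with h4 | h4
      · have := kinDen_le (ψ := ψ) h2 h1 h4
        linarith
      · have h7 := kinDen_le' (ψ := ψ) h2 h1 (hy.2.trans hc2.le)
        have h8 := radDen_le (ψ := ψ) h2 hη0 hκ0 h4 hy.2
        have h9 := mul_nonneg (sq_nonneg η') h6
        linarith
  have hr := double_integral_mono (f := radDen ψ) (g := fun t y =>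
      K1 * (omg y * √(1 - y ^ 2) * radDen ψ t y)) hTT (hη1.trans hc1).le cRη (cW'.const_mul _)
    fun t ht y hy => radDen_le (hT0.trans_le ht.1) hη0 hκ0 (hη'1.trans hy.1) hy.2
  rw [double_integral_linear (f := fun t y => 2 * selfSim ψ t y + 2 * η' ^ 2 * eDen ψ t (y * t))
      (g := fun t y => omg y * √(1 - y ^ 2) * radDen ψ t y) hTT hyc.le 1 (2 * K1)
      ((cS.const_mul _).add (cE.const_mul _)) cW,
    double_integral_linear (f := selfSim ψ) (g := fun t y => eDen ψ t (y * t)) hTT hyc.le 2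
      (2 * η' ^ 2) cS cE] at hk
  simp only [intervalIntegral.integral_const_mul] at hr
  have hW := double_integral_mono_interval (f := fun t y => omg y * √(1 - y ^ 2) * radDen ψ t y)
    hTT (hη1.trans hc1).le hyη.le le_rfl cW hW0
  have hW3 := H3 T hT3' T' hTT y0 hy0 hyc
  have hE := h.double_integral_eDen_le hT0 hTT hy0 hyc.le (ε := 12) fun t ht =>
    (h.locE_lt (hT0.trans_le ht.1) (mul_pos hy0 (hT0.trans_le ht.1)).le).le
  have hS1 := double_integral_mono_interval (f := selfSim ψ) hTT hyc.le le_rfl hc2.le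
    (continuousOn_selfSim h hT0 hy0) fun t ht y hy =>
      mul_nonneg (mul_pos (hy0.trans_le hy.1) (hT0.trans_le ht.1)).le (sq_nonneg _)
  have hS2 := H2 T hT2' T' hTT y0 hy0 (by linarith)
  have hL : 0 ≤ log (T' / T) := log_nonneg ((one_le_div hT0).2 hTT)
  have e1 : ∫ t in T..T', defect ψ η c y0 t / t =
      (∫ t in T..T', ∫ y in y0..c, kinDen ψ t y) + ∫ t in T..T', ∫ y in η..c, radDen ψ t y := by
    rw [← intervalIntegral.integral_add
      ((continuousOn_inner_integral hTT hyc.le cK).intervalIntegrable_of_Icc hTT)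
      ((continuousOn_inner_integral hTT (hη1.trans hc1).le cRη).intervalIntegrable_of_Icc hTT)]
    refine intervalIntegral.integral_congr fun t ht => ?_
    rw [uIcc_of_le hTT] at ht
    exact defect_div_eq ψ (hT0.trans_le ht.1)
  rw [e1]
  have hW4 := mul_le_mul_of_nonneg_left hW3 hK0.le
  have hW5 := mul_le_mul_of_nonneg_left hW hK0.le
  have hE4 := mul_le_mul_of_nonneg_left hE (by positivity : 0 ≤ 2 * η' ^ 2)
  have e2 : K1 * (C3 + (ε / (12 * K1) + 100 * (1 - c)) * log (T' / T)) =
      K1 * C3 + ε / 12 * log (T' / T) + (K1 * (100 * κ ^ 2)) * log (T' / T) := by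
    rw [hc]; field_simp; ring
  have e3 : K1 * (100 * κ ^ 2) ≤ ε / 12 := by
    have : K1 * (100 * κ ^ 2) = 1600 / η' ^ 4 * κ := by rw [hK1]; field_simp; norm_num
    rw [this]
    calc _ ≤ 1600 / η' ^ 4 * (ε * η' ^ 4 / 19200) := by gcongr
      _ = _ := by field_simp; norm_num
  have e4 : 2 * η' ^ 2 * 12 ≤ ε / 4 := by nlinarith
  have e5 := mul_le_mul_of_nonneg_right e3 hL
  have e6 := mul_le_mul_of_nonneg_right e4 hL
  linarith

end DegOneWave

theorem exists_le_of_integral_le {f : ℝ → ℝ} {a b m : ℝ} (hab : a < b)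
    (hf : ContinuousOn f (Icc a b)) (hI : ∫ x in a..b, f x ≤ m * (b - a)) :
    ∃ x ∈ Icc a b, f x ≤ m := by
  obtain ⟨x, hx, hmin⟩ := isCompact_Icc.exists_isMinOn (nonempty_Icc.2 hab.le) hf
  refine ⟨x, hx, ?_⟩
  have h1 : ∫ _ in a..b, f x ≤ ∫ y in a..b, f y :=
    intervalIntegral.integral_mono_on hab.le (by simp) (hf.intervalIntegrable_of_Icc hab.le)
      fun y hy => hmin hy
  rw [intervalIntegral.integral_const, smul_eq_mul, mul_comm] at h1
  exact le_of_mul_le_mul_right (h1.trans hI) (sub_pos.2 hab)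

/-- If the logarithmic average of `K` is small, then so is its average over one of the windows
`[t, t + ℓ t]`. -/
theorem exists_window {K l : ℝ → ℝ} {T T' δ : ℝ} (hT : 0 < T) (hTT : T ≤ T') (hδ : 0 < δ)
    (hK : ContinuousOn K (Icc T (2 * T'))) (hK0 : ∀ t ∈ Icc T (2 * T'), 0 ≤ K t)
    (hl : ∀ t ∈ Icc T T', 0 < l t ∧ l t ≤ t)
    (hI : ∫ t in T..2 * T', K t / t < δ / 2 * log (T' / T)) :
    ∃ t ∈ Icc T T', ∫ s in t..t + l t, K s ≤ δ * l t := by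
  by_contra! hcon
  have hT2 : T ≤ 2 * T' := by linarith
  have hKd : ContinuousOn (fun t => K t / t) (Icc T (2 * T')) :=
    hK.div continuousOn_id fun t ht => (hT.trans_le ht.1).ne'
  have hint : ∀ a ∈ Icc T (2 * T'), ∀ b ∈ Icc T (2 * T'), a ≤ b →
      IntervalIntegrable (fun t => K t / t) volume a b := fun a ha b hb hab =>
    (hKd.mono (Icc_subset_Icc ha.1 hb.2)).intervalIntegrable_of_Icc hab
  set G : ℝ → ℝ := fun s => (∫ t in T..s, K t / t) - δ / 2 * log (s / T) with hG
  have hGc : ContinuousOn G (Icc T T') := by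
    have h1 : ContinuousOn (fun s => ∫ t in T..s, K t / t) (Icc T T') := by
      have h2 : IntegrableOn (fun t => K t / t) (uIcc T T') := by
        rw [uIcc_of_le hTT]
        exact (hKd.mono (Icc_subset_Icc le_rfl (by linarith))).integrableOn_Icc
      have := intervalIntegral.continuousOn_primitive_interval h2
      rwa [uIcc_of_le hTT] at this
    refine h1.sub (ContinuousOn.mul continuousOn_const (ContinuousOn.log (by fun_prop) ?_))
    intro t ht
    have := hT.trans_le ht.1
    positivity
  have hS : IsCompact {s ∈ Icc T T' | 0 ≤ G s} := by
    refine isCompact_Icc.of_isClosed_subset ?_ (sep_subset _ _)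
    exact hGc.preimage_isClosed_of_isClosed isClosed_Icc isClosed_Ici
  have hSn : {s ∈ Icc T T' | 0 ≤ G s}.Nonempty :=
    ⟨T, ⟨le_rfl, hTT⟩, by simp [hG, div_self hT.ne']⟩
  obtain ⟨t, ⟨ht, hGt⟩, hmax⟩ := hS.exists_isGreatest hSn
  have ht0 : 0 < t := hT.trans_le ht.1
  obtain ⟨hl0, hl1⟩ := hl t ht
  have hs1 : t + l t ∈ Icc T (2 * T') := ⟨by linarith [ht.1], by linarith [ht.2]⟩
  have htm : t ∈ Icc T (2 * T') := ⟨ht.1, by linarith [ht.2]⟩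
  have hTm : T ∈ Icc T (2 * T') := ⟨le_rfl, hT2⟩
  have hstep : δ / 2 * log ((t + l t) / t) ≤ ∫ s in t..t + l t, K s / s := by
    have h1 : log ((t + l t) / t) ≤ l t / t := by
      have := log_le_sub_one_of_pos (x := (t + l t) / t) (by positivity)
      have e : (t + l t) / t - 1 = l t / t := by field_simp; ring
      linarith
    have h2 : (∫ s in t..t + l t, K s) / (2 * t) ≤ ∫ s in t..t + l t, K s / s := by
      rw [← intervalIntegral.integral_div]
      refine intervalIntegral.integral_mono_on (by linarith)
        (((hK.mono (Icc_subset_Icc htm.1 hs1.2)).intervalIntegrable_of_Icc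
          (by linarith)).div_const _) (hint _ htm _ hs1 (by linarith)) fun s hs => ?_
      have := ht0.trans_le hs.1
      exact div_le_div_of_nonneg_left (hK0 s ⟨htm.1.trans hs.1, hs.2.trans hs1.2⟩) this
        (by linarith [hs.2])
    have h3 : δ * l t / (2 * t) ≤ (∫ s in t..t + l t, K s) / (2 * t) :=
      div_le_div_of_nonneg_right (hcon t ht).le (by positivity)
    calc δ / 2 * log ((t + l t) / t) ≤ δ / 2 * (l t / t) := by gcongr
      _ = δ * l t / (2 * t) := by field_simp
      _ ≤ _ := h3.trans h2
  have hG1 : 0 ≤ G (t + l t) := by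
    have e1 := intervalIntegral.integral_add_adjacent_intervals (hint T hTm t htm ht.1)
      (hint t htm _ hs1 (by linarith))
    have e2 : log ((t + l t) / T) = log ((t + l t) / t) + log (t / T) := by
      rw [← log_mul (by positivity) (by positivity)]; congr 1; field_simp
    simp only [hG] at hGt ⊢
    rw [← e1, e2]
    linarith
  have hgt : T' < t + l t := by
    by_contra! hle
    have := hmax ⟨⟨hs1.1, hle⟩, hG1⟩
    linarith
  have e1 := intervalIntegral.integral_add_adjacent_intervals (hint T hTm _ hs1 hs1.1)
    (hint _ hs1 (2 * T') ⟨hT2, le_rfl⟩ hs1.2)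
  have e2 : 0 ≤ ∫ s in t + l t..2 * T', K s / s :=
    intervalIntegral.integral_nonneg hs1.2 fun s hs =>
      div_nonneg (hK0 s ⟨hs1.1.trans hs.1, hs.2⟩) (by linarith [hs.1])
  have e3 : log (T' / T) ≤ log ((t + l t) / T) :=
    log_le_log (div_pos (by linarith) hT) (by gcongr)
  have e4 := mul_le_mul_of_nonneg_left e3 (by positivity : 0 ≤ δ / 2)
  simp only [hG] at hG1
  linarith

namespace DegOneWave

variable {ψ : ℝ → ℝ → ℝ}

theorem continuousOn_defect (h : DegOneWave ψ) {T T' y0 η c : ℝ} (hT : 0 < T) (hTT : T ≤ T')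
    (hy0 : 0 < y0) (hy0c : y0 ≤ c) (hη : 0 < η) (hηc : η ≤ c) :
    ContinuousOn (defect ψ η c y0) (Icc T T') := by
  have h1 := continuousOn_inner_integral hTT hy0c (h.continuousOn_kinDen hT hy0 (T' := T'))
  have h2 := continuousOn_inner_integral hTT hηc (h.continuousOn_radDen hT hη (T' := T'))
  refine ((h1.add h2).mul continuousOn_id).congr fun t ht => ?_
  have ht0 := hT.trans_le ht.1
  have := defect_div_eq ψ (η := η) (c := c) (y0 := y0) ht0
  simp only [Pi.mul_apply, Pi.add_apply, id]
  rw [← this]; field_simp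

theorem defect_nonneg (ψ : ℝ → ℝ → ℝ) {y0 η c t : ℝ} (ht : 0 < t) (hy0 : 0 < y0) (hy0c : y0 ≤ c)
    (hη : 0 < η) (hηc : η ≤ c) : 0 ≤ defect ψ η c y0 t := by
  refine add_nonneg (intervalIntegral.integral_nonneg (by gcongr) fun r hr => ?_)
    (intervalIntegral.integral_nonneg (by gcongr) fun r hr => ?_)
  · have := (mul_pos hy0 ht).trans_le hr.1; positivity
  · have := (mul_pos hη ht).trans_le hr.1; positivity

theorem exists_scale (h : DegOneWave ψ) {t b : ℝ} (ht : 0 < t) (hb : 0 < b) :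
    ∃ l, 0 < l ∧ l ≤ b ∧ locE ψ t 0 l ≤ 1 ∧ (locE ψ t 0 l = 1 ∨ l = b) := by
  rcases le_total (locE ψ t 0 b) 1 with hle | hle
  · exact ⟨b, hb, le_rfl, hle, Or.inr rfl⟩
  · have h0 : locE ψ t 0 0 = 0 := by simp [locE]
    obtain ⟨l, hl, hl1⟩ := intermediate_value_Icc hb.le (h.continuousOn_locE ht hb.le)
      (show (1 : ℝ) ∈ Icc _ _ from ⟨by simp only [h0]; norm_num, hle⟩)
    have hl1' : locE ψ t 0 l = 1 := hl1
    refine ⟨l, hl.1.lt_of_ne ?_, hl.2, hl1'.le, Or.inl hl1'⟩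
    rintro rfl
    linarith

theorem locE_window (h : DegOneWave ψ) {t l s : ℝ} (ht : 0 < t) (hl : 0 < l)
    (hE : locE ψ t 0 l ≤ 1) (hs : s ∈ Icc t (t + l / 2)) : locE ψ s 0 (l / 2) ≤ 1 := by
  have h1 := h.locE_forward (t1 := t) (t2 := s) (a := l) ht hs.1 (by linarith [hs.2])
  have h2 := h.locE_mono_right (t := s) (a := 0) (b := l / 2) (c := l - (s - t))
    (ht.trans_le hs.1) le_rfl (by positivity) (by linarith [hs.2])
  linarith

/-- The map cannot move from near `0` to near `π` over a bounded range of scales with little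
radial energy. -/
theorem integral_pR_sq_gt (h : DegOneWave ψ) {s a b η : ℝ} (hs : 0 < s) (ha : 0 < a) (hab : a ≤ b)
    (hη : 0 < η) (hba : b / a ≤ 1 / η) (hcosa : 1 - cos (ψ s a) ≤ 1 / 2)
    (hcosb : 2 * (1 + cos (ψ s b)) ≤ 1) : η / 4 < ∫ r in a..b, pR ψ s r ^ 2 * r := by
  by_contra! hrad
  have hosc := h.osc_sq_le hs ha hab
  have hlg : log (b / a) ≤ 1 / η := by
    have h9 := log_le_sub_one_of_pos (x := b / a) (div_pos (ha.trans_le hab) ha)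
    linarith
  have hlg0 : 0 ≤ log (b / a) := log_nonneg ((one_le_div ha).2 hab)
  have h10 : (∫ r in a..b, pR ψ s r ^ 2 * r) * log (b / a) ≤ 1 / 4 := by
    calc _ ≤ η / 4 * (1 / η) := mul_le_mul hrad hlg hlg0 (by positivity)
      _ = 1 / 4 := by field_simp
  have h11 := one_add_cos_le (ψ s a) (ψ s b)
  have h12 : (ψ s a - ψ s b) ^ 2 = (ψ s b - ψ s a) ^ 2 := by ring
  linarith

theorem integral_pR_sq_le_defect (h : DegOneWave ψ) {s a y0 η c : ℝ} (hs : 0 < s) (hy0 : 0 < y0)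
    (hy0c : y0 ≤ c) (hη : 0 < η) (hηa : η * s ≤ a) (hac : a ≤ c * s) :
    ∫ r in a..c * s, pR ψ s r ^ 2 * r ≤ defect ψ η c y0 s := by
  have hηs : 0 < η * s := by positivity
  have h5 : ∫ r in a..c * s, pR ψ s r ^ 2 * r ≤ ∫ r in η * s..c * s, pR ψ s r ^ 2 * r := by
    refine intervalIntegral.integral_mono_interval hηa hac le_rfl ?_ ?_
    · refine (ae_restrict_iff' measurableSet_Ioc).2 (Eventually.of_forall fun r hr => ?_)
      have : 0 < r := hηs.trans hr.1
      simp only [Pi.zero_apply]; positivity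
    · have h6 := (continuousOn_slice h.continuousOn_pR hs).mono
        (fun r hr => hηs.trans_le hr.1 : Icc (η * s) (c * s) ⊆ Ioi 0)
      exact ContinuousOn.intervalIntegrable_of_Icc (hηa.trans hac) (by fun_prop)
  have h7 : 0 ≤ ∫ r in y0 * s..c * s, pT ψ s r ^ 2 * r := by
    refine intervalIntegral.integral_nonneg
      (mul_le_mul_of_nonneg_right hy0c hs.le) fun r hr => ?_
    have := (mul_pos hy0 hs).trans_le hr.1
    positivity
  unfold defect
  linarith

/-- Selection of a scale and of a time window of comparable length with small defect. -/
theorem exists_good_window (h : DegOneWave ψ) {δ η κ T1 : ℝ} (hδ : 0 < δ) (hη : 0 < η)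
    (hη1 : η < 1 / 4) (hκ : 0 < κ) :
    ∃ c, 1 / 2 < c ∧ 1 - κ < c ∧ c < 1 ∧ ∃ t ≥ T1, 1 ≤ t ∧ ∃ l, 0 < l ∧ l ≤ 4 * η * t ∧
      locE ψ t 0 l = 1 ∧ ∃ y0, 0 < y0 ∧ y0 < η ∧
      (∀ s ∈ Icc t (t + l / 2), locE ψ s 0 (y0 * s) ≤ δ) ∧
      ∫ s in t..t + l / 2, defect ψ η c y0 s ≤ δ * (l / 2) := by
  have hηt : ∀ t : ℝ, 0 < t → 4 * η * t ≤ t := fun t ht => by nlinarith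
  set δ' := min δ (η / 4) with hδ'
  have hδ0 : 0 < δ' := by positivity
  have hδ1 : δ' ≤ δ := min_le_left _ _
  have hδ2 : δ' ≤ η / 4 := min_le_right _ _
  obtain ⟨c, hc, hcε, hc1, T0, hT0, C, hcone, H⟩ := h.exists_integral_defect_le hη
    (by linarith) (ε := min (δ' / 4) (min κ (1 / 100))) (by positivity)
  set ε := min (δ' / 4) (min κ (1 / 100))
  have hηc : η ≤ c := by linarith
  have hε0 : ε ≤ δ' / 4 := min_le_left _ _
  have hε1 : ε ≤ κ := (min_le_right _ _).trans (min_le_left _ _)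
  have hε2 : ε ≤ 1 / 100 := (min_le_right _ _).trans (min_le_right _ _)
  set T := max T0 T1 with hTdef
  have hT0' : T0 ≤ T := le_max_left _ _
  have hT1 : 1 ≤ T := by linarith
  have hTpos : 0 < T := by linarith
  set L := max (4 * C / δ' + 2) 1 with hL
  have hL1 : 1 ≤ L := le_max_right _ _
  have hL2 : 4 * C / δ' + 2 ≤ L := le_max_left _ _
  set T' := T * exp L with hT'
  have hTT : T ≤ T' := by
    have : 1 ≤ exp L := one_le_exp (by linarith)
    nlinarith
  have hlog : log (T' / T) = L := by
    rw [hT', mul_div_cancel_left₀ _ hTpos.ne', log_exp]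
  have hlog2 : log (2 * T' / T) ≤ L + 1 := by
    have : 2 * T' / T = 2 * (T' / T) := by ring
    rw [this, log_mul (by norm_num) (by positivity), hlog]
    linarith [log_two_lt_d9]
  have hlog2' : 0 ≤ log (2 * T' / T) := log_nonneg ((one_le_div hTpos).2 (by linarith))
  choose! l hl using fun t (ht : 0 < t) => h.exists_scale ht (b := 4 * η * t) (by positivity)
  obtain ⟨ρ, hρ, hρE⟩ := h.exists_radius_locE_le (T := T) (T' := 2 * T') hTpos hδ
  set y0 := min (η / 2) (ρ / (2 * T')) with hy0
  have hT'0 : 0 < T' := by positivity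
  have hy00 : 0 < y0 := by positivity
  have hy0η : y0 < η := by linarith [min_le_left (η / 2) (ρ / (2 * T'))]
  have hy0ρ : y0 * (2 * T') ≤ ρ := by
    rw [← le_div_iff₀ (by positivity)]; exact min_le_right _ _
  have hpre := H T hT0' (2 * T') (by linarith) y0 hy00 hy0η
  have hI : ∫ t in T..2 * T', defect ψ η c y0 t / t < δ' / 2 * log (T' / T) := by
    refine hpre.trans_lt ?_
    rw [hlog]
    have h1 : ε * log (2 * T' / T) ≤ δ' / 4 * (L + 1) := by
      have : 0 ≤ δ' / 4 := by positivity
      exact mul_le_mul hε0 hlog2 hlog2' this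
    have h2 : 4 * C / δ' * δ' = 4 * C := by field_simp
    nlinarith
  have hcd := h.continuousOn_defect (T := T) (T' := 2 * T') (y0 := y0) (η := η) (c := c) hTpos
    (by linarith) hy00 (by linarith) hη (by linarith)
  obtain ⟨t, ht, htI⟩ := exists_window (l := fun t => l t / 2) hTpos hTT hδ0 hcd
    (fun t ht => defect_nonneg ψ (hTpos.trans_le ht.1) hy00 (by linarith) hη (by linarith))
    (fun t ht => by
      have ht0 := hTpos.trans_le ht.1
      obtain ⟨h1, h2, -⟩ := hl t ht0
      exact ⟨half_pos h1, by linarith [hηt t ht0]⟩) hI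
  have ht0 := hTpos.trans_le ht.1
  obtain ⟨hl0, hlη, hlE, hor⟩ := hl t ht0
  have hlt : l t ≤ t := hlη.trans (hηt t ht0)
  have hsub : Icc t (t + l t / 2) ⊆ Icc T (2 * T') :=
    Icc_subset_Icc ht.1 (by linarith [ht.2])
  have htI' : ∫ s in t..t + l t / 2, defect ψ η c y0 s ≤ δ' * (l t / 2) := htI
  refine ⟨c, hc, by linarith, hc1, t, (le_max_right _ _).trans ht.1, hT1.trans ht.1, l t, hl0,
    hlη, ?_, y0, hy00, hy0η, fun s hs => ?_, htI'.trans (by gcongr)⟩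
  · rcases hor with h1 | h1
    · exact h1
    exfalso
    obtain ⟨s, hs, hsd⟩ := exists_le_of_integral_le (m := δ') (by linarith) (hcd.mono hsub)
      (by rwa [add_sub_cancel_left])
    have hs0 : 0 < s := ht0.trans_le hs.1
    have hs2 : s ≤ 2 * t := by linarith [hs.2]
    set a := l t / 2 with ha
    have ha0 : 0 < a := half_pos hl0
    have haη : a = 2 * η * t := by rw [ha, h1]; ring
    have hac : a ≤ c * s := by
      have h1 : 2 * η * t ≤ 1 / 2 * t := by gcongr; linarith
      have h2 : 1 / 2 * t ≤ c * s := mul_le_mul hc.le hs.1 ht0.le (by linarith)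
      rw [haη]; exact h1.trans h2
    have hcos := h.one_sub_cos_le hs0 ha0
    have hwin := h.locE_window ht0 hl0 hlE hs
    have hcone' := hcone s (by linarith [ht.1, hs.1])
    have hrad := (h.integral_pR_sq_le_defect hs0 hy00 (hy0η.le.trans hηc) hη
      (by rw [haη]; nlinarith [mul_le_mul_of_nonneg_left hs2 hη.le]) hac).trans (hsd.trans hδ2)
    refine (h.integral_pR_sq_gt hs0 ha0 hac hη ?_ (by linarith) (by linarith)).not_ge hrad
    rw [haη, div_le_div_iff₀ (by positivity) hη]
    have h2 : c * s ≤ 1 * (2 * t) := mul_le_mul hc1.le hs2 hs0.le one_pos.le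
    linarith [mul_le_mul_of_nonneg_right h2 hη.le]
  · have hs' := hsub hs
    have hs0 : 0 < s := ht0.trans_le hs.1
    refine (h.locE_mono_right hs0 le_rfl (mul_pos hy00 hs0).le ?_).trans (hρE s hs')
    exact (mul_le_mul_of_nonneg_left hs'.2 hy00.le).trans hy0ρ

end DegOneWave

/-- The defect `r ∂ᵣψ - sin ψ` from solving the Bogomolny equation. -/
def amp (ψ : ℝ → ℝ → ℝ) (t r : ℝ) : ℝ := r * pR ψ t r - sin (ψ t r)

/-- The divergence in the localized Morawetz identity for `amp`. -/
def morH (g g' β β' : ℝ → ℝ) (ψ : ℝ → ℝ → ℝ) (t r : ℝ) : ℝ :=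
  g t * β r * (-(cos (ψ t r) * amp ψ t r ^ 2 / r) + r * (1 + cos (ψ t r)) * pT ψ t r ^ 2)
    + g t * β' r * ((amp ψ t r ^ 2 + r ^ 2 * pT ψ t r ^ 2) / 2)
    - g' t * β r * (r * pT ψ t r * amp ψ t r)

theorem amp_sq_div_le (ψ : ℝ → ℝ → ℝ) (t : ℝ) {r : ℝ} (hr : 0 < r) :
    amp ψ t r ^ 2 / r ≤ 2 * eDen ψ t r := by
  have e : 2 * eDen ψ t r - amp ψ t r ^ 2 / r =
      2 * (r * pT ψ t r ^ 2) + (r * pR ψ t r + sin (ψ t r)) ^ 2 / r := by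
    rw [eDen_eq ψ t hr, amp]; field_simp; ring
  have : 0 ≤ 2 * (r * pT ψ t r ^ 2) + (r * pR ψ t r + sin (ψ t r)) ^ 2 / r := by positivity
  linarith

theorem amp_sq_add_le (ψ : ℝ → ℝ → ℝ) (t : ℝ) {r : ℝ} (hr : 0 < r) :
    (amp ψ t r ^ 2 + r ^ 2 * pT ψ t r ^ 2) / 2 ≤ r * eDen ψ t r := by
  have e : r * eDen ψ t r - (amp ψ t r ^ 2 + r ^ 2 * pT ψ t r ^ 2) / 2 =
      (r * pT ψ t r) ^ 2 / 2 + (r * pR ψ t r + sin (ψ t r)) ^ 2 / 2 := by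
    rw [eDen_eq ψ t hr, amp]; field_simp; ring
  have : 0 ≤ (r * pT ψ t r) ^ 2 / 2 + (r * pR ψ t r + sin (ψ t r)) ^ 2 / 2 := by positivity
  linarith

namespace DegOneWave

variable {ψ : ℝ → ℝ → ℝ}

theorem differentiableAt_amp (h : DegOneWave ψ) {t r : ℝ} (ht : 0 < t) (hr : 0 < r) :
    DifferentiableAt ℝ (fun p : ℝ × ℝ => amp ψ p.1 p.2) (t, r) := by
  have h1 := h.differentiableAt ht hr
  have h3 := h.differentiableAt_pR ht hr
  unfold amp
  fun_prop

theorem continuousOn_amp (h : DegOneWave ψ) :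
    ContinuousOn (fun p : ℝ × ℝ => amp ψ p.1 p.2) (Ioi 0 ×ˢ Ioi 0) := fun _ hp =>
  (h.differentiableAt_amp hp.1 hp.2).continuousAt.continuousWithinAt

theorem continuousOn_amp_sq_div (h : DegOneWave ψ) :
    ContinuousOn (fun p : ℝ × ℝ => amp ψ p.1 p.2 ^ 2 / p.2) (Ioi 0 ×ˢ Ioi 0) :=
  (h.continuousOn_amp.pow 2).div continuousOn_snd fun _ hp => ne_of_gt hp.2

theorem continuousOn_morH (h : DegOneWave ψ) {g g' β β' : ℝ → ℝ} (hg : Continuous g)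
    (hg' : Continuous g') (hβ : Continuous β) (hβ' : Continuous β') :
    ContinuousOn (fun p : ℝ × ℝ => morH g g' β β' ψ p.1 p.2) (Ioi 0 ×ˢ Ioi 0) := by
  have h1 := h.continuousOn
  have h2 := h.continuousOn_pT
  have h3 := h.continuousOn_amp
  have h4 : ∀ p ∈ (Ioi 0 ×ˢ Ioi 0 : Set (ℝ × ℝ)), p.2 ≠ 0 := fun p hp => ne_of_gt hp.2
  unfold morH
  fun_prop (disch := assumption)

theorem morawetz_pointwise (h : DegOneWave ψ) {g g' β β' : ℝ → ℝ} {t r : ℝ} (ht : 0 < t)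
    (hr : 0 < r) (hg : HasDerivAt g (g' t) t) (hβ : HasDerivAt β (β' r) r) :
    ∃ a b, HasDerivAt (fun s => -(g s * β r * (r * pT ψ s r * amp ψ s r))) a t ∧
      HasDerivAt (fun ρ => g t * β ρ * ((amp ψ t ρ ^ 2 + ρ ^ 2 * pT ψ t ρ ^ 2) / 2)) b r ∧
      a + b = morH g g' β β' ψ t r := by
  obtain ⟨tt, tr, rr, h1, h2, h3, h4, he⟩ := h.second_derivatives ht hr
  have h0 := h.hasDerivAt_t ht hr
  have h0' := h.hasDerivAt_r ht hr
  have hat : HasDerivAt (fun s => amp ψ s r) (r * tr - cos (ψ t r) * pT ψ t r) t :=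
    (h3.const_mul r).sub h0.sin
  have har : HasDerivAt (fun ρ => amp ψ t ρ) (pR ψ t r + r * rr - cos (ψ t r) * pR ψ t r) r := by
    refine (((hasDerivAt_id r).mul h4).sub h0'.sin).congr_deriv ?_
    simp
  refine ⟨_, _, ((hg.mul_const (β r)).mul ((h1.const_mul r).mul hat)).neg,
    (hβ.const_mul (g t)).mul (((har.pow 2).add (((hasDerivAt_id r).pow 2).mul (h2.pow 2))).div_const
      2), ?_⟩
  simp only [Nat.cast_ofNat, Nat.add_one_sub_one, pow_one, id, he, Pi.pow_apply,
    Pi.mul_apply, morH]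
  generalize hA : amp ψ t r = A
  rw [amp] at hA
  have hpr : pR ψ t r = (A + sin (ψ t r)) / r := by rw [← hA]; field_simp; ring
  rw [hpr]
  field_simp
  ring

theorem morawetz_identity (h : DegOneWave ψ) {g g' β β' : ℝ → ℝ} {T T' ρ R : ℝ} (hT : 0 < T)
    (hTT : T ≤ T') (hρ : 0 < ρ) (hρR : ρ ≤ R) (hg : ∀ t, HasDerivAt g (g' t) t)
    (hβ : ∀ r, HasDerivAt β (β' r) r) (hg' : Continuous g') (hβ' : Continuous β')
    (hgT : g T = 0) (hgT' : g T' = 0) (hβR : β R = 0) :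
    ∫ t in T..T', ∫ r in ρ..R, -morH g g' β β' ψ t r =
      ∫ t in T..T', g t * β ρ * ((amp ψ t ρ ^ 2 + ρ ^ 2 * pT ψ t ρ ^ 2) / 2) := by
  have hgc : Continuous g := continuous_iff_continuousAt.2 fun t => (hg t).continuousAt
  have hβc : Continuous β := continuous_iff_continuousAt.2 fun t => (hβ t).continuousAt
  have pos : ∀ t ∈ Icc T T', 0 < t := fun t ht => hT.trans_le ht.1
  have posr : ∀ t : ℝ, ∀ y ∈ Icc ρ R, 0 < 0 + 0 * t + y * (1 + 0 * t) := fun t y hy => by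
    have := hρ.trans_le hy.1; linarith
  have dg : ∀ t r : ℝ, DifferentiableAt ℝ (fun p : ℝ × ℝ => g p.1) (t, r) := fun t r =>
    DifferentiableAt.comp (g := g) (t, r) (hg t).differentiableAt differentiableAt_fst
  have dβ : ∀ t r : ℝ, DifferentiableAt ℝ (fun p : ℝ × ℝ => β p.2) (t, r) := fun t r =>
    DifferentiableAt.comp (g := β) (t, r) (hβ r).differentiableAt differentiableAt_snd
  have key := divergence_sweep 0 0 1 0 hTT hρR
    (F := fun s r => -(g s * β r * (r * pT ψ s r * amp ψ s r)))
    (G := fun t ρ => g t * β ρ * ((amp ψ t ρ ^ 2 + ρ ^ 2 * pT ψ t ρ ^ 2) / 2))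
    (H := morH g g' β β' ψ)
    (fun t ht y hy => by
      have h1 := h.differentiableAt_pT (pos t ht) (posr t y hy)
      have h2 := h.differentiableAt_amp (pos t ht) (posr t y hy)
      have h3 := dg t (0 + 0 * t + y * (1 + 0 * t))
      have h4 := dβ t (0 + 0 * t + y * (1 + 0 * t))
      exact ((h3.mul h4).mul ((differentiableAt_snd.mul h1).mul h2)).neg)
    (fun t ht y hy => by
      have h1 := h.differentiableAt_pT (pos t ht) (posr t y hy)
      have h2 := h.differentiableAt_amp (pos t ht) (posr t y hy)
      have h3 := dg t (0 + 0 * t + y * (1 + 0 * t))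
      have h4 := dβ t (0 + 0 * t + y * (1 + 0 * t))
      simp only [div_eq_mul_inv]
      exact (h3.mul h4).mul (((h2.pow 2).add ((differentiableAt_snd.pow 2).mul (h1.pow 2))).mul_const _))
    (fun t ht y hy => h.morawetz_pointwise (pos t ht) (posr t y hy) (hg t) (hβ _))
    ((h.continuousOn_morH hgc hg' hβc hβ').comp
      (f := fun p : ℝ × ℝ => (p.1, 0 + 0 * p.1 + p.2 * (1 + 0 * p.1))) (by fun_prop)
      fun p hp => ⟨pos _ hp.1, posr _ _ hp.2⟩)
  simp only [hgT, hgT', hβR, zero_mul, mul_zero, zero_add, add_zero, mul_one, one_mul, neg_zero,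
    intervalIntegral.integral_zero, sub_zero, sub_self] at key
  simp only [intervalIntegral.integral_neg, key, zero_sub, neg_neg]

end DegOneWave

/-- Temporal cut-off `(s - t)(t + ℓ - s) / ℓ²`. -/
def timeCut (t ℓ s : ℝ) : ℝ := (s - t) * (t + ℓ - s) / ℓ ^ 2

/-- Spatial weight `ℓ⁸ (r² + ℓ²)⁻⁴`, shifted to vanish at `r = R`. -/
def radWeight (ℓ R r : ℝ) : ℝ := ℓ ^ 8 / (r ^ 2 + ℓ ^ 2) ^ 4 - ℓ ^ 8 / (R ^ 2 + ℓ ^ 2) ^ 4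

/-- Derivative of `radWeight`. -/
def radWeightDeriv (ℓ r : ℝ) : ℝ := -(8 * r * ℓ ^ 8) / (r ^ 2 + ℓ ^ 2) ^ 5

theorem hasDerivAt_timeCut (t ℓ s : ℝ) :
    HasDerivAt (timeCut t ℓ) ((2 * t + ℓ - 2 * s) / ℓ ^ 2) s := by
  refine ((((hasDerivAt_id s).sub_const t).mul ((hasDerivAt_id s).const_sub (t + ℓ))).div_const
    (ℓ ^ 2)).congr_deriv ?_
  simp only [id]; ring

theorem timeCut_nonneg {t ℓ s : ℝ} (hs : s ∈ Icc t (t + ℓ)) : 0 ≤ timeCut t ℓ s :=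
  div_nonneg (mul_nonneg (by linarith [hs.1]) (by linarith [hs.2])) (sq_nonneg ℓ)

theorem timeCut_le {t ℓ : ℝ} (hℓ : 0 < ℓ) (s : ℝ) : timeCut t ℓ s ≤ 1 / 4 := by
  rw [timeCut, div_le_iff₀ (by positivity)]
  nlinarith [sq_nonneg (2 * s - 2 * t - ℓ)]

theorem le_timeCut {t ℓ s : ℝ} (hℓ : 0 < ℓ) (hs : s ∈ Icc (t + ℓ / 4) (t + 3 * ℓ / 4)) :
    3 / 16 ≤ timeCut t ℓ s := by
  rw [timeCut, le_div_iff₀ (by positivity)]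
  nlinarith [mul_nonneg (sub_nonneg.2 hs.1) (sub_nonneg.2 hs.2)]

theorem abs_deriv_timeCut_le {t ℓ s : ℝ} (hℓ : 0 < ℓ) (hs : s ∈ Icc t (t + ℓ)) :
    |(2 * t + ℓ - 2 * s) / ℓ ^ 2| ≤ 1 / ℓ := by
  rw [abs_div, abs_of_pos (by positivity : 0 < ℓ ^ 2), div_le_div_iff₀ (by positivity) hℓ]
  have : |2 * t + ℓ - 2 * s| ≤ ℓ := abs_le.2 ⟨by linarith [hs.2], by linarith [hs.1]⟩
  nlinarith

theorem hasDerivAt_radWeight {ℓ : ℝ} (hℓ : 0 < ℓ) (R r : ℝ) :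
    HasDerivAt (radWeight ℓ R) (radWeightDeriv ℓ r) r := by
  have hd : HasDerivAt (fun r : ℝ => (r ^ 2 + ℓ ^ 2) ^ 4) (4 * (r ^ 2 + ℓ ^ 2) ^ 3 * (2 * r)) r := by
    refine ((((hasDerivAt_id r).pow 2).add_const (ℓ ^ 2)).pow 4).congr_deriv ?_
    simp
  have hne : r ^ 2 + ℓ ^ 2 ≠ 0 := by positivity
  refine (((hasDerivAt_const r (ℓ ^ 8)).div hd (pow_ne_zero 4 hne)).sub_const _).congr_deriv ?_
  rw [radWeightDeriv]
  field_simp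
  ring

theorem radWeight_nonneg {ℓ R r : ℝ} (hℓ : 0 < ℓ) (hr : 0 ≤ r) (hrR : r ≤ R) :
    0 ≤ radWeight ℓ R r := by
  have : ℓ ^ 8 / (R ^ 2 + ℓ ^ 2) ^ 4 ≤ ℓ ^ 8 / (r ^ 2 + ℓ ^ 2) ^ 4 := by gcongr
  rw [radWeight]; linarith

theorem radWeight_le {ℓ : ℝ} (hℓ : 0 < ℓ) (R r : ℝ) :
    radWeight ℓ R r ≤ ℓ ^ 8 / (r ^ 2 + ℓ ^ 2) ^ 4 := by
  have : 0 ≤ ℓ ^ 8 / (R ^ 2 + ℓ ^ 2) ^ 4 := by positivity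
  rw [radWeight]; linarith

theorem radWeight_le_one {ℓ : ℝ} (hℓ : 0 < ℓ) (R r : ℝ) : radWeight ℓ R r ≤ 1 := by
  refine (radWeight_le hℓ R r).trans ?_
  rw [div_le_one (by positivity)]
  calc ℓ ^ 8 = (0 + ℓ ^ 2) ^ 4 := by ring
    _ ≤ (r ^ 2 + ℓ ^ 2) ^ 4 := by gcongr; positivity

theorem radWeightDeriv_nonpos {ℓ r : ℝ} (hr : 0 ≤ r) : radWeightDeriv ℓ r ≤ 0 := by
  rw [radWeightDeriv, neg_div, neg_nonpos]; positivity

theorem le_radWeight {ℓ K r : ℝ} (hℓ : 0 < ℓ) (hr : 0 ≤ r) (hrK : r ≤ K * ℓ / 2) :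
    ((K ^ 2 / 4 + 1) ^ 4)⁻¹ - ((K ^ 2 + 1) ^ 4)⁻¹ ≤ radWeight ℓ (K * ℓ) r := by
  have h1 : ((K ^ 2 / 4 + 1) ^ 4)⁻¹ = ℓ ^ 8 / ((K * ℓ / 2) ^ 2 + ℓ ^ 2) ^ 4 := by
    have : (K * ℓ / 2) ^ 2 + ℓ ^ 2 = (K ^ 2 / 4 + 1) * ℓ ^ 2 := by ring
    rw [this]; field_simp
  have h2 : ((K ^ 2 + 1) ^ 4)⁻¹ = ℓ ^ 8 / ((K * ℓ) ^ 2 + ℓ ^ 2) ^ 4 := by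
    have : (K * ℓ) ^ 2 + ℓ ^ 2 = (K ^ 2 + 1) * ℓ ^ 2 := by ring
    rw [this]; field_simp
  rw [h1, h2, radWeight]
  gcongr

theorem radWeight_mul_cos {ℓ R r C : ℝ} (hℓ : 0 < ℓ) (hr : 0 < r) (hrR : r ≤ R) (hC : -1 ≤ C)
    (hC' : r ≤ ℓ → 1 / 2 ≤ C) :
    radWeight ℓ R r / 2 ≤ radWeight ℓ R r * C - r * radWeightDeriv ℓ r / 2 := by
  have h0 := radWeight_nonneg hℓ hr.le hrR
  have h1 := radWeightDeriv_nonpos (ℓ := ℓ) hr.le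
  rcases le_total r ℓ with hle | hle
  · have := mul_le_mul_of_nonneg_left (hC' hle) h0
    nlinarith
  · have h2 : 2 * radWeight ℓ R r ≤ -(r * radWeightDeriv ℓ r / 2) := by
      have h3 := radWeight_le hℓ R r
      have h4 : 2 * (ℓ ^ 8 / (r ^ 2 + ℓ ^ 2) ^ 4) ≤ -(r * radWeightDeriv ℓ r / 2) := by
        have e : -(r * radWeightDeriv ℓ r / 2) =
            (4 * r ^ 2 / (r ^ 2 + ℓ ^ 2)) * (ℓ ^ 8 / (r ^ 2 + ℓ ^ 2) ^ 4) := by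
          rw [radWeightDeriv]; field_simp; ring
        rw [e]
        refine mul_le_mul_of_nonneg_right ?_ (by positivity)
        rw [le_div_iff₀ (by positivity)]
        nlinarith
      linarith
    nlinarith

theorem morawetz_algebra {g g' b b' C A p r ℓ K ν : ℝ} (hℓ : 0 < ℓ) (hν : 0 < ν) (hr : 0 < r)
    (hK : 0 < K) (hrK : r ≤ K * ℓ) (hg : 0 ≤ g) (hg1 : g ≤ 1 / 4) (hg' : |g'| ≤ 1 / ℓ) (hb : 0 ≤ b)
    (hb1 : b ≤ 1) (hb' : b' ≤ 0) (hC1 : C ≤ 1) (hmain : b / 2 ≤ b * C - r * b' / 2) :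
    g * b / 2 * (A ^ 2 / r) ≤
      -(g * b * (-(C * A ^ 2 / r) + r * (1 + C) * p ^ 2) + g * b' * ((A ^ 2 + r ^ 2 * p ^ 2) / 2)
        - g' * b * (r * p * A))
      + ((1 / 2 + K / (2 * ν)) * (r * p ^ 2) + K * ν / 2 * (A ^ 2 / r)) := by
  have hX : 0 ≤ A ^ 2 / r := by positivity
  have hY : 0 ≤ r * p ^ 2 := by positivity
  have e : -(g * b * (-(C * A ^ 2 / r) + r * (1 + C) * p ^ 2)
      + g * b' * ((A ^ 2 + r ^ 2 * p ^ 2) / 2) - g' * b * (r * p * A)) =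
      g * (b * C - r * b' / 2) * (A ^ 2 / r) - g * (b * (1 + C) + r * b' / 2) * (r * p ^ 2)
        + g' * b * (r * p * A) := by field_simp; ring
  rw [e]
  have h1 : g * b / 2 * (A ^ 2 / r) ≤ g * (b * C - r * b' / 2) * (A ^ 2 / r) := by
    refine mul_le_mul_of_nonneg_right ?_ hX
    have := mul_le_mul_of_nonneg_left hmain hg
    linarith
  have h2 : g * (b * (1 + C) + r * b' / 2) * (r * p ^ 2) ≤ 1 / 2 * (r * p ^ 2) := by
    refine mul_le_mul_of_nonneg_right ?_ hY
    have h3 : b * (1 + C) + r * b' / 2 ≤ 2 := by nlinarith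
    nlinarith
  have h4 : |g' * b * (r * p * A)| ≤ K / (2 * ν) * (r * p ^ 2) + K * ν / 2 * (A ^ 2 / r) := by
    have h5 : |p * A| ≤ (r * p ^ 2 / ν + ν * (A ^ 2 / r)) / 2 := by
      have i1 : (r * p ^ 2 / ν + ν * (A ^ 2 / r)) / 2 - p * A = (r * p - ν * A) ^ 2 / (2 * ν * r) := by
        field_simp; ring
      have i2 : (r * p ^ 2 / ν + ν * (A ^ 2 / r)) / 2 + p * A = (r * p + ν * A) ^ 2 / (2 * ν * r) := by
        field_simp; ring
      have i3 : 0 ≤ (r * p - ν * A) ^ 2 / (2 * ν * r) := by positivity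
      have i4 : 0 ≤ (r * p + ν * A) ^ 2 / (2 * ν * r) := by positivity
      rw [abs_le]; constructor <;> linarith
    have h6 : |g' * b * r| ≤ K := by
      rw [abs_mul, abs_mul, abs_of_nonneg hb, abs_of_pos hr]
      calc |g'| * b * r ≤ 1 / ℓ * 1 * (K * ℓ) := by gcongr
        _ = K := by field_simp
    calc |g' * b * (r * p * A)| = |g' * b * r| * |p * A| := by rw [← abs_mul]; ring_nf
      _ ≤ K * ((r * p ^ 2 / ν + ν * (A ^ 2 / r)) / 2) := by gcongr
      _ = _ := by field_simp
  have h7 := neg_abs_le (g' * b * (r * p * A))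
  linarith

namespace DegOneWave

variable {ψ : ℝ → ℝ → ℝ}

theorem continuousOn_pT_sq (h : DegOneWave ψ) :
    ContinuousOn (fun p : ℝ × ℝ => p.2 * pT ψ p.1 p.2 ^ 2) (Ioi 0 ×ˢ Ioi 0) :=
  continuousOn_snd.mul (h.continuousOn_pT.pow 2)

/-- Localized Morawetz estimate for `amp` on the middle half of a time interval. -/
theorem morawetz_estimate (h : DegOneWave ψ) {t ℓ K ν ρ : ℝ} (ht : 0 < t) (hℓ : 0 < ℓ) (hK : 0 < K)
    (hν : 0 < ν) (hρ : 0 < ρ) (hρK : ρ ≤ K * ℓ / 2)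
    (hcos : ∀ s ∈ Icc t (t + ℓ), ∀ r, 0 < r → r ≤ ℓ → 1 / 2 ≤ cos (ψ s r)) :
    3 / 32 * (((K ^ 2 / 4 + 1) ^ 4)⁻¹ - ((K ^ 2 + 1) ^ 4)⁻¹) *
        ∫ s in t + ℓ / 4..t + 3 * ℓ / 4, ∫ r in ρ..K * ℓ / 2, amp ψ s r ^ 2 / r ≤
      (∫ s in t..t + ℓ, ρ * eDen ψ s ρ) +
        ((1 / 2 + K / (2 * ν)) * (∫ s in t..t + ℓ, ∫ r in ρ..K * ℓ, r * pT ψ s r ^ 2)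
          + K * ν / 2 * ∫ s in t..t + ℓ, ∫ r in ρ..K * ℓ, amp ψ s r ^ 2 / r) := by
  have hI : t ≤ t + ℓ := by linarith
  have hKℓ : 0 < K * ℓ := by positivity
  have hρ' : ρ ≤ K * ℓ := by linarith
  have sub : (Icc t (t + ℓ) ×ˢ Icc ρ (K * ℓ) : Set (ℝ × ℝ)) ⊆ Ioi 0 ×ˢ Ioi 0 := fun p hp =>
    ⟨ht.trans_le hp.1.1, hρ.trans_le hp.2.1⟩
  have dg := hasDerivAt_timeCut t ℓ
  have dβ := hasDerivAt_radWeight hℓ (K * ℓ)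
  have gc : Continuous (timeCut t ℓ) := continuous_iff_continuousAt.2 fun s => (dg s).continuousAt
  have βc : Continuous (radWeight ℓ (K * ℓ)) :=
    continuous_iff_continuousAt.2 fun s => (dβ s).continuousAt
  have gc' : Continuous (fun s => (2 * t + ℓ - 2 * s) / ℓ ^ 2) := by fun_prop
  have βc' : Continuous (radWeightDeriv ℓ) := by
    unfold radWeightDeriv
    have : ∀ r : ℝ, (r ^ 2 + ℓ ^ 2) ^ 5 ≠ 0 := fun r => by positivity
    fun_prop (disch := assumption)
  have cX := h.continuousOn_amp_sq_div.mono sub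
  have cY := h.continuousOn_pT_sq.mono sub
  have cH := (h.continuousOn_morH gc gc' βc βc').mono sub
  have cf : ContinuousOn (fun p : ℝ × ℝ => timeCut t ℓ p.1 * radWeight ℓ (K * ℓ) p.2 / 2 *
      (amp ψ p.1 p.2 ^ 2 / p.2)) (Icc t (t + ℓ) ×ˢ Icc ρ (K * ℓ)) :=
    ContinuousOn.mul (by fun_prop) cX
  have hid := h.morawetz_identity ht hI hρ hρ' dg dβ gc' βc' (by simp [timeCut]) (by simp [timeCut])
    (by simp [radWeight])
  have hb : ∫ s in t..t + ℓ, timeCut t ℓ s * radWeight ℓ (K * ℓ) ρ *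
      ((amp ψ s ρ ^ 2 + ρ ^ 2 * pT ψ s ρ ^ 2) / 2) ≤ ∫ s in t..t + ℓ, ρ * eDen ψ s ρ := by
    have tρ : ∀ {f : ℝ × ℝ → ℝ}, ContinuousOn f (Ioi 0 ×ˢ Ioi 0) →
        ContinuousOn (fun s => f (s, ρ)) (Icc t (t + ℓ)) := fun hf =>
      hf.comp (f := fun s => (s, ρ)) (by fun_prop) fun s hs => ⟨ht.trans_le hs.1, hρ⟩
    refine intervalIntegral.integral_mono_on hI ?_ ?_ fun s hs => ?_
    · refine ContinuousOn.intervalIntegrable_of_Icc hI (ContinuousOn.mul (by fun_prop) ?_)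
      exact (((tρ h.continuousOn_amp).pow 2).add (((tρ h.continuousOn_pT).pow 2).const_smul
        (ρ ^ 2))).div_const 2
    · exact ContinuousOn.intervalIntegrable_of_Icc hI (continuousOn_const.mul
        (tρ h.continuousOn_eDen))
    · have h1 := amp_sq_add_le ψ s hρ
      have h2 := timeCut_nonneg hs
      have h3 := timeCut_le (t := t) hℓ s
      have h4 := radWeight_nonneg hℓ hρ.le hρ'
      have h5 := radWeight_le_one hℓ (K * ℓ) ρ
      refine (mul_le_of_le_one_left (by positivity) ?_).trans h1
      nlinarith
  have hmono := double_integral_mono hI hρ'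
    (f := fun s r => timeCut t ℓ s * radWeight ℓ (K * ℓ) r / 2 * (amp ψ s r ^ 2 / r))
    (g := fun s r => 1 * -morH (timeCut t ℓ) (fun s => (2 * t + ℓ - 2 * s) / ℓ ^ 2)
      (radWeight ℓ (K * ℓ)) (radWeightDeriv ℓ) ψ s r + 1 *
      ((1 / 2 + K / (2 * ν)) * (r * pT ψ s r ^ 2) + K * ν / 2 * (amp ψ s r ^ 2 / r)))
    cf ((continuousOn_const.mul cH.neg).add (continuousOn_const.mul
      ((continuousOn_const.mul cY).add (continuousOn_const.mul cX))))
    fun s hs r hr => by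
      have hr0 := hρ.trans_le hr.1
      rw [one_mul, one_mul]
      exact morawetz_algebra hℓ hν hr0 hK hr.2 (timeCut_nonneg hs) (timeCut_le hℓ s)
        (abs_deriv_timeCut_le hℓ hs) (radWeight_nonneg hℓ hr0.le hr.2) (radWeight_le_one hℓ _ _)
        (radWeightDeriv_nonpos hr0.le) (cos_le_one _)
        (radWeight_mul_cos hℓ hr0 hr.2 (neg_one_le_cos _) (hcos s hs r hr0))
  rw [double_integral_linear hI hρ' 1 1 (f := fun s r => -morH (timeCut t ℓ)
      (fun s => (2 * t + ℓ - 2 * s) / ℓ ^ 2) (radWeight ℓ (K * ℓ)) (radWeightDeriv ℓ) ψ s r)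
      (g := fun s r => (1 / 2 + K / (2 * ν)) * (r * pT ψ s r ^ 2) + K * ν / 2 * (amp ψ s r ^ 2 / r))
      cH.neg ((continuousOn_const.mul cY).add (continuousOn_const.mul cX)),
    double_integral_linear hI hρ' _ _ (f := fun s r => r * pT ψ s r ^ 2)
      (g := fun s r => amp ψ s r ^ 2 / r) cY cX, hid, one_mul, one_mul] at hmono
  have hf0 : ∀ s ∈ Icc t (t + ℓ), ∀ r ∈ Icc ρ (K * ℓ),
      0 ≤ timeCut t ℓ s * radWeight ℓ (K * ℓ) r / 2 * (amp ψ s r ^ 2 / r) := fun s hs r hr => by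
    have hr0 := hρ.trans_le hr.1
    have h2 := timeCut_nonneg hs
    have h4 := radWeight_nonneg hℓ hr0.le hr.2
    positivity
  have hmid : t + ℓ / 4 ≤ t + 3 * ℓ / 4 := by linarith
  have hsubI : Icc (t + ℓ / 4) (t + 3 * ℓ / 4) ⊆ Icc t (t + ℓ) :=
    Icc_subset_Icc (by linarith) (by linarith)
  have hsubR : Icc ρ (K * ℓ / 2) ⊆ Icc ρ (K * ℓ) := Icc_subset_Icc le_rfl (by linarith)
  have hlow1 : ∫ s in t + ℓ / 4..t + 3 * ℓ / 4, ∫ r in ρ..K * ℓ,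
      timeCut t ℓ s * radWeight ℓ (K * ℓ) r / 2 * (amp ψ s r ^ 2 / r) ≤
      ∫ s in t..t + ℓ, ∫ r in ρ..K * ℓ,
        timeCut t ℓ s * radWeight ℓ (K * ℓ) r / 2 * (amp ψ s r ^ 2 / r) := by
    refine intervalIntegral.integral_mono_interval (by linarith) hmid (by linarith) ?_
      ((continuousOn_inner_integral hI hρ' (f := fun s r => timeCut t ℓ s *
        radWeight ℓ (K * ℓ) r / 2 * (amp ψ s r ^ 2 / r)) cf).intervalIntegrable_of_Icc hI)
    filter_upwards [ae_restrict_mem measurableSet_Ioc] with s hs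
    exact intervalIntegral.integral_nonneg hρ' (hf0 s (Ioc_subset_Icc_self hs))
  have hlow2 := double_integral_mono_interval hmid hρK (le_refl ρ) (by linarith : K * ℓ / 2 ≤ K * ℓ)
    (f := fun s r => timeCut t ℓ s * radWeight ℓ (K * ℓ) r / 2 * (amp ψ s r ^ 2 / r))
    (cf.mono (prod_mono hsubI subset_rfl)) fun s hs => hf0 s (hsubI hs)
  set b0 := ((K ^ 2 / 4 + 1) ^ 4)⁻¹ - ((K ^ 2 + 1) ^ 4)⁻¹ with hb0
  have hlow3 := double_integral_mono hmid hρK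
    (f := fun s r => 3 / 32 * b0 * (amp ψ s r ^ 2 / r))
    (g := fun s r => timeCut t ℓ s * radWeight ℓ (K * ℓ) r / 2 * (amp ψ s r ^ 2 / r))
    (continuousOn_const.mul (cX.mono (prod_mono hsubI hsubR)))
    (cf.mono (prod_mono hsubI hsubR)) fun s hs r hr => by
      have hr0 := hρ.trans_le hr.1
      refine mul_le_mul_of_nonneg_right ?_ (by positivity)
      have h1 := le_timeCut hℓ hs
      have h2 := le_radWeight hℓ hr0.le hr.2
      have h3 := radWeight_nonneg hℓ hr0.le (hsubR hr).2
      have h4 := mul_le_mul_of_nonneg_right h1 h3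
      linarith
  simp only [intervalIntegral.integral_const_mul] at hlow3
  simp only [intervalIntegral.integral_const_mul]
  simp only [intervalIntegral.integral_const_mul] at hb
  linarith

end DegOneWave

namespace DegOneWave

variable {ψ : ℝ → ℝ → ℝ}

theorem integrableOn_pT_sq (h : DegOneWave ψ) {t : ℝ} (ht : 0 < t) :
    IntegrableOn (fun r => pT ψ t r ^ 2 * r) (Ioi 0) := by
  have hc : ContinuousOn (fun r => pT ψ t r ^ 2 * r) (Ioi 0) :=
    ((continuousOn_slice h.continuousOn_pT ht).pow 2).mul continuousOn_id
  refine Integrable.mono' (h.integrableOn_eDen ht subset_rfl)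
    (hc.aestronglyMeasurable measurableSet_Ioi) ?_
  filter_upwards [ae_restrict_mem measurableSet_Ioi] with r hr
  have hr0 : (0 : ℝ) < r := hr
  rw [norm_of_nonneg (by positivity)]
  exact pT_sq_le ψ t hr0.le

theorem integrableOn_amp_sq (h : DegOneWave ψ) {t : ℝ} (ht : 0 < t) :
    IntegrableOn (fun r => amp ψ t r ^ 2 / r) (Ioi 0) := by
  have hc : ContinuousOn (fun r => amp ψ t r ^ 2 / r) (Ioi 0) :=
    continuousOn_slice h.continuousOn_amp_sq_div ht
  refine Integrable.mono' ((h.integrableOn_eDen ht subset_rfl).const_mul 2)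
    (hc.aestronglyMeasurable measurableSet_Ioi) ?_
  filter_upwards [ae_restrict_mem measurableSet_Ioi] with r hr
  have hr0 : (0 : ℝ) < r := hr
  rw [norm_of_nonneg (by positivity)]
  exact amp_sq_div_le ψ t hr0

theorem setIntegral_pT_sq_le_locE (h : DegOneWave ψ) {t a : ℝ} (ht : 0 < t) :
    ∫ r in Ioc 0 a, pT ψ t r ^ 2 * r ≤ locE ψ t 0 a :=
  setIntegral_mono_on ((h.integrableOn_pT_sq ht).mono_set Ioc_subset_Ioi_self)
    (h.integrableOn_eDen ht Ioc_subset_Ioi_self) measurableSet_Ioc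
    fun _ hr => pT_sq_le ψ t hr.1.le

theorem setIntegral_amp_sq_le_locE (h : DegOneWave ψ) {t a b : ℝ} (ht : 0 < t) (ha : 0 ≤ a) :
    ∫ r in Ioc a b, amp ψ t r ^ 2 / r ≤ 2 * locE ψ t a b := by
  have hsub : Ioc a b ⊆ Ioi 0 := fun r hr => ha.trans_lt hr.1
  rw [locE, ← integral_const_mul]
  exact setIntegral_mono_on ((h.integrableOn_amp_sq ht).mono_set hsub)
    ((h.integrableOn_eDen ht hsub).const_mul 2) measurableSet_Ioc
    fun r hr => amp_sq_div_le ψ t (hsub hr)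

theorem setIntegral_Ioc_split {f : ℝ → ℝ} (hf : IntegrableOn f (Ioi 0)) {a b : ℝ} (ha : 0 ≤ a)
    (hab : a ≤ b) : ∫ r in Ioc 0 b, f r = (∫ r in Ioc 0 a, f r) + ∫ r in Ioc a b, f r := by
  rw [← Ioc_union_Ioc_eq_Ioc ha hab]
  exact setIntegral_union (Ioc_disjoint_Ioc_of_le le_rfl) measurableSet_Ioc
    (hf.mono_set Ioc_subset_Ioi_self) (hf.mono_set fun r hr => ha.trans_lt hr.1)

theorem setIntegral_pT_sq_le_defect (h : DegOneWave ψ) {s y0 η c : ℝ} (hs : 0 < s) (hy0 : 0 < y0)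
    (hy0c : y0 ≤ c) (hη : 0 < η) (hηc : η ≤ c) :
    ∫ r in Ioc 0 (c * s), pT ψ s r ^ 2 * r ≤ locE ψ s 0 (y0 * s) + defect ψ η c y0 s := by
  have hys : 0 < y0 * s := by positivity
  have hyc : y0 * s ≤ c * s := by gcongr
  have hηc' : η * s ≤ c * s := by gcongr
  rw [setIntegral_Ioc_split (h.integrableOn_pT_sq hs) hys.le hyc, defect,
    intervalIntegral.integral_of_le hyc]
  have h1 := h.setIntegral_pT_sq_le_locE (a := y0 * s) hs
  have h2 : 0 ≤ ∫ r in η * s..c * s, pR ψ s r ^ 2 * r :=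
    intervalIntegral.integral_nonneg hηc' fun r hr => by
      have : 0 < r := (by positivity : 0 < η * s).trans_le hr.1
      positivity
  linarith

theorem integral_pT_sq_le_defect (h : DegOneWave ψ) {s y0 η c a b : ℝ} (hs : 0 < s) (hy0 : 0 < y0)
    (hy0c : y0 ≤ c) (hη : 0 < η) (hηc : η ≤ c) (ha : 0 < a) (hab : a ≤ b) (hbc : b ≤ c * s) :
    ∫ r in a..b, r * pT ψ s r ^ 2 ≤ locE ψ s 0 (y0 * s) + defect ψ η c y0 s := by
  refine le_trans ?_ (h.setIntegral_pT_sq_le_defect hs hy0 hy0c hη hηc)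
  rw [intervalIntegral.integral_of_le hab]
  simp_rw [mul_comm _ (pT ψ s _ ^ 2)]
  refine setIntegral_mono_set ((h.integrableOn_pT_sq hs).mono_set Ioc_subset_Ioi_self) ?_
    (Ioc_subset_Ioc ha.le hbc).eventuallyLE
  filter_upwards [ae_restrict_mem measurableSet_Ioc] with r hr
  have := hr.1.le
  simp only [Pi.zero_apply]; positivity

/-- A slice near the origin carrying little energy over a time interval. -/
theorem exists_inner_slice (h : DegOneWave ψ) {t ℓ δ b : ℝ} (ht : 0 < t) (hℓ : 0 < ℓ) (hδ : 0 < δ)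
    (hb : 0 < b) : ∃ ρ, 0 < ρ ∧ ρ ≤ b ∧ (∀ s ∈ Icc t (t + ℓ), locE ψ s 0 ρ ≤ δ) ∧
      ∫ s in t..t + ℓ, ρ * eDen ψ s ρ ≤ 2 * δ * ℓ := by
  have hI : t ≤ t + ℓ := by linarith
  obtain ⟨ρ0, hρ0, hE⟩ := h.exists_radius_locE_le (T := t) (T' := t + ℓ) ht hδ
  set ρ1 := min ρ0 b
  have hρ1 : 0 < ρ1 := lt_min hρ0 hb
  have hE1 : ∀ s ∈ Icc t (t + ℓ), ∀ ρ ∈ Icc 0 ρ1, locE ψ s 0 ρ ≤ δ := fun s hs ρ hρ =>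
    (h.locE_mono_right (ht.trans_le hs.1) le_rfl hρ.1 (hρ.2.trans (min_le_left _ _))).trans
      (hE s hs)
  have hle : ρ1 / 2 ≤ ρ1 := by linarith
  have cE : ContinuousOn (fun p : ℝ × ℝ => eDen ψ p.1 p.2) (Icc t (t + ℓ) ×ˢ Icc (ρ1 / 2) ρ1) :=
    h.continuousOn_eDen.mono fun p hp =>
      ⟨ht.trans_le hp.1.1, (by positivity : 0 < ρ1 / 2).trans_le hp.2.1⟩
  obtain ⟨ρ, hρ, hs⟩ := exists_slice_le hI hle (f := fun s r => eDen ψ s r) cE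
  have hρ' : 0 < ρ := (by positivity : 0 < ρ1 / 2).trans_le hρ.1
  refine ⟨ρ, hρ', hρ.2.trans (min_le_right _ _), fun s hs => hE1 s hs ρ ⟨hρ'.le, hρ.2⟩, ?_⟩
  have h1 : ∫ s in t..t + ℓ, ∫ r in ρ1 / 2..ρ1, eDen ψ s r ≤ ∫ _ in t..t + ℓ, δ := by
    refine intervalIntegral.integral_mono_on hI
      ((continuousOn_inner_integral hI hle cE).intervalIntegrable_of_Icc hI)
      intervalIntegrable_const fun s hs => ?_
    have hs0 := ht.trans_le hs.1
    rw [← locE_eq_intervalIntegral hle]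
    have h2 := h.locE_add_locE hs0 le_rfl (by positivity : 0 ≤ ρ1 / 2) hle
    have h3 := locE_nonneg ψ s (a := 0) (b := ρ1 / 2) le_rfl
    have h4 := hE1 s hs ρ1 ⟨hρ1.le, le_rfl⟩
    linarith
  rw [intervalIntegral.integral_const, smul_eq_mul] at h1
  have h5 : 0 ≤ ∫ s in t..t + ℓ, eDen ψ s ρ :=
    intervalIntegral.integral_nonneg hI fun s _ => eDen_nonneg ψ s hρ'.le
  rw [intervalIntegral.integral_const_mul]
  have h6 : ρ * ∫ s in t..t + ℓ, eDen ψ s ρ ≤ ρ1 * ∫ s in t..t + ℓ, eDen ψ s ρ := by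
    gcongr; exact hρ.2
  nlinarith

theorem exists_time_of_window (h : DegOneWave ψ) {t l c y0 η ν K : ℝ} (ht : 0 < t) (hl : 0 < l)
    (hE : locE ψ t 0 l ≤ 1) (hν : 0 < ν) (hν1 : ν ≤ 1) (hK : 0 < K) (hy0 : 0 < y0)
    (hy0c : y0 ≤ c) (hη : 0 < η) (hηc : η ≤ c) (hc : 0 < c) (hKc : K * (l / 2) ≤ c * t)
    (hin : ∀ s ∈ Icc t (t + l / 2), locE ψ s 0 (y0 * s) ≤ ν ^ 2)
    (hdef : ∫ s in t..t + l / 2, defect ψ η c y0 s ≤ ν ^ 2 * (l / 2)) :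
    ∃ s ∈ Icc t (t + l / 2), ∃ ρ, 0 < ρ ∧ ρ ≤ K * (l / 2) / 2 ∧ locE ψ s 0 ρ ≤ ν ∧
      (∫ r in ρ..K * (l / 2) / 2, amp ψ s r ^ 2 / r) + defect ψ η c y0 s ≤
        2 * (32 / (3 * (((K ^ 2 / 4 + 1) ^ 4)⁻¹ - ((K ^ 2 + 1) ^ 4)⁻¹)) * (3 + 13 * K) + 1) * ν := by
  set ℓ := l / 2 with hℓ'
  have hℓ : 0 < ℓ := by positivity
  have hI : t ≤ t + ℓ := by linarith
  have hν2 : ν ^ 2 ≤ ν := by nlinarith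
  obtain ⟨ρ, hρ, hρb, hρE, hρe⟩ := h.exists_inner_slice ht hℓ (pow_pos hν 2)
    (by positivity : 0 < K * ℓ / 2)
  have hρK : ρ ≤ K * ℓ := by have := mul_pos hK hℓ; linarith
  have hcos : ∀ s ∈ Icc t (t + ℓ), ∀ r, 0 < r → r ≤ ℓ → 1 / 2 ≤ cos (ψ s r) := by
    intro s hs r hr hrl
    have hs0 := ht.trans_le hs.1
    have h1 := h.locE_window ht hl hE hs
    have h2 := h.locE_mono_right hs0 le_rfl hr.le hrl
    have h3 := h.one_sub_cos_le hs0 hr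
    linarith
  have hmor := h.morawetz_estimate ht hℓ hK hν hρ hρb hcos
  have sub : (Icc t (t + ℓ) ×ˢ Icc ρ (K * ℓ) : Set (ℝ × ℝ)) ⊆ Ioi 0 ×ˢ Ioi 0 := fun p hp =>
    ⟨ht.trans_le hp.1.1, hρ.trans_le hp.2.1⟩
  have cX := h.continuousOn_amp_sq_div.mono sub
  have cY := h.continuousOn_pT_sq.mono sub
  have cD := h.continuousOn_defect (T' := t + ℓ) ht hI hy0 hy0c hη hηc
  have hY : ∫ s in t..t + ℓ, ∫ r in ρ..K * ℓ, r * pT ψ s r ^ 2 ≤ 2 * ν ^ 2 * ℓ := by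
    have h1 : ∫ s in t..t + ℓ, ∫ r in ρ..K * ℓ, r * pT ψ s r ^ 2 ≤
        ∫ s in t..t + ℓ, (ν ^ 2 + defect ψ η c y0 s) := by
      refine intervalIntegral.integral_mono_on hI
        ((continuousOn_inner_integral hI hρK (f := fun s r => r * pT ψ s r ^ 2)
          cY).intervalIntegrable_of_Icc hI)
        ((continuousOn_const.add cD).intervalIntegrable_of_Icc hI) fun s hs => ?_
      have hs0 := ht.trans_le hs.1
      refine (h.integral_pT_sq_le_defect hs0 hy0 hy0c hη hηc hρ hρK (hKc.trans ?_)).trans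
        (by linarith [hin s hs])
      have := hs.1
      gcongr
    rw [intervalIntegral.integral_add intervalIntegrable_const (cD.intervalIntegrable_of_Icc hI),
      intervalIntegral.integral_const, smul_eq_mul] at h1
    linarith
  have hX : ∫ s in t..t + ℓ, ∫ r in ρ..K * ℓ, amp ψ s r ^ 2 / r ≤ 24 * ℓ := by
    have h1 : ∫ s in t..t + ℓ, ∫ r in ρ..K * ℓ, amp ψ s r ^ 2 / r ≤ ∫ _ in t..t + ℓ, (24 : ℝ) := by
      refine intervalIntegral.integral_mono_on hI
        ((continuousOn_inner_integral hI hρK (f := fun s r => amp ψ s r ^ 2 / r)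
          cX).intervalIntegrable_of_Icc hI) intervalIntegrable_const fun s hs => ?_
      have hs0 := ht.trans_le hs.1
      rw [intervalIntegral.integral_of_le hρK]
      have h2 := h.setIntegral_amp_sq_le_locE (b := K * ℓ) hs0 hρ.le
      have h3 := h.locE_lt (b := K * ℓ) hs0 hρ.le
      linarith
    rw [intervalIntegral.integral_const, smul_eq_mul] at h1
    linarith
  set b0 := ((K ^ 2 / 4 + 1) ^ 4)⁻¹ - ((K ^ 2 + 1) ^ 4)⁻¹ with hb0'
  have hb0 : 0 < b0 := by
    rw [hb0', sub_pos]
    have : K ^ 2 / 4 < K ^ 2 := by have := pow_pos hK 2; linarith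
    gcongr
  have hmid : t + ℓ / 4 < t + 3 * ℓ / 4 := by linarith
  have hsubI : Icc (t + ℓ / 4) (t + 3 * ℓ / 4) ⊆ Icc t (t + ℓ) :=
    Icc_subset_Icc (by linarith) (by linarith)
  have cX' : ContinuousOn (fun s => ∫ r in ρ..K * ℓ / 2, amp ψ s r ^ 2 / r)
      (Icc (t + ℓ / 4) (t + 3 * ℓ / 4)) :=
    continuousOn_inner_integral hmid.le hρb (f := fun s r => amp ψ s r ^ 2 / r)
      (cX.mono (prod_mono hsubI (Icc_subset_Icc le_rfl (by have := mul_pos hK hℓ; linarith))))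
  have hDmid : ∫ s in t + ℓ / 4..t + 3 * ℓ / 4, defect ψ η c y0 s ≤ ν * ℓ := by
    have h1 : ∫ s in t + ℓ / 4..t + 3 * ℓ / 4, defect ψ η c y0 s ≤
        ∫ s in t..t + ℓ, defect ψ η c y0 s := by
      refine intervalIntegral.integral_mono_interval (by linarith) hmid.le (by linarith) ?_
        (cD.intervalIntegrable_of_Icc hI)
      filter_upwards [ae_restrict_mem measurableSet_Ioc] with s hs
      exact defect_nonneg ψ (ht.trans hs.1) hy0 hy0c hη hηc
    have : ν ^ 2 * ℓ ≤ ν * ℓ := by gcongr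
    linarith
  have hXmid : ∫ s in t + ℓ / 4..t + 3 * ℓ / 4, ∫ r in ρ..K * ℓ / 2, amp ψ s r ^ 2 / r ≤
      32 / (3 * b0) * (3 + 13 * K) * ν * ℓ := by
    have h1 : (1 / 2 + K / (2 * ν)) * (∫ s in t..t + ℓ, ∫ r in ρ..K * ℓ, r * pT ψ s r ^ 2) ≤
        (1 / 2 + K / (2 * ν)) * (2 * ν ^ 2 * ℓ) := by gcongr
    have h2 : K * ν / 2 * (∫ s in t..t + ℓ, ∫ r in ρ..K * ℓ, amp ψ s r ^ 2 / r) ≤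
        K * ν / 2 * (24 * ℓ) := by gcongr
    have h3 : (1 / 2 + K / (2 * ν)) * (2 * ν ^ 2 * ℓ) = ν ^ 2 * ℓ + K * ν * ℓ := by field_simp
    have h4 : ν ^ 2 * ℓ ≤ ν * ℓ := by gcongr
    set I := ∫ s in t + ℓ / 4..t + 3 * ℓ / 4, ∫ r in ρ..K * ℓ / 2, amp ψ s r ^ 2 / r
    have h5 : 3 / 32 * b0 * I ≤ (3 + 13 * K) * ν * ℓ := by linarith
    have h6 : I = 32 / (3 * b0) * (3 / 32 * b0 * I) := by field_simp
    rw [h6]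
    calc _ ≤ 32 / (3 * b0) * ((3 + 13 * K) * ν * ℓ) := by gcongr
      _ = _ := by ring
  obtain ⟨s, hs, hsle⟩ := exists_le_of_integral_le (m := 2 * (32 / (3 * b0) * (3 + 13 * K) + 1) * ν)
    hmid (cX'.add (cD.mono hsubI)) (by
      simp only [Pi.add_apply]
      rw [intervalIntegral.integral_add (cX'.intervalIntegrable_of_Icc hmid.le)
        ((cD.mono hsubI).intervalIntegrable_of_Icc hmid.le)]
      calc _ ≤ 32 / (3 * b0) * (3 + 13 * K) * ν * ℓ + ν * ℓ := by linarith
        _ = _ := by ring)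
  exact ⟨s, hsubI hs, ρ, hρ, hρb, (hρE s (hsubI hs)).trans hν2, hsle⟩

/-- Arbitrarily late times with small kinetic energy inside the light cone at which `ψ` nearly
solves the Bogomolny equation up to a large multiple of its concentration scale. -/
theorem exists_good_time (h : DegOneWave ψ) {ε K η κ T1 : ℝ} (hε : 0 < ε) (hK : 0 < K) (hη : 0 < η)
    (hη1 : η < 1 / 4) (hηK : 4 * K * η ≤ 1) (hκ : 0 < κ) :
    ∃ c, 1 - κ < c ∧ c < 1 ∧ ∃ τ ≥ T1, 1 ≤ τ ∧ ∃ l, 0 < l ∧ l ≤ 4 * η * τ ∧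
      1 ≤ locE ψ τ 0 (2 * l) ∧ (∫ r in Ioc 0 (K * l / 4), amp ψ τ r ^ 2 / r) ≤ ε ∧
      (∫ r in Ioc 0 (c * τ), pT ψ τ r ^ 2 * r) ≤ ε := by
  set M := 2 * (32 / (3 * (((K ^ 2 / 4 + 1) ^ 4)⁻¹ - ((K ^ 2 + 1) ^ 4)⁻¹)) * (3 + 13 * K) + 1)
    with hM'
  have hM : 0 ≤ M := by
    have : ((K ^ 2 + 1) ^ 4)⁻¹ ≤ ((K ^ 2 / 4 + 1) ^ 4)⁻¹ := by
      have : K ^ 2 / 4 ≤ K ^ 2 := by have := pow_pos hK 2; linarith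
      gcongr
    have h2 := sub_nonneg.2 this
    positivity
  set ν := min 1 (ε / (M + 2)) with hν'
  have hν : 0 < ν := by positivity
  have hν1 : ν ≤ 1 := min_le_left _ _
  have hνε : (M + 2) * ν ≤ ε := by
    have : ν ≤ ε / (M + 2) := min_le_right _ _
    rw [le_div_iff₀ (by positivity)] at this
    linarith
  obtain ⟨c, hc2, hcκ, hc1, t, htT, ht1, l, hl, hlt, hE, y0, hy0, hy0η, hin, hdef⟩ :=
    h.exists_good_window (δ := ν ^ 2) (T1 := T1) (by positivity) hη hη1 hκ
  have ht : 0 < t := by linarith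
  have hKc : K * (l / 2) ≤ c * t := by
    have h1 : K * l ≤ K * (4 * η * t) := by gcongr
    have h2 : 4 * K * η * t ≤ 1 * t := by gcongr
    nlinarith
  obtain ⟨s, hs, ρ, hρ, hρK, hρE, hle⟩ := h.exists_time_of_window ht hl hE.le hν hν1 hK hy0
    (by linarith) hη (by linarith) (by linarith) hKc hin hdef
  have hs0 := ht.trans_le hs.1
  have e : K * (l / 2) / 2 = K * l / 4 := by ring
  rw [e] at hρK hle
  have hd0 := defect_nonneg ψ hs0 hy0 (by linarith : y0 ≤ c) hη (by linarith)
  have hX0 : 0 ≤ ∫ r in ρ..K * l / 4, amp ψ s r ^ 2 / r :=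
    intervalIntegral.integral_nonneg hρK fun r hr => by
      have := hρ.trans_le hr.1
      positivity
  refine ⟨c, hcκ, hc1, s, htT.le.trans hs.1, ht1.trans hs.1, l, hl, ?_, ?_, ?_, ?_⟩
  · exact hlt.trans (by have := hs.1; gcongr)
  · rw [← hE]
    exact (h.locE_backward ht hs.1 hl.le).trans (h.locE_mono_right hs0 le_rfl
      (by linarith [hs.1]) (by linarith [hs.2]))
  · rw [setIntegral_Ioc_split (h.integrableOn_amp_sq hs0) hρ.le hρK,
      ← intervalIntegral.integral_of_le hρK]
    have h1 := h.setIntegral_amp_sq_le_locE (a := 0) (b := ρ) hs0 le_rfl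
    linarith
  · have h1 := h.setIntegral_pT_sq_le_defect hs0 hy0 (by linarith : y0 ≤ c) hη (by linarith)
    have h2 := hin s hs
    nlinarith

end DegOneWave

theorem hasDerivAt_Q (x : ℝ) : HasDerivAt Q (2 / (1 + x ^ 2)) x :=
  ((hasDerivAt_arctan x).const_mul 2).congr_deriv (by ring)

theorem Q_strictMono : StrictMono Q := fun _ _ hxy =>
  mul_lt_mul_of_pos_left (arctan_strictMono hxy) two_pos

theorem Q_zero : Q 0 = 0 := by simp [Q]

theorem cos_Q (x : ℝ) : cos (Q x) = (1 - x ^ 2) / (1 + x ^ 2) := by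
  rw [Q, cos_two_mul, cos_sq_arctan]
  field_simp; ring

theorem sin_Q (x : ℝ) : sin (Q x) = 2 * x / (1 + x ^ 2) := by
  have h : sin (Q x) = 2 * (sin (arctan x) / cos (arctan x)) * cos (arctan x) ^ 2 := by
    have := (cos_arctan_pos x).ne'
    rw [Q, sin_two_mul]; field_simp
  rw [h, cos_sq_arctan, ← tan_eq_sin_div_cos, tan_arctan]
  ring

theorem Q_one_third_pos : 0 < Q (1 / 3) := by rw [← Q_zero]; exact Q_strictMono (by norm_num)

theorem Q_one_third_le_pi : Q (1 / 3) ≤ π := by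
  have := arctan_lt_pi_div_two (1 / 3); rw [Q]; linarith

theorem cos_ge_of_abs_le {x : ℝ} (hx : |x| ≤ Q (1 / 3)) : 4 / 5 ≤ cos x := by
  have h := cos_le_cos_of_nonneg_of_le_pi (abs_nonneg x) Q_one_third_le_pi hx
  rw [cos_abs, cos_Q] at h
  norm_num at h; exact h

theorem lt_abs_of_cos_lt {x : ℝ} (hx : cos x < 4 / 5) : Q (1 / 3) < |x| := by
  by_contra! h
  linarith [cos_ge_of_abs_le h]

theorem half_mul_sub_sq_le {x y : ℝ} (hx : |x| ≤ Q (1 / 3)) (hy : |y| ≤ Q (1 / 3)) :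
    1 / 2 * (x - y) ^ 2 ≤ (sin x - sin y) * (x - y) := by
  wlog hxy : y ≤ x generalizing x y
  · have := this hy hx (le_of_not_ge hxy); nlinarith
  have h := (convex_Icc (-Q (1 / 3)) (Q (1 / 3))).mul_sub_le_image_sub_of_le_deriv (f := sin)
    continuous_sin.continuousOn differentiable_sin.differentiableOn (C := 1 / 2)
    (fun z hz => by
      rw [Real.deriv_sin]
      have hz' : z ∈ Icc (-Q (1 / 3)) (Q (1 / 3)) := interior_subset hz
      have := cos_ge_of_abs_le (abs_le.2 ⟨hz'.1, hz'.2⟩)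
      linarith) y (abs_le.1 hy) x (abs_le.1 hx) hxy
  nlinarith

theorem exists_first_hit {f : ℝ → ℝ} {b θ : ℝ} (hb : 0 < b) (hc : ContinuousOn f (Ioi 0))
    (h0 : Tendsto f (nhdsWithin 0 (Ioi 0)) (nhds 0)) (hθ : 0 < θ) (hfb : θ ≤ f b) :
    ∃ r, 0 < r ∧ r ≤ b ∧ f r = θ ∧ ∀ s, 0 < s → s ≤ r → f s ≤ θ := by
  obtain ⟨a, ha, hsmall⟩ : ∃ a > 0, ∀ s, 0 < s → s ≤ a → f s < θ := by
    have h1 : ∀ᶠ s in nhdsWithin 0 (Ioi 0), f s < θ := h0.eventually (Iio_mem_nhds hθ)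
    obtain ⟨a, ha, hsub⟩ := mem_nhdsGT_iff_exists_Ioc_subset.1 h1
    exact ⟨a, ha, fun s hs hsa => hsub ⟨hs, hsa⟩⟩
  have hab : a ≤ b := by
    by_contra! hlt
    exact absurd (hsmall b hb hlt.le) (not_lt.2 hfb)
  have hcab : ContinuousOn f (Icc a b) := hc.mono fun r hr => ha.lt.trans_le hr.1
  have hclosed : IsCompact (Icc a b ∩ f ⁻¹' Ici θ) :=
    isCompact_Icc.of_isClosed_subset (hcab.preimage_isClosed_of_isClosed isClosed_Icc isClosed_Ici)
      inter_subset_left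
  obtain ⟨r, ⟨hr, hfr⟩, hmin⟩ := hclosed.exists_isLeast ⟨b, ⟨hab, le_rfl⟩, hfb⟩
  have hlt : ∀ s, 0 < s → s < r → f s < θ := fun s hs hsr => by
    by_contra! hge
    rcases le_total s a with hsa | hsa
    · exact absurd (hsmall s hs hsa) (not_lt.2 hge)
    · exact absurd (hmin ⟨⟨hsa, hsr.le.trans hr.2⟩, hge⟩) (not_le.2 hsr)
  have hr0 : 0 < r := ha.lt.trans_le hr.1
  have hreq : f r = θ := by
    refine le_antisymm ?_ hfr
    have hct : Tendsto f (nhdsWithin r (Iio r)) (nhds (f r)) :=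
      (hc.continuousAt (Ioi_mem_nhds hr0)).tendsto.mono_left nhdsWithin_le_nhds
    refine le_of_tendsto hct ?_
    filter_upwards [Ioo_mem_nhdsLT hr0] with s hs
    exact (hlt s hs.1 hs.2).le
  exact ⟨r, hr0, hr.2, hreq, fun s hs hsr => hsr.lt_or_eq.elim (fun h => (hlt s hs h).le)
    fun h => h ▸ hreq.le⟩

theorem setIntegral_Ioc_le_of_forall {f : ℝ → ℝ} {b C : ℝ} (hb : 0 < b) (hC : 0 ≤ C)
    (hf : ∀ a, 0 < a → a ≤ b → ∫ r in a..b, f r ≤ C) : ∫ r in Ioc 0 b, f r ≤ C := by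
  by_cases hi : IntegrableOn f (Ioc 0 b)
  · have h1 : ContinuousOn (fun x => ∫ r in x..b, f r) (uIcc 0 b) :=
      intervalIntegral.continuousOn_primitive_interval_left
        (by rw [uIcc_of_le hb.le, integrableOn_Icc_iff_integrableOn_Ioc]; exact hi)
    rw [uIcc_of_le hb.le] at h1
    have h2 : Tendsto (fun x => ∫ r in x..b, f r) (nhdsWithin 0 (Ioc 0 b))
        (nhds (∫ r in (0 : ℝ)..b, f r)) :=
      (h1 0 (left_mem_Icc.2 hb.le)).mono_left (nhdsWithin_mono _ Ioc_subset_Icc_self)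
    rw [← intervalIntegral.integral_of_le hb.le]
    have : (nhdsWithin (0 : ℝ) (Ioc 0 b)).NeBot := by
      rw [nhdsWithin_Ioc_eq_nhdsGT hb]; infer_instance
    refine le_of_tendsto h2 ?_
    filter_upwards [self_mem_nhdsWithin] with a ha
    exact hf a ha.1 ha.2
  · rw [integral_undef hi]; exact hC

/-- A function which nearly solves the Bogomolny equation `r v' = sin v` and is normalized at the
scale `μ`, on which it is compared to `Q (r / μ)`. -/
structure NearBogomolny (v w : ℝ → ℝ) (μ R ε : ℝ) : Prop where
  scale_pos : 0 < μ
  one_le : 1 ≤ R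
  deriv : ∀ r, 0 < r → HasDerivAt v (w r) r
  cont : ContinuousOn w (Ioi 0)
  inner : ∀ r, 0 < r → r ≤ μ / 3 → |v r| ≤ Q (1 / 3)
  match_eq : v (μ / 3) = Q (1 / 3)
  small : ∀ a b, 0 < a → a ≤ b → b ≤ R * μ → ∫ r in a..b, (r * w r - sin (v r)) ^ 2 / r ≤ ε

namespace NearBogomolny

variable {v w : ℝ → ℝ} {μ R ε : ℝ}

theorem eps_nonneg (h : NearBogomolny v w μ R ε) : 0 ≤ ε := by
  have hp := h.scale_pos
  have := h.small μ μ hp le_rfl (by have := h.one_le; nlinarith)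
  simpa using this

theorem continuousOn (h : NearBogomolny v w μ R ε) : ContinuousOn v (Ioi 0) := fun r hr =>
  (h.deriv r hr).continuousAt.continuousWithinAt

theorem hasDerivAt_diff_sq (h : NearBogomolny v w μ R ε) {r : ℝ} (hr : 0 < r) :
    HasDerivAt (fun r => (v r - Q (r / μ)) ^ 2)
      (2 * (v r - Q (r / μ)) * ((r * w r - sin (v r)) + (sin (v r) - sin (Q (r / μ)))) / r) r := by
  have hμ := h.scale_pos
  have h1 : HasDerivAt (fun r => Q (r / μ)) (2 / (1 + (r / μ) ^ 2) * (1 / μ)) r :=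
    HasDerivAt.comp (h₂ := Q) r (hasDerivAt_Q (r / μ)) ((hasDerivAt_id r).div_const μ)
  refine (((h.deriv r hr).sub h1).pow 2).congr_deriv ?_
  rw [sin_Q]
  simp only [Nat.cast_ofNat, Nat.add_one_sub_one, pow_one, Pi.sub_apply]
  field_simp
  ring

theorem continuousOn_defect (h : NearBogomolny v w μ R ε) :
    ContinuousOn (fun r => (r * w r - sin (v r)) ^ 2 / r) (Ioi 0) := by
  have h1 := h.continuousOn
  have h2 := h.cont
  have h3 : ∀ r ∈ Ioi (0 : ℝ), r ≠ 0 := fun r hr => ne_of_gt hr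
  fun_prop (disch := assumption)

theorem continuousOn_diff_sq (h : NearBogomolny v w μ R ε) :
    ContinuousOn (fun r => (v r - Q (r / μ)) ^ 2) (Ioi 0) := fun _ hr =>
  (h.hasDerivAt_diff_sq hr).continuousAt.continuousWithinAt

theorem continuousOn_diff_sq_div (h : NearBogomolny v w μ R ε) :
    ContinuousOn (fun r => (v r - Q (r / μ)) ^ 2 / r) (Ioi 0) :=
  h.continuousOn_diff_sq.div continuousOn_id fun _ hr => ne_of_gt hr

theorem integral_inner_le (h : NearBogomolny v w μ R ε) {a : ℝ} (ha : 0 < a) (haμ : a ≤ μ / 3) :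
    ∫ r in a..μ / 3, (v r - Q (r / μ)) ^ 2 / r ≤ 4 * ε := by
  have hμ := h.scale_pos
  have hsub : Icc a (μ / 3) ⊆ Ioi 0 := fun r hr => ha.trans_le hr.1
  have cA := h.continuousOn_defect.mono hsub
  have cD := h.continuousOn_diff_sq_div.mono hsub
  have key := intervalIntegral.integral_le_sub_of_hasDeriv_right_of_le haμ
    (h.continuousOn_diff_sq.mono hsub)
    (fun x hx => (h.hasDerivAt_diff_sq (ha.trans hx.1)).hasDerivWithinAt)
    (φ := fun r => 1 / 2 * ((v r - Q (r / μ)) ^ 2 / r) - 2 * ((r * w r - sin (v r)) ^ 2 / r))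
    (((continuousOn_const.mul cD).sub (continuousOn_const.mul cA)).integrableOn_Icc)
    (fun r hr => by
      have hr0 := ha.trans hr.1
      have hq : |Q (r / μ)| ≤ Q (1 / 3) := by
        have h1 : 0 ≤ Q (r / μ) := by rw [← Q_zero]; exact Q_strictMono.monotone (by positivity)
        rw [abs_of_nonneg h1]
        refine Q_strictMono.monotone ?_
        rw [div_le_iff₀ hμ]; linarith [hr.2]
      have h2 := half_mul_sub_sq_le (h.inner r hr0 hr.2.le) hq
      have e : 1 / 2 * ((v r - Q (r / μ)) ^ 2 / r) - 2 * ((r * w r - sin (v r)) ^ 2 / r) =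
        (1 / 2 * (v r - Q (r / μ)) ^ 2 - 2 * (r * w r - sin (v r)) ^ 2) / r := by ring
      rw [e]
      refine div_le_div_of_nonneg_right ?_ hr0.le
      nlinarith [sq_nonneg ((v r - Q (r / μ)) + 2 * (r * w r - sin (v r)))])
  have hm : v (μ / 3) - Q (μ / 3 / μ) = 0 := by
    rw [h.match_eq, div_right_comm, div_self hμ.ne', sub_self]
  have i1 : IntervalIntegrable (fun r => 1 / 2 * ((v r - Q (r / μ)) ^ 2 / r)) volume a (μ / 3) :=
    (continuousOn_const.mul cD).intervalIntegrable_of_Icc haμ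
  have i2 : IntervalIntegrable (fun r => 2 * ((r * w r - sin (v r)) ^ 2 / r)) volume a (μ / 3) :=
    (continuousOn_const.mul cA).intervalIntegrable_of_Icc haμ
  rw [hm, intervalIntegral.integral_sub i1 i2, intervalIntegral.integral_const_mul, intervalIntegral.integral_const_mul] at key
  have h1 := h.small a (μ / 3) ha haμ (by have := h.one_le; nlinarith)
  have h2 := sq_nonneg (v a - Q (a / μ))
  linarith

theorem diff_sq_le (h : NearBogomolny v w μ R ε) {r : ℝ} (hr : μ / 3 ≤ r) (hrR : r ≤ R * μ) :
    (v r - Q (r / μ)) ^ 2 ≤ (3 * R) ^ 3 * ε := by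
  have hμ := h.scale_pos
  set a := μ / 3 with ha'
  have ha : 0 < a := by positivity
  have hsub : Icc a r ⊆ Ioi 0 := fun r hr => ha.trans_le hr.1
  have cA := h.continuousOn_defect.mono hsub
  have key := intervalIntegral.sub_le_integral_of_hasDeriv_right_of_le hr
    (g := fun x => (v x - Q (x / μ)) ^ 2 / x ^ 3)
    ((h.continuousOn_diff_sq.mono hsub).div (by fun_prop) fun x hx => pow_ne_zero 3 (hsub hx).ne')
    (fun x hx => ((h.hasDerivAt_diff_sq (ha.trans hx.1)).div ((hasDerivAt_id x).pow 3)
      (pow_ne_zero 3 (ha.trans hx.1).ne')).hasDerivWithinAt)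
    (φ := fun x => (a ^ 3)⁻¹ * ((x * w x - sin (v x)) ^ 2 / x))
    ((continuousOn_const.mul cA).integrableOn_Icc)
    (fun x hx => by
      have hx0 := ha.trans hx.1
      set A := x * w x - sin (v x)
      set d := v x - Q (x / μ) with hd
      have hs := abs_sin_sub_sin_le (v x) (Q (x / μ))
      set S := sin (v x) - sin (Q (x / μ))
      have h1 : d * S ≤ d ^ 2 := by
        calc d * S ≤ |d * S| := le_abs_self _
          _ = |d| * |S| := abs_mul _ _
          _ ≤ |d| * |d| := by gcongr
          _ = d ^ 2 := by rw [← sq, sq_abs]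
      have h2 : 2 * d * (A + S) - 3 * d ^ 2 ≤ A ^ 2 := by nlinarith [sq_nonneg (d - A)]
      simp only [Nat.cast_ofNat, Nat.add_one_sub_one, id, mul_one, Pi.pow_apply]
      clear_value A d S
      have e : (2 * d * (A + S) / x * x ^ 3 - d ^ 2 * (3 * x ^ 2)) / (x ^ 3) ^ 2 =
          (x ^ 3)⁻¹ * ((2 * d * (A + S) - 3 * d ^ 2) / x) := by field_simp
      rw [e]
      calc _ ≤ (x ^ 3)⁻¹ * (A ^ 2 / x) := by
            refine mul_le_mul_of_nonneg_left ?_ (by positivity)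
            exact div_le_div_of_nonneg_right h2 hx0.le
        _ ≤ (a ^ 3)⁻¹ * (A ^ 2 / x) := by
            have := hx.1
            gcongr)
  have hm : v a - Q (a / μ) = 0 := by
    rw [ha', h.match_eq, div_right_comm, div_self hμ.ne', sub_self]
  rw [hm, intervalIntegral.integral_const_mul] at key
  have h1 := h.small a r ha hr hrR
  have hr0 : 0 < r := ha.trans_le hr
  have hε := h.eps_nonneg
  have h2 : (v r - Q (r / μ)) ^ 2 / r ^ 3 ≤ (a ^ 3)⁻¹ * ε := by
    have : (a ^ 3)⁻¹ * (∫ y in a..r, (y * w y - sin (v y)) ^ 2 / y) ≤ (a ^ 3)⁻¹ * ε := by gcongr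
    simp only [ne_eq, OfNat.ofNat_ne_zero, not_false_eq_true, zero_pow, zero_div, sub_zero] at key
    linarith
  rw [div_le_iff₀ (by positivity)] at h2
  calc _ ≤ (a ^ 3)⁻¹ * ε * r ^ 3 := h2
    _ ≤ (a ^ 3)⁻¹ * ε * (R * μ) ^ 3 := by gcongr
    _ = _ := by rw [ha']; field_simp

theorem integrand_le (h : NearBogomolny v w μ R ε) {r : ℝ} (hr : 0 < r) :
    ((w r - 1 / μ * _root_.deriv Q (r / μ)) ^ 2 + (v r - Q (r / μ)) ^ 2 / r ^ 2) * r ≤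
      2 * ((r * w r - sin (v r)) ^ 2 / r) + 3 * ((v r - Q (r / μ)) ^ 2 / r) := by
  have hμ := h.scale_pos
  rw [(hasDerivAt_Q _).deriv]
  have hs := abs_sin_sub_sin_le (v r) (Q (r / μ))
  rw [← sq_le_sq] at hs
  have e : w r - 1 / μ * (2 / (1 + (r / μ) ^ 2)) =
      ((r * w r - sin (v r)) + (sin (v r) - sin (Q (r / μ)))) / r := by
    have : sin (Q (r / μ)) = r / μ * (2 / (1 + (r / μ) ^ 2)) := by rw [sin_Q]; ring
    rw [this]; field_simp; ring
  rw [e]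
  set A := r * w r - sin (v r)
  set S := sin (v r) - sin (Q (r / μ))
  set d := v r - Q (r / μ)
  clear_value A S d
  have e2 : (((A + S) / r) ^ 2 + d ^ 2 / r ^ 2) * r = ((A + S) ^ 2 + d ^ 2) / r := by field_simp
  have e3 : 2 * (A ^ 2 / r) + 3 * (d ^ 2 / r) = (2 * A ^ 2 + 3 * d ^ 2) / r := by ring
  rw [e2, e3]
  refine div_le_div_of_nonneg_right ?_ hr.le
  nlinarith [sq_nonneg (A - S)]

theorem setIntegral_le (h : NearBogomolny v w μ R ε) {b : ℝ} (hb : b ≤ R * μ) :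
    ∫ r in Ioc 0 b,
      ((w r - 1 / μ * _root_.deriv Q (r / μ)) ^ 2 + (v r - Q (r / μ)) ^ 2 / r ^ 2) * r ≤
      (14 + 3 * (3 * R) ^ 4) * ε := by
  have hμ := h.scale_pos
  have hR := h.one_le
  have hε := h.eps_nonneg
  have hRμ : μ / 3 ≤ R * μ := by nlinarith
  rcases le_or_gt b 0 with hb0 | hb0
  · rw [Ioc_eq_empty (not_lt.2 hb0), setIntegral_empty]; positivity
  refine setIntegral_Ioc_le_of_forall hb0 (by positivity) fun a ha hab' => ?_
  have hab := hab'.trans hb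
  have hsub : Icc a (R * μ) ⊆ Ioi 0 := fun r hr => ha.trans_le hr.1
  have cA := h.continuousOn_defect.mono hsub
  have cD := h.continuousOn_diff_sq_div.mono hsub
  have hQ' : _root_.deriv Q = fun x => 2 / (1 + x ^ 2) := funext fun x => (hasDerivAt_Q x).deriv
  have cf : ContinuousOn (fun r => ((w r - 1 / μ * _root_.deriv Q (r / μ)) ^ 2
      + (v r - Q (r / μ)) ^ 2 / r ^ 2) * r) (Icc a (R * μ)) := by
    have c1 := h.cont.mono hsub
    have c2 := h.continuousOn_diff_sq.mono hsub
    have c3 : ∀ r ∈ Icc a (R * μ), r ^ 2 ≠ 0 := fun r hr => pow_ne_zero 2 (hsub hr).ne'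
    have c4 : Continuous fun r : ℝ => 2 / (1 + (r / μ) ^ 2) := by
      have : ∀ r : ℝ, 1 + (r / μ) ^ 2 ≠ 0 := fun r => by positivity
      fun_prop (disch := assumption)
    have c5 : ContinuousOn (fun r => (v r - Q (r / μ)) ^ 2 / r ^ 2) (Icc a (R * μ)) :=
      c2.div (by fun_prop) c3
    rw [hQ']
    exact (((c1.sub (continuous_const.mul c4).continuousOn).pow 2).add c5).mul continuousOn_id
  have i1 : IntervalIntegrable (fun r => 2 * ((r * w r - sin (v r)) ^ 2 / r))
      volume a (R * μ) := (continuousOn_const.mul cA).intervalIntegrable_of_Icc hab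
  have i2 : IntervalIntegrable (fun r => 3 * ((v r - Q (r / μ)) ^ 2 / r))
      volume a (R * μ) := (continuousOn_const.mul cD).intervalIntegrable_of_Icc hab
  have h1 := intervalIntegral.integral_mono_on hab (cf.intervalIntegrable_of_Icc hab)
    (i1.add i2) fun r hr => h.integrand_le (hsub hr)
  rw [intervalIntegral.integral_add i1 i2, intervalIntegral.integral_const_mul, intervalIntegral.integral_const_mul] at h1
  have h2 := h.small a (R * μ) ha hab le_rfl
  have hD : ∫ r in a..R * μ, (v r - Q (r / μ)) ^ 2 / r ≤ 4 * ε + (3 * R) ^ 4 * ε := by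
    set m := min a (μ / 3) with hm
    have hm0 : 0 < m := lt_min ha (by positivity)
    have iD : ∀ x y, 0 < x → 0 < y →
        IntervalIntegrable (fun r => (v r - Q (r / μ)) ^ 2 / r) volume x y := fun x y hx hy =>
      (h.continuousOn_diff_sq_div.mono fun z hz => (lt_min hx hy).trans_le hz.1).intervalIntegrable
    have h3 : ∫ r in a..R * μ, (v r - Q (r / μ)) ^ 2 / r ≤
        ∫ r in m..R * μ, (v r - Q (r / μ)) ^ 2 / r := by
      refine intervalIntegral.integral_mono_interval (min_le_left _ _) hab le_rfl ?_
        (iD _ _ hm0 (by positivity))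
      filter_upwards [ae_restrict_mem measurableSet_Ioc] with r hr
      have := hm0.trans hr.1
      simp only [Pi.zero_apply]; positivity
    have h4 := h.integral_inner_le hm0 (min_le_right _ _)
    have h5 : ∫ r in μ / 3..R * μ, (v r - Q (r / μ)) ^ 2 / r ≤
        ∫ _ in μ / 3..R * μ, (3 * R) ^ 3 * ε / (μ / 3) := by
      refine intervalIntegral.integral_mono_on hRμ (iD _ _ (by positivity) (by positivity))
        intervalIntegrable_const fun r hr => ?_
      have := hr.1
      exact div_le_div₀ (by positivity) (h.diff_sq_le hr.1 hr.2) (by positivity) hr.1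
    rw [intervalIntegral.integral_const, smul_eq_mul] at h5
    have h6 : (R * μ - μ / 3) * ((3 * R) ^ 3 * ε / (μ / 3)) ≤
        (R * μ) * ((3 * R) ^ 3 * ε / (μ / 3)) := by
      gcongr; linarith
    have h7 : (R * μ) * ((3 * R) ^ 3 * ε / (μ / 3)) = (3 * R) ^ 4 * ε := by field_simp
    rw [← intervalIntegral.integral_add_adjacent_intervals (iD m (μ / 3) hm0 (by positivity))
      (iD (μ / 3) (R * μ) (by positivity) (by positivity))] at h3
    linarith
  have h8 := intervalIntegral.integral_mono_interval (μ := volume) le_rfl hab' hb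
    (by
      filter_upwards [ae_restrict_mem measurableSet_Ioc] with r hr
      have := ha.trans hr.1
      simp only [Pi.zero_apply]; positivity)
    (cf.intervalIntegrable_of_Icc hab)
  linarith

end NearBogomolny

namespace DegOneWave

variable {ψ : ℝ → ℝ → ℝ}

theorem intervalIntegral_le_setIntegral {f : ℝ → ℝ} {a b c : ℝ} (hf : IntegrableOn f (Ioi 0))
    (hf0 : ∀ r, 0 < r → 0 ≤ f r) (ha : 0 < a) (hab : a ≤ b) (hbc : b ≤ c) :
    ∫ r in a..b, f r ≤ ∫ r in Ioc 0 c, f r := by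
  rw [intervalIntegral.integral_of_le hab]
  refine setIntegral_mono_set (hf.mono_set Ioc_subset_Ioi_self) ?_
    (Ioc_subset_Ioc ha.le hbc).eventuallyLE
  filter_upwards [ae_restrict_mem measurableSet_Ioc] with r hr
  exact hf0 r hr.1

theorem intervalIntegral_amp_le (h : DegOneWave ψ) {t a b c : ℝ} (ht : 0 < t) (ha : 0 < a)
    (hab : a ≤ b) (hbc : b ≤ c) :
    ∫ r in a..b, amp ψ t r ^ 2 / r ≤ ∫ r in Ioc 0 c, amp ψ t r ^ 2 / r :=
  intervalIntegral_le_setIntegral (h.integrableOn_amp_sq ht) (fun _ _ => by positivity) ha hab hbc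

/-- The Bogomolny identity for the local energy. -/
theorem locE_eq_bogomolny (h : DegOneWave ψ) {t a b : ℝ} (ht : 0 < t) (ha : 0 < a) (hab : a ≤ b) :
    locE ψ t a b = (∫ r in a..b, pT ψ t r ^ 2 * r) + (∫ r in a..b, amp ψ t r ^ 2 / r) +
      2 * (cos (ψ t a) - cos (ψ t b)) := by
  have hb := ha.trans_le hab
  have hsub : uIcc a b ⊆ Ioi 0 := fun r hr => (lt_min ha hb).trans_le hr.1
  have h1 := continuousOn_slice h.continuousOn_pR ht
  have h2 := continuousOn_slice h.continuousOn ht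
  have i3 : IntervalIntegrable (fun r => 2 * (sin (ψ t r) * pR ψ t r)) volume a b :=
    ((continuousOn_const.mul ((continuous_sin.comp_continuousOn h2).mul h1)).mono
      hsub).intervalIntegrable
  have hftc := intervalIntegral.integral_eq_sub_of_hasDerivAt (a := a) (b := b)
    (f := fun r => -2 * cos (ψ t r)) (f' := fun r => 2 * (sin (ψ t r) * pR ψ t r))
    (fun r hr => ((h.hasDerivAt_r ht (hsub hr)).cos.const_mul (-2)).congr_deriv (by ring)) i3
  have i1 : IntervalIntegrable (fun r => pT ψ t r ^ 2 * r) volume a b :=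
    (intervalIntegrable_iff_integrableOn_Ioc_of_le hab).2
      ((h.integrableOn_pT_sq ht).mono_set fun r hr => ha.trans hr.1)
  have i2 : IntervalIntegrable (fun r => amp ψ t r ^ 2 / r) volume a b :=
    (intervalIntegrable_iff_integrableOn_Ioc_of_le hab).2
      ((h.integrableOn_amp_sq ht).mono_set fun r hr => ha.trans hr.1)
  rw [locE_eq_intervalIntegral hab]
  have e : ∫ r in a..b, eDen ψ t r = ∫ r in a..b, (pT ψ t r ^ 2 * r + amp ψ t r ^ 2 / r +
      2 * (sin (ψ t r) * pR ψ t r)) := by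
    refine intervalIntegral.integral_congr fun r hr => ?_
    have hr0 : 0 < r := hsub hr
    rw [eDen_eq ψ t hr0, amp]
    field_simp
    ring
  rw [e, intervalIntegral.integral_add (i1.add i2) i3, intervalIntegral.integral_add i1 i2, hftc]
  ring

theorem cos_le_of_one_le_locE (h : DegOneWave ψ) {t b ε : ℝ} (ht : 0 < t) (hb : 0 < b)
    (hT : ∫ r in Ioc 0 b, pT ψ t r ^ 2 * r ≤ ε) (hA : ∫ r in Ioc 0 b, amp ψ t r ^ 2 / r ≤ ε)
    (hE : 1 ≤ locE ψ t 0 b) : cos (ψ t b) ≤ 1 / 2 + ε := by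
  have key : 1 ≤ 0 + (2 * ε + 2 * (1 - cos (ψ t b))) := by
    refine ge_of_tendsto ((h.tendsto_locE_zero ht).add_const _) ?_
    filter_upwards [Ioc_mem_nhdsGT hb] with a ha
    have h1 := h.locE_add_locE ht le_rfl ha.1.le ha.2
    have h2 := h.locE_eq_bogomolny ht ha.1 ha.2
    have h3 := h.intervalIntegral_amp_le ht ha.1 ha.2 le_rfl
    have h4 := intervalIntegral_le_setIntegral (h.integrableOn_pT_sq ht)
      (fun _ _ => by positivity) ha.1 ha.2 le_rfl
    have h5 := cos_le_one (ψ t a)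
    linarith
  linarith

theorem exists_nearBogomolny (h : DegOneWave ψ) {t b R ε : ℝ} (ht : 0 < t) (hb : 0 < b)
    (hR : 1 ≤ R) (hA : ∫ r in Ioc 0 (3 * R * b), amp ψ t r ^ 2 / r ≤ ε)
    (hcos : cos (ψ t b) < 4 / 5) :
    ∃ μ, 0 < μ ∧ μ ≤ 3 * b ∧ (NearBogomolny (ψ t) (pR ψ t) μ R ε ∨
      NearBogomolny (fun r => -ψ t r) (fun r => -pR ψ t r) μ R ε) := by
  have hc := continuousOn_slice h.continuousOn ht
  have hc' := continuousOn_slice h.continuousOn_pR ht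
  have h0 : Tendsto (fun r => |ψ t r|) (nhdsWithin 0 (Ioi 0)) (nhds 0) := by
    simpa using (h.bc t ht.le).1.abs
  obtain ⟨r, hr, hrb, hψ, hin⟩ := exists_first_hit hb (continuous_abs.comp_continuousOn hc) h0
    Q_one_third_pos (lt_abs_of_cos_lt hcos).le
  have e3 : 3 * r / 3 = r := by ring
  have hs : ∀ x y, 0 < x → x ≤ y → y ≤ R * (3 * r) →
      ∫ s in x..y, amp ψ t s ^ 2 / s ≤ ε := fun x y hx hxy hy =>
    (h.intervalIntegral_amp_le ht hx hxy (hy.trans (by nlinarith))).trans hA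
  refine ⟨3 * r, by positivity, by linarith, ?_⟩
  have hψ' : |ψ t r| = Q (1 / 3) := hψ
  rcases abs_choice (ψ t r) with hσ | hσ
  · exact Or.inl ⟨by positivity, hR, fun s hs => h.hasDerivAt_r ht hs, hc',
      fun s hs1 hs2 => hin s hs1 (by rwa [e3] at hs2), by rw [e3, ← hσ, hψ'], hs⟩
  · refine Or.inr ⟨by positivity, hR, fun s hs => (h.hasDerivAt_r ht hs).neg, hc'.neg,
      fun s hs1 hs2 => ?_, by rw [e3, ← hσ, hψ'], fun x y hx hxy hy => ?_⟩
    · rw [abs_neg]; exact hin s hs1 (by rwa [e3] at hs2)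
    · refine le_of_eq_of_le ?_ (hs x y hx hxy hy)
      congr 1; funext s
      rw [sin_neg, amp]; ring

/-- Connecting `0` to `-π` and then to `π` costs too much energy. -/
theorem not_nearBogomolny_neg (h : DegOneWave ψ) {t μ R ε δ : ℝ} (ht : 0 < t) (hδ : 0 ≤ δ)
    (hδ1 : δ ≤ 1 / 2) (hεδ : (3 * R) ^ 3 * ε ≤ δ ^ 2)
    (hE : totE ψ 0 + 4 * (2 / (1 + R ^ 2) + δ) < 12) :
    ¬ NearBogomolny (fun r => -ψ t r) (fun r => -pR ψ t r) μ R ε := fun hN => by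
  have hμ := hN.scale_pos
  have hR := hN.one_le
  have hR0 : 0 < R * μ := by positivity
  have hd := hN.diff_sq_le (r := R * μ) (by nlinarith) le_rfl
  rw [mul_div_cancel_right₀ _ hμ.ne'] at hd
  have hd' := abs_le_of_sq_le_sq' (hd.trans hεδ) hδ
  have hc := abs_le.1 (abs_cos_sub_cos_le (-ψ t (R * μ)) (Q R))
  have hda : |-ψ t (R * μ) - Q R| ≤ δ := abs_le.2 hd'
  rw [cos_neg, cos_Q] at hc
  have e : (1 - R ^ 2) / (1 + R ^ 2) = -1 + 2 / (1 + R ^ 2) := by field_simp; ring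
  rw [e] at hc
  have hQ : π / 2 ≤ Q R := by
    have h1 : Q 1 ≤ Q R := Q_strictMono.monotone hR
    rw [Q, arctan_one] at h1; linarith
  have hneg : ψ t (R * μ) ≤ 0 := by linarith [pi_gt_three, hd'.1]
  obtain ⟨r', hr', hψ'⟩ : ∃ r' ≥ R * μ, ψ t r' = 0 := by
    have hev : ∀ᶠ r in atTop, 0 < ψ t r := (h.bc t ht.le).2.eventually (Ioi_mem_nhds pi_pos)
    obtain ⟨b, hb, hb'⟩ := (hev.and (eventually_ge_atTop (R * μ))).exists
    have hcont : ContinuousOn (ψ t) (Icc (R * μ) b) :=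
      (continuousOn_slice h.continuousOn ht).mono fun r hr => hR0.trans_le hr.1
    obtain ⟨r', hr', e'⟩ := intermediate_value_Icc hb' hcont ⟨hneg, hb.le⟩
    exact ⟨r', hr'.1, e'⟩
  have hr'0 := hR0.trans_le hr'
  have h1 := h.one_sub_cos_le ht hR0
  have h2 := (abs_le.1 (h.abs_cos_sub_cos_le_locE ht hR0 hr')).2
  have h3 := h.one_add_cos_le_outE ht hr'0
  have h4 := h.locE_add_outE ht hR0.le
  have h5 := h.locE_add_outE_of_le ht hR0.le hr'
  rw [hψ', cos_zero] at h2 h3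
  linarith [hc.2]

end DegOneWave

namespace DegOneWave

variable {ψ : ℝ → ℝ → ℝ}

/-- Arbitrarily late times at which `ψ` is close to a rescaled `Q` on a prescribed multiple of its
scale, while the kinetic energy inside a slightly smaller cone is small. -/
theorem exists_time_close_to_Q (h : DegOneWave ψ) {ε : ℝ} (hε : 0 < ε) (R T0 : ℝ) :
    ∃ τ lam A, T0 ≤ τ ∧ 0 < lam ∧ T0 ≤ A ∧ lam ≤ A ∧ 0 ≤ A / τ ∧ A / τ ≤ ε ∧
      |R * lam / τ| ≤ ε ∧ ∫ r in Ioc 0 (τ - A), pT ψ τ r ^ 2 * r ≤ ε ∧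
      ∫ r in Ioc 0 (R * lam), ((pR ψ τ r - 1 / lam * deriv Q (r / lam)) ^ 2
        + (ψ τ r - Q (r / lam)) ^ 2 / r ^ 2) * r ≤ ε := by
  set gap := 12 - totE ψ 0 with hgap'
  have hgap : 0 < gap := sub_pos.2 h.small
  obtain ⟨R', hR1, hRR, hRg⟩ : ∃ R', 1 ≤ R' ∧ |R| ≤ R' ∧ 16 / gap ≤ R' :=
    ⟨max 1 (max |R| (16 / gap)), le_max_left _ _, (le_max_left _ _).trans (le_max_right _ _),
      (le_max_right _ _).trans (le_max_right _ _)⟩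
  have hR0 : 0 < R' := by linarith
  obtain ⟨δ, hδ0, hδ1, hδg⟩ : ∃ δ, 0 < δ ∧ δ ≤ 1 / 2 ∧ δ ≤ gap / 16 :=
    ⟨min (1 / 2) (gap / 16), by positivity, min_le_left _ _, min_le_right _ _⟩
  have hE : totE ψ 0 + 4 * (2 / (1 + R' ^ 2) + δ) < 12 := by
    have h1 : 2 / (1 + R' ^ 2) ≤ gap / 8 := by
      rw [div_le_iff₀ hgap] at hRg
      rw [div_le_div_iff₀ (by positivity) (by norm_num)]
      nlinarith
    linarith
  obtain ⟨ε1, hε1, hε1ε, hε1', hε1C, hε1δ⟩ : ∃ ε1, 0 < ε1 ∧ ε1 ≤ ε ∧ ε1 ≤ 1 / 10 ∧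
      (14 + 3 * (3 * R') ^ 4) * ε1 ≤ ε ∧ (3 * R') ^ 3 * ε1 ≤ δ ^ 2 := by
    refine ⟨min (min ε (1 / 10)) (min (ε / (14 + 3 * (3 * R') ^ 4)) (δ ^ 2 / (3 * R') ^ 3)),
      by positivity, (min_le_left _ _).trans (min_le_left _ _),
      (min_le_left _ _).trans (min_le_right _ _), ?_, ?_⟩
    · rw [← le_div_iff₀' (by positivity)]
      exact (min_le_right _ _).trans (min_le_left _ _)
    · rw [← le_div_iff₀' (by positivity)]
      exact (min_le_right _ _).trans (min_le_right _ _)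
  obtain ⟨η, hη, hη1, hηε⟩ : ∃ η, 0 < η ∧ R' * η ≤ 1 / 96 ∧ R' * η ≤ ε / 24 := by
    refine ⟨min (1 / 96) (ε / 24) / R', by positivity, ?_, ?_⟩ <;> rw [mul_div_cancel₀ _ hR0.ne']
    exacts [min_le_left _ _, min_le_right _ _]
  have hη' : η ≤ R' * η := le_mul_of_one_le_left hη.le hR1
  obtain ⟨κ, hκ, hκ1, hκε⟩ : ∃ κ, 0 < κ ∧ κ ≤ 1 / 2 ∧ κ ≤ ε :=
    ⟨min (1 / 2) ε, by positivity, min_le_left _ _, min_le_right _ _⟩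
  obtain ⟨c, hc, hc1, τ, hτT, hτ1, l, hl, hlη, hEl, hA, hT⟩ := h.exists_good_time
    (K := 24 * R') (T1 := max T0 (T0 / ε)) hε1 (by positivity) hη (by linarith) (by linarith) hκ
  have hτ : 0 < τ := by linarith
  have hlc : 2 * l ≤ c * τ := by nlinarith
  have hA' : ∫ r in Ioc 0 (3 * R' * (2 * l)), amp ψ τ r ^ 2 / r ≤ ε1 := by
    rwa [show 24 * R' * l / 4 = 3 * R' * (2 * l) by ring] at hA
  have hcos : cos (ψ τ (2 * l)) < 4 / 5 := by
    have h1 := h.cos_le_of_one_le_locE hτ (by positivity : 0 < 2 * l)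
      ((setIntegral_mono_set ((h.integrableOn_pT_sq hτ).mono_set Ioc_subset_Ioi_self)
        (by
          filter_upwards [ae_restrict_mem measurableSet_Ioc] with r hr
          have := hr.1
          simp only [Pi.zero_apply]; positivity)
        (Ioc_subset_Ioc_right hlc).eventuallyLE).trans hT)
      ((setIntegral_mono_set ((h.integrableOn_amp_sq hτ).mono_set Ioc_subset_Ioi_self)
        (by
          filter_upwards [ae_restrict_mem measurableSet_Ioc] with r hr
          have := hr.1
          simp only [Pi.zero_apply]; positivity)
        (Ioc_subset_Ioc_right (by nlinarith)).eventuallyLE).trans hA') hEl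
    linarith
  obtain ⟨μ, hμ, hμl, hN⟩ := h.exists_nearBogomolny hτ (by positivity) hR1 hA' hcos
  have hN' := hN.resolve_right (h.not_nearBogomolny_neg hτ hδ0.le hδ1 hε1δ hE)
  have hRμ : R' * μ ≤ ε * τ := by
    calc R' * μ ≤ R' * (24 * (η * τ)) := by gcongr; linarith
      _ = 24 * (R' * η) * τ := by ring
      _ ≤ ε * τ := by gcongr; linarith
  have hAτ : (1 - c) * τ ≤ max ((1 - c) * τ) (max μ T0) := le_max_left _ _
  have hμA : μ ≤ max ((1 - c) * τ) (max μ T0) := (le_max_left _ _).trans (le_max_right _ _)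
  refine ⟨τ, μ, max ((1 - c) * τ) (max μ T0), (le_max_left _ _).trans hτT, hμ,
    (le_max_right _ _).trans (le_max_right _ _), hμA, div_nonneg (hμ.le.trans hμA) hτ.le, ?_, ?_,
    ?_, ?_⟩
  · rw [div_le_iff₀ hτ]
    refine max_le (by gcongr; linarith) (max_le (by nlinarith) ?_)
    have h1 := (le_max_right _ _).trans hτT
    rwa [div_le_iff₀' hε] at h1
  · rw [abs_div, abs_mul, abs_of_pos hμ, abs_of_pos hτ, div_le_iff₀ hτ]
    refine le_trans ?_ hRμ
    gcongr
  · refine (setIntegral_mono_set ((h.integrableOn_pT_sq hτ).mono_set Ioc_subset_Ioi_self) ?_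
      (Ioc_subset_Ioc_right (by linarith)).eventuallyLE).trans (hT.trans hε1ε)
    filter_upwards [ae_restrict_mem measurableSet_Ioc] with r hr
    have := hr.1
    simp only [Pi.zero_apply]; positivity
  · have hb : R * μ ≤ R' * μ := by gcongr; exact (le_abs_self R).trans hRR
    exact (hN'.setIntegral_le hb).trans hε1C

end DegOneWave

/-- diagonal extraction of times `τₙ` and scales `λₙ` along which the kinetic
energy in the truncated cone vanishes and `ψ⃗(τₙ)` converges to `Q(·/λₙ)` on `r ≤ αₙλₙ`. -/
theorem stmt10_diagonal_extraction
    (ψ : ℝ → ℝ → ℝ) (α : ℕ → ℝ)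
    (hwm : IsWaveMap ψ) (hfe : FiniteEnergy ψ) (hcons : EnergyConserved ψ)
    (hbc : DegreeOneBC ψ)
    (hE3 : totE ψ 0 < 12)
    (hα : Filter.Tendsto α Filter.atTop Filter.atTop) :
    ∃ τ lam A : ℕ → ℝ,
      Filter.Tendsto τ Filter.atTop Filter.atTop ∧
      (∀ n, 0 < lam n) ∧
      Filter.Tendsto (fun n => α n * lam n / τ n) Filter.atTop (nhds 0) ∧
      Filter.Tendsto A Filter.atTop Filter.atTop ∧
      (∀ n, lam n ≤ A n) ∧
      Filter.Tendsto (fun n => A n / τ n) Filter.atTop (nhds 0) ∧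
      Filter.Tendsto
        (fun n => ∫ r in Set.Ioc 0 (τ n - A n), (pT ψ (τ n) r) ^ 2 * r)
        Filter.atTop (nhds 0) ∧
      Filter.Tendsto
        (fun n => ∫ r in Set.Ioc 0 (α n * lam n),
          ((pR ψ (τ n) r - (1 / lam n) * deriv Q (r / lam n)) ^ 2
            + (ψ (τ n) r - Q (r / lam n)) ^ 2 / r ^ 2) * r)
        Filter.atTop (nhds 0) := by
  have h : DegOneWave ψ := ⟨hwm, hfe, hcons, hbc, hE3⟩
  choose τ lam A hτ hlam hA hlamA hAτ0 hAτ hατ hT hQ using fun n : ℕ =>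
    h.exists_time_close_to_Q (one_div_pos.2 (n.cast_add_one_pos : (0 : ℝ) < n + 1)) (α n) n
  have h0 : Tendsto (fun n : ℕ => 1 / ((n : ℝ) + 1)) atTop (nhds 0) :=
    tendsto_one_div_add_atTop_nhds_zero_nat
  refine ⟨τ, lam, A, tendsto_atTop_mono hτ tendsto_natCast_atTop_atTop, hlam,
    squeeze_zero_norm hατ h0, tendsto_atTop_mono hA tendsto_natCast_atTop_atTop, hlamA,
    squeeze_zero hAτ0 hAτ h0, squeeze_zero (fun n => ?_) hT h0, squeeze_zero (fun n => ?_) hQ h0⟩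
  all_goals
    refine setIntegral_nonneg measurableSet_Ioc fun r hr => ?_
    have := hr.1
    positivity
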